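/- arXiv:2406.04154 — 3 statements merged into one kernel-verified Lean document; each statement's English description precedes it below -/
import Mathlib

section
/- For every r ≥ 4 there is a constant c₀(r) > 0 such that, setting m := 5r², for every integer 0 ≤ f ≤ binom(m,r) there exists an ordered graph H on vertex set U = {u₁ < u₂ < ... < u_{m−r+2}} whose total weight w_U(H) := Σ_{u_iu_j ∈ E(H), i<j} binom(m−j, r−2) equals f, and which satisfies the ordered EH-property with constant c₀(r). -/
open Classical

/-- An ordered graph `H` (on the linearly ordered vertex set `Fin N`) satisfies the
ordered EH-property with constant `c` if every finite ordered graph with no induced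
order-preserving copy of `H` has a homogeneous set (clique or independent set) of size
at least `n^c`, where `n` is its number of vertices. -/
def OrderedEH {N : ℕ} (H : SimpleGraph (Fin N)) (c : ℝ) : Prop :=
  ∀ (V : Type) [Fintype V] [LinearOrder V] (G : SimpleGraph V),
    (¬ ∃ φ : Fin N → V, StrictMono φ ∧ ∀ i j : Fin N, G.Adj (φ i) (φ j) ↔ H.Adj i j) →
    ∃ S : Finset V, (Fintype.card V : ℝ) ^ c ≤ (S.card : ℝ) ∧
      ((∀ x ∈ S, ∀ y ∈ S, x ≠ y → G.Adj x y) ∨ (∀ x ∈ S, ∀ y ∈ S, ¬ G.Adj x y))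

/-- If every vertex of `A` has fewer than `d` larger `R`-neighbours in `A`, then some subset of `A`
of size at least `|A| / d` spans no `R`-pair. -/
lemma exists_large_subset_of_forward_degree_lt {V : Type} [LinearOrder V] (R : V → V → Prop)
    (d : ℕ) (A : Finset V) (hA : ∀ v ∈ A, {w ∈ A | v < w ∧ R v w}.card < d) :
    ∃ I ⊆ A, A.card ≤ d * I.card ∧ ∀ v ∈ I, ∀ w ∈ I, v < w → ¬ R v w := by
  induction A using Finset.strongInduction with
  | H A ih =>
    rcases A.eq_empty_or_nonempty with rfl | hne
    · exact ⟨∅, by simp, by simp, by simp⟩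
    set v := A.min' hne with hv
    have hvA : v ∈ A := A.min'_mem hne
    set N := {w ∈ A | v < w ∧ R v w} with hN
    have hvN : v ∉ N := by simp [hN]
    have hsub : insert v N ⊆ A := by
      intro w hw
      rcases Finset.mem_insert.1 hw with rfl | hw
      · exact hvA
      · exact (Finset.mem_filter.1 hw).1
    have hB : A \ insert v N ⊂ A :=
      Finset.sdiff_ssubset hsub ⟨v, Finset.mem_insert_self _ _⟩
    obtain ⟨I, hI, hcard, hind⟩ := ih _ hB (fun w hw => lt_of_le_of_lt
      (Finset.card_le_card (Finset.filter_subset_filter _ hB.1)) (hA w (hB.1 hw)))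
    have hvI : v ∉ I := fun h => by simpa using hI h
    refine ⟨insert v I, ?_, ?_, ?_⟩
    · intro w hw
      rcases Finset.mem_insert.1 hw with rfl | hw
      · exact hvA
      · exact hB.1 (hI hw)
    · have h1 := Finset.card_sdiff_add_card_eq_card hsub
      rw [Finset.card_insert_of_notMem hvN] at h1
      have h2 : N.card < d := by convert hA v hvA
      rw [Finset.card_insert_of_notMem hvI, mul_add]
      omega
    · intro x hx y hy hxy
      rcases Finset.mem_insert.1 hx with rfl | hx
      · rcases Finset.mem_insert.1 hy with rfl | hy
        · exact absurd hxy (lt_irrefl _)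
        · intro hR
          have := hI hy
          simp only [Finset.mem_sdiff, Finset.mem_insert, not_or] at this
          exact this.2.2 (Finset.mem_filter.2 ⟨this.1, hxy, hR⟩)
      · rcases Finset.mem_insert.1 hy with rfl | hy
        · exact absurd hxy (not_lt.2 (A.min'_le _ (hB.1 (hI hx))))
        · exact hind x hx y hy hxy

/-- A set of vertices of `G` that is a clique or an independent set. -/
def IsHomogeneous {V : Type} (G : SimpleGraph V) (S : Finset V) : Prop :=
  (∀ x ∈ S, ∀ y ∈ S, x ≠ y → G.Adj x y) ∨ (∀ x ∈ S, ∀ y ∈ S, ¬ G.Adj x y)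

lemma isHomogeneous_of_forall_lt {V : Type} [LinearOrder V] (G : SimpleGraph V) (Q : Prop)
    (S : Finset V) (h : ∀ v ∈ S, ∀ w ∈ S, v < w → ¬ (G.Adj v w ↔ Q)) : IsHomogeneous G S := by
  by_cases hQ : Q
  · right
    intro x hx y hy hxy
    rcases lt_trichotomy x y with hlt | rfl | hlt
    · exact h x hx y hy hlt (by simp [hQ, hxy])
    · exact G.irrefl hxy
    · exact h y hy x hx hlt (by simp [hQ, hxy.symm])
  · left
    intro x hx y hy hxy
    rcases lt_or_gt_of_ne hxy with hlt | hlt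
    · have := h x hx y hy hlt
      simpa [hQ] using this
    · have := h y hy x hx hlt
      exact SimpleGraph.Adj.symm (by simpa [hQ] using this)

lemma exists_forward_neighbours_or_homogeneous {V : Type} [LinearOrder V] (G : SimpleGraph V)
    (Q : Prop) (t n : ℕ) (ht : 0 < t) (A : Finset V) (hA : t ^ (n + 1) ≤ A.card) :
    (∃ v ∈ A, t ^ n ≤ {w ∈ A | v < w ∧ (G.Adj v w ↔ Q)}.card) ∨
      ∃ S : Finset V, t ≤ S.card ∧ IsHomogeneous G S := by
  by_cases h : ∃ v ∈ A, t ^ n ≤ {w ∈ A | v < w ∧ (G.Adj v w ↔ Q)}.card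
  · exact Or.inl h
  · push Not at h
    obtain ⟨I, -, hcard, hI⟩ :=
      exists_large_subset_of_forward_degree_lt (fun v w => G.Adj v w ↔ Q) (t ^ n) A
        fun v hv => lt_of_eq_of_lt (by congr) (h v hv)
    refine Or.inr ⟨I, ?_, isHomogeneous_of_forall_lt G Q I hI⟩
    rw [pow_succ] at hA
    exact Nat.le_of_mul_le_mul_left (hA.trans hcard) (pow_pos ht n)

lemma exists_backward_neighbours_or_homogeneous {V : Type} [LinearOrder V] (G : SimpleGraph V)
    (Q : Prop) (t n : ℕ) (ht : 0 < t) (A : Finset V) (hA : t ^ (n + 1) ≤ A.card) :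
    (∃ v ∈ A, t ^ n ≤ {w ∈ A | w < v ∧ (G.Adj v w ↔ Q)}.card) ∨
      ∃ S : Finset V, t ≤ S.card ∧ IsHomogeneous G S :=
  exists_forward_neighbours_or_homogeneous (V := Vᵒᵈ) G Q t n ht A hA

/-- The map `φ` embeds the ordered graph on `[a, b)` whose pairs `i < j` are edges iff
`(p i ≤ j ↔ P)` into `G[A]`. -/
structure IsCopy {V : Type} [LinearOrder V] (G : SimpleGraph V) (p : ℕ → ℕ) (P : Prop) (a b : ℕ)
    (A : Finset V) (φ : ℕ → V) : Prop where
  mem : ∀ i, a ≤ i → i < b → φ i ∈ A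
  lt : ∀ i j, a ≤ i → i < j → j < b → φ i < φ j
  adj : ∀ i j, a ≤ i → i < j → j < b → (G.Adj (φ i) (φ j) ↔ (p i ≤ j ↔ P))

lemma IsCopy.extend_left {V : Type} [LinearOrder V] {G : SimpleGraph V} {p : ℕ → ℕ} {P : Prop}
    {a b : ℕ} {A : Finset V} {φ : ℕ → V} (Q : Prop) {v : V} (hv : v ∈ A)
    (h : IsCopy G p P (a + 1) b {w ∈ A | v < w ∧ (G.Adj v w ↔ Q)} φ)
    (hQ : ∀ j, a < j → j < b → ((p a ≤ j ↔ P) ↔ Q)) :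
    IsCopy G p P a b A (fun i => if i = a then v else φ i) := by
  have hmem : ∀ i, a < i → i < b → φ i ∈ A ∧ v < φ i ∧ (G.Adj v (φ i) ↔ Q) := fun i h1 h2 => by
    simpa using h.mem i h1 h2
  refine ⟨?_, ?_, ?_⟩
  · intro i hi hib
    rcases hi.eq_or_lt with rfl | hi
    · simpa using hv
    · simpa [hi.ne'] using (hmem i hi hib).1
  · intro i j hi hij hj
    have hja : a < j := hi.trans_lt hij
    rcases hi.eq_or_lt with rfl | hi
    · simpa [hja.ne'] using (hmem j hja hj).2.1
    · simpa [hi.ne', hja.ne'] using h.lt i j hi hij hj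
  · intro i j hi hij hj
    have hja : a < j := hi.trans_lt hij
    rcases hi.eq_or_lt with rfl | hi
    · simpa [hja.ne', hQ j hja hj] using (hmem j hja hj).2.2
    · simpa [hi.ne', hja.ne'] using h.adj i j hi hij hj

lemma IsCopy.extend_right {V : Type} [LinearOrder V] {G : SimpleGraph V} {p : ℕ → ℕ} {P : Prop}
    {a b : ℕ} {A : Finset V} {φ : ℕ → V} (Q : Prop) {v : V} (hv : v ∈ A)
    (h : IsCopy G p P a b {w ∈ A | w < v ∧ (G.Adj v w ↔ Q)} φ)
    (hQ : ∀ i, a ≤ i → i < b → ((p i ≤ b ↔ P) ↔ Q)) :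
    IsCopy G p P a (b + 1) A (fun i => if i = b then v else φ i) := by
  have hmem : ∀ i, a ≤ i → i < b → φ i ∈ A ∧ φ i < v ∧ (G.Adj v (φ i) ↔ Q) := fun i h1 h2 => by
    simpa using h.mem i h1 h2
  refine ⟨?_, ?_, ?_⟩
  · intro i hi hib
    rcases (Nat.lt_succ_iff.1 hib).eq_or_lt with rfl | hib
    · simpa using hv
    · simpa [hib.ne] using (hmem i hi hib).1
  · intro i j hi hij hj
    have hib : i < b := hij.trans_le (Nat.lt_succ_iff.1 hj)
    rcases (Nat.lt_succ_iff.1 hj).eq_or_lt with rfl | hj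
    · simpa [hib.ne] using (hmem i hi hib).2.1
    · simpa [hib.ne, hj.ne] using h.lt i j hi hij hj
  · intro i j hi hij hj
    have hib : i < b := hij.trans_le (Nat.lt_succ_iff.1 hj)
    rcases (Nat.lt_succ_iff.1 hj).eq_or_lt with rfl | hj
    · simpa [hib.ne, hQ i hi hib, G.adj_comm (φ i)] using (hmem i hi hib).2.2
    · simpa [hib.ne, hj.ne] using h.adj i j hi hij hj

lemma exists_isCopy_or_homogeneous {V : Type} [LinearOrder V] (G : SimpleGraph V) (p : ℕ → ℕ)
    (P : Prop) (N t : ℕ) (ht : 0 < t)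
    (hp : ∀ i j, i < j → j < N → p i ≤ i + 1 ∨ p j ≤ j + 1 ∨ p j ≤ p i) (n : ℕ) :
    ∀ (a : ℕ) (A : Finset V), a + n ≤ N → t ^ n ≤ A.card →
      (∃ φ, IsCopy G p P a (a + n) A φ) ∨ ∃ S : Finset V, t ≤ S.card ∧ IsHomogeneous G S := by
  induction n with
  | zero =>
    intro a A _ hA
    obtain ⟨v, -⟩ := Finset.card_pos.1 (lt_of_lt_of_le (by simp) hA)
    exact Or.inl ⟨fun _ => v, ⟨fun i _ _ => by omega, fun i j _ _ _ => by omega,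
      fun i j _ _ _ => by omega⟩⟩
  | succ n ih =>
    intro a A ha hA
    have left (Q : Prop) (hQ : ∀ j, a < j → j < a + (n + 1) → ((p a ≤ j ↔ P) ↔ Q)) :
        (∃ φ, IsCopy G p P a (a + (n + 1)) A φ) ∨
          ∃ S : Finset V, t ≤ S.card ∧ IsHomogeneous G S := by
      rcases exists_forward_neighbours_or_homogeneous G Q t n ht A hA with ⟨v, hv, hcard⟩ | hS
      · rcases ih (a + 1) _ (by omega) hcard with ⟨φ, hφ⟩ | hS
        · rw [add_right_comm, add_assoc] at hφ
          exact Or.inl ⟨_, hφ.extend_left Q hv hQ⟩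
        · exact Or.inr hS
      · exact Or.inr hS
    by_cases h1 : p a ≤ a + 1
    · refine left P fun j hj _ => ?_
      have : p a ≤ j := by omega
      simp [this]
    by_cases h2 : p a ≤ a + n
    · rcases exists_backward_neighbours_or_homogeneous G P t n ht A hA with ⟨v, hv, hcard⟩ | hS
      · rcases ih a _ (by omega) hcard with ⟨φ, hφ⟩ | hS
        · refine Or.inl ⟨_, hφ.extend_right P hv fun i hi hin => ?_⟩
          replace hin : i < a + n := hin
          have : p i ≤ a + n := by
            rcases hi.eq_or_lt with rfl | hi
            · exact h2
            · rcases hp a i hi (by omega) with h | h | h <;> omega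
          simp [this]
        · exact Or.inr hS
      · exact Or.inr hS
    · refine left (¬ P) fun j _ hj => ?_
      have : ¬ p a ≤ j := by omega
      simp [this]

lemma orderedEH_of_threshold {N : ℕ} (hN : 0 < N) (H : SimpleGraph (Fin N)) (p : ℕ → ℕ) (P : Prop)
    (hp : ∀ i j, i < j → j < N → p i ≤ i + 1 ∨ p j ≤ j + 1 ∨ p j ≤ p i)
    (hH : ∀ i j : Fin N, i < j → (H.Adj i j ↔ (p i ≤ j ↔ P))) :
    OrderedEH H (1 / (2 * N)) := by
  intro V _ _ G hG
  set n := Fintype.card V with hn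
  set x : ℝ := (n : ℝ) ^ (1 / (2 * N : ℝ)) with hx
  have hN' : (N : ℝ) ≠ 0 := by positivity
  have hx0 : 0 ≤ x := by positivity
  have hxn : x ^ (2 * N) = n := by
    rw [hx, ← Real.rpow_natCast, ← Real.rpow_mul (by positivity)]
    push_cast
    rw [one_div_mul_cancel (by positivity), Real.rpow_one]
  rcases Nat.lt_or_ge 1 n with h1 | h1
  · rcases le_total x 2 with h2 | h2
    · obtain ⟨a, b, hab⟩ := Fintype.one_lt_card_iff.1 h1
      refine ⟨{a, b}, by rw [Finset.card_pair hab]; exact_mod_cast h2, ?_⟩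
      by_cases h : G.Adj a b
      · left; simp [h, h.symm]
      · right; simp [h, G.adj_comm b a]
    · have ht : 0 < ⌈x⌉₊ := Nat.ceil_pos.2 (by linarith)
      have htn : ⌈x⌉₊ ^ N ≤ (Finset.univ : Finset V).card := by
        rw [Finset.card_univ, ← hn]
        have h3 : (⌈x⌉₊ : ℝ) ≤ x ^ 2 := by
          have := (Nat.ceil_lt_add_one hx0).le
          nlinarith
        have h4 : (⌈x⌉₊ : ℝ) ^ N ≤ n := by
          rw [← hxn, pow_mul]
          exact pow_le_pow_left₀ (by positivity) h3 N
        exact_mod_cast h4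
      rcases exists_isCopy_or_homogeneous G p P N _ ht hp N 0 Finset.univ (by simp) htn with
        ⟨φ, hφ⟩ | ⟨S, hS, hS'⟩
      · rw [zero_add] at hφ
        refine absurd ⟨fun i => φ i, fun i j hij => hφ.lt i j (by simp) hij j.2, ?_⟩ hG
        intro i j
        rcases lt_trichotomy i j with hij | rfl | hij
        · rw [hφ.adj i j (by simp) hij j.2, hH i j hij]
        · simp
        · rw [G.adj_comm, H.adj_comm, hφ.adj j i (by simp) hij i.2, hH j i hij]
      · exact ⟨S, (Nat.le_ceil x).trans (by exact_mod_cast hS), hS'⟩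
  · refine ⟨Finset.univ, ?_, ?_⟩
    · have : x ≤ n := by
        rcases Nat.le_one_iff_eq_zero_or_eq_one.1 h1 with h | h
        · rw [hx, h]; simp [hN.ne']
        · rw [hx, h]; simp
      simpa using this
    · right
      intro a _ b _ hab
      exact hab.ne (Fintype.card_le_one_iff.1 h1 a b)

lemma sum_range_choose_const (s x : ℕ) : ∑ i ∈ Finset.range x, i.choose s = x.choose (s + 1) := by
  induction x with
  | zero => simp
  | succ x ih => rw [Finset.sum_range_succ, ih, Nat.choose_succ_succ, add_comm]

lemma sum_Ico_choose_sub (m p s : ℕ) :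
    ∑ j ∈ Finset.Ico p m, (m - (j + 1)).choose s = (m - p).choose (s + 1) := by
  rw [Finset.sum_Ico_eq_sum_range, ← sum_range_choose_const,
    ← Finset.sum_range_reflect (fun i => i.choose s)]
  refine Finset.sum_congr rfl fun i _ => ?_
  congr 1
  omega

/-- The graph on `Fin N` in which `i < j` are adjacent iff `p i ≤ j`. -/
def thresholdGraph (N : ℕ) (p : ℕ → ℕ) : SimpleGraph (Fin N) :=
  SimpleGraph.fromRel fun i j => i < j ∧ p i ≤ j

lemma thresholdGraph_adj_of_lt {N : ℕ} (p : ℕ → ℕ) {i j : Fin N} (hij : i < j) :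
    (thresholdGraph N p).Adj i j ↔ p i ≤ j := by
  simp [thresholdGraph, hij, hij.ne, not_lt_of_gt hij]

/-- Total weight of an ordered graph. -/
noncomputable def weight (m s : ℕ) (H : SimpleGraph (Fin (m - s))) : ℕ :=
  ∑ i : Fin (m - s), ∑ j : Fin (m - s),
    if i < j ∧ H.Adj i j then (m - (j.val + 1)).choose s else 0

lemma weight_thresholdGraph {m s : ℕ} (c : ℕ → ℕ) (hc : ∀ x < m, c x ≤ x) :
    weight m s (thresholdGraph (m - s) fun i => m - c (m - 1 - i)) =
      ∑ x ∈ Finset.range m, (c x).choose (s + 1) := by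
  have hrow (i : ℕ) (hi : i < m) :
      ∑ j : Fin (m - s), (if m - c (m - 1 - i) ≤ (j : ℕ) then (m - (j.val + 1)).choose s else 0) =
        (c (m - 1 - i)).choose (s + 1) := by
    have hle := hc (m - 1 - i) (by omega)
    rw [Fin.sum_univ_eq_sum_range
      (fun j => if m - c (m - 1 - i) ≤ j then (m - (j + 1)).choose s else 0)]
    rw [Finset.sum_subset (s₂ := Finset.range m) (Finset.range_subset_range.2 (Nat.sub_le _ _))]
    · rw [← Finset.sum_filter]
      have : {j ∈ Finset.range m | m - c (m - 1 - i) ≤ j} = Finset.Ico (m - c (m - 1 - i)) m := by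
        ext j; simp [and_comm]
      rw [this, sum_Ico_choose_sub]
      congr 1
      omega
    · intro j hj hj'
      simp only [Finset.mem_range] at hj hj'
      rw [Nat.choose_eq_zero_of_lt (by omega), ite_self]
  have h1 : weight m s (thresholdGraph (m - s) fun i => m - c (m - 1 - i)) =
      ∑ i : Fin (m - s), (c (m - 1 - i)).choose (s + 1) := by
    refine Finset.sum_congr rfl fun i _ => ?_
    rw [← hrow i (by omega)]
    refine Finset.sum_congr rfl fun j _ => ?_
    have hle := hc (m - 1 - i) (by omega)
    by_cases hij : i < j
    · simp only [hij, true_and, thresholdGraph_adj_of_lt _ hij]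
    · have h2 : ¬ m - c (m - 1 - i) ≤ (j : ℕ) := by
        rw [not_lt, Fin.le_def] at hij
        omega
      simp [hij, h2]
  rw [h1, Fin.sum_univ_eq_sum_range (fun i => (c (m - 1 - i)).choose (s + 1)),
    Finset.sum_subset (s₂ := Finset.range m) (Finset.range_subset_range.2 (Nat.sub_le _ _)),
    Finset.sum_range_reflect (fun x => (c x).choose (s + 1))]
  intro i hi hi'
  simp only [Finset.mem_range] at hi hi'
  have hle := hc (m - 1 - i) (by omega)
  exact Nat.choose_eq_zero_of_lt (by omega)

lemma weight_add_weight_compl (m s : ℕ) (H : SimpleGraph (Fin (m - s))) :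
    weight m s H + weight m s Hᶜ = m.choose (s + 2) := by
  have h := weight_thresholdGraph (m := m) (s := s) (fun x => x) (fun _ _ => le_rfl)
  rw [sum_range_choose_const] at h
  rw [← h, weight, weight, weight, ← Finset.sum_add_distrib]
  refine Finset.sum_congr rfl fun i _ => ?_
  rw [← Finset.sum_add_distrib]
  refine Finset.sum_congr rfl fun j _ => ?_
  by_cases hij : i < j
  · have h2 : m - (m - 1 - (i : ℕ)) ≤ j := by
      rw [Fin.lt_def] at hij
      omega
    by_cases hH : H.Adj i j <;>
      simp [hij, hij.ne, hH, thresholdGraph_adj_of_lt _ hij, h2]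
  · simp [hij]

lemma choose_succ_le_choose_succ_right {z v : ℕ} (h : 3 * v + 2 ≤ z) :
    (z + 1).choose v ≤ z.choose (v + 1) := by
  have h1 := Nat.choose_succ_right_eq z v
  have h2 := Nat.choose_mul_succ_eq z v
  have h3 : 2 * z.choose v ≤ z.choose (v + 1) := by
    obtain ⟨k, rfl⟩ := Nat.exists_eq_add_of_le h
    have h4 : 3 * v + 2 + k - v = 2 * (v + 1) + k := by omega
    rw [h4] at h1
    refine Nat.le_of_mul_le_mul_right ?_ (Nat.succ_pos v)
    rw [Nat.succ_eq_add_one, h1]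
    nlinarith [Nat.zero_le ((3 * v + 2 + k).choose v * k)]
  refine le_trans ?_ h3
  obtain ⟨k, rfl⟩ := Nat.exists_eq_add_of_le h
  have h4 : 3 * v + 2 + k + 1 - v = 2 * v + 3 + k := by omega
  rw [h4] at h2
  refine Nat.le_of_mul_le_mul_right (c := 2 * v + 3 + k) ?_ (by omega)
  rw [← h2]
  have : 3 * v + 2 + k + 1 ≤ 2 * (2 * v + 3 + k) := by omega
  calc _ ≤ (3 * v + 2 + k).choose v * (2 * (2 * v + 3 + k)) := Nat.mul_le_mul_left _ this
    _ = _ := by ring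

/-- Greedy expansion into distinct binomial coefficients using at most every second one. -/
lemma exists_sparse_expansion (v X : ℕ) (hX : 3 * (v + 1) ≤ X) (n : ℕ) :
    ∀ R, R < (X + 2 * n).choose (v + 1) → ∃ A ⊆ Finset.Ico X (X + 2 * n), A.card ≤ n ∧
      ∃ R' < X.choose (v + 1), R = ∑ x ∈ A, x.choose (v + 1) + R' := by
  induction n with
  | zero => intro R hR; exact ⟨∅, by simp, by simp, R, hR, by simp⟩
  | succ n ih =>
    intro R hR
    have key (x R₁ : ℕ) (hx : X + 2 * n ≤ x) (hx' : x < X + 2 * (n + 1))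
        (hR₁ : R = x.choose (v + 1) + R₁) (hlt : R₁ < (X + 2 * n).choose (v + 1)) :
        ∃ A ⊆ Finset.Ico X (X + 2 * (n + 1)), A.card ≤ n + 1 ∧
          ∃ R' < X.choose (v + 1), R = ∑ x ∈ A, x.choose (v + 1) + R' := by
      obtain ⟨A, hA, hcard, R', hR', rfl⟩ := ih R₁ hlt
      have hxA : x ∉ A := fun h => by have := Finset.mem_Ico.1 (hA h); omega
      refine ⟨insert x A, ?_, ?_, R', hR', ?_⟩
      · intro y hy
        rcases Finset.mem_insert.1 hy with rfl | hy
        · exact Finset.mem_Ico.2 ⟨by omega, hx'⟩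
        · have := Finset.mem_Ico.1 (hA hy)
          exact Finset.mem_Ico.2 ⟨by omega, by omega⟩
      · rw [Finset.card_insert_of_notMem hxA]; omega
      · rw [Finset.sum_insert hxA, hR₁, add_assoc]
    have e : X + 2 * (n + 1) = X + 2 * n + 1 + 1 := by ring
    have s1 := Nat.choose_succ_succ (X + 2 * n + 1) v
    have s2 := Nat.choose_succ_succ (X + 2 * n) v
    have l1 := choose_succ_le_choose_succ_right (z := X + 2 * n) (v := v) (by omega)
    have l2 : (X + 2 * n).choose v ≤ (X + 2 * n + 1).choose v := Nat.choose_le_choose v (by omega)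
    rw [e] at hR
    simp only [Nat.succ_eq_add_one] at s1 s2
    by_cases c1 : (X + 2 * n + 1).choose (v + 1) ≤ R
    · exact key (X + 2 * n + 1) (R - (X + 2 * n + 1).choose (v + 1)) (by omega) (by omega) (by omega) (by omega)
    by_cases c2 : (X + 2 * n).choose (v + 1) ≤ R
    · exact key (X + 2 * n) (R - (X + 2 * n).choose (v + 1)) le_rfl (by omega) (by omega) (by omega)
    · obtain ⟨A, hA, hcard, h⟩ := ih R (by omega)
      exact ⟨A, hA.trans (Finset.Ico_subset_Ico_right (by omega)), by omega, h⟩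

/-- Greedy expansion into binomial coefficients with repetition. -/
lemma exists_repeated_expansion (u : ℕ) (hu : 0 < u) (n : ℕ) :
    ∀ R, R < (u + n).choose u → ∃ e : ℕ → ℕ, Antitone e ∧ (∀ k, e k < u + n) ∧
      (∀ k, n * u ≤ k → e k = 0) ∧ ∑ k ∈ Finset.range (n * u), (e k).choose u = R := by
  induction n with
  | zero =>
    intro R hR
    exact ⟨fun _ => 0, fun _ _ _ => le_rfl, fun _ => by omega, fun _ _ => rfl, by simp_all⟩
  | succ n ih =>
    intro R hR
    set C := (u + n).choose u with hC
    have hCpos : 0 < C := Nat.choose_pos (by omega)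
    have hd : R / C ≤ u := by
      have h1 := Nat.choose_mul_succ_eq (u + n) u
      have h2 : u + n + 1 - u = n + 1 := by omega
      rw [h2] at h1
      have h3 : (u + n + 1).choose u ≤ C * (u + 1) := by
        refine Nat.le_of_mul_le_mul_right (c := n + 1) ?_ (by omega)
        rw [← h1, mul_assoc]
        refine Nat.mul_le_mul_left _ ?_
        nlinarith [Nat.zero_le (u * n)]
      refine Nat.lt_succ_iff.1 (Nat.div_lt_of_lt_mul (lt_of_lt_of_le hR ?_))
      exact h3
    obtain ⟨e, he, hlt, hz, hsum⟩ := ih (R % C) (Nat.mod_lt _ hCpos)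
    set d := R / C with hd'
    refine ⟨fun k => if k < d then u + n else e (k - d), ?_, ?_, ?_, ?_⟩
    · intro a b hab
      have := hlt (b - d)
      by_cases hb : b < d
      · simp [hb, hab.trans_lt hb]
      · by_cases ha : a < d
        · simp [hb, ha, this.le]
        · simp only [hb, ha, if_false]
          exact he (by omega)
    · intro k
      have := hlt (k - d)
      dsimp only
      split_ifs <;> omega
    · intro k hk
      have h1 : (n + 1) * u = n * u + u := by ring
      have : ¬ k < d := by
        have := Nat.zero_le (n * u)
        by_contra hkd
        omega
      simp only [this, if_false]
      exact hz _ (by omega)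
    · have h1 : (n + 1) * u = d + (n * u + (u - d)) := by
        have : (n + 1) * u = n * u + u := by ring
        omega
      rw [h1, Finset.sum_range_add, Finset.sum_range_add]
      have e1 : ∑ k ∈ Finset.range d, (if k < d then u + n else e (k - d)).choose u = C * d := by
        rw [Finset.sum_congr rfl (g := fun _ => C)]
        · simp [mul_comm]
        · intro k hk
          simp [Finset.mem_range.1 hk, hC]
      rw [e1]
      simp only [Nat.add_sub_cancel_left, add_lt_iff_neg_left, not_lt_zero, if_false]
      rw [hsum, Finset.sum_eq_zero, add_zero, Nat.div_add_mod]
      intro k _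
      have : ¬ d + (n * u + k) < d := by omega
      rw [hz _ (by omega)]
      exact Nat.choose_eq_zero_of_lt hu

lemma sum_card_filter_lt (S : Finset ℕ) (g : ℕ → ℕ) :
    ∑ x ∈ S, g {z ∈ S | z < x}.card = ∑ k ∈ Finset.range S.card, g k := by
  induction S using Finset.induction_on_max with
  | empty => simp
  | insert a S ha ih =>
    have haS : a ∉ S := fun h => lt_irrefl _ (ha a h)
    rw [Finset.sum_insert haS, Finset.card_insert_of_notMem haS, Finset.sum_range_succ, ← ih,
      add_comm]
    congr 1
    · refine Finset.sum_congr rfl fun x hx => ?_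
      rw [Finset.filter_insert, if_neg (not_lt_of_gt (ha x hx))]
    · rw [Finset.filter_insert, if_neg (lt_irrefl a), Finset.filter_true_of_mem ha]

lemma choose_add_mul_choose_le (n k d : ℕ) :
    n.choose (k + 1) + d * n.choose k ≤ (n + d).choose (k + 1) := by
  induction d with
  | zero => simp
  | succ d ih =>
    have h1 := Nat.choose_succ_succ (n + d) k
    have h2 : n.choose k ≤ (n + d).choose k := Nat.choose_le_choose k (by omega)
    rw [← add_assoc, add_mul, one_mul]
    simp only [Nat.succ_eq_add_one] at h1
    omega

lemma two_mul_choose_sub_lt (k : ℕ) :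
    2 * (5 * (k + 1) ^ 2 - 5 * (k + 1)).choose (k + 1) < (5 * (k + 1) ^ 2).choose (k + 1) := by
  obtain ⟨n, hn⟩ : ∃ n, n = 5 * (k + 1) ^ 2 - 5 * (k + 1) := ⟨_, rfl⟩
  have hle : 5 * (k + 1) ≤ 5 * (k + 1) ^ 2 := by nlinarith
  have hm : 5 * (k + 1) ^ 2 = n + 5 * (k + 1) := by omega
  rcases Nat.eq_zero_or_pos k with rfl | hk
  · simp
  have hkn : k ≤ n := by nlinarith
  rw [← hn, hm]
  have h1 := choose_add_mul_choose_le n k (5 * (k + 1))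
  have h2 := Nat.choose_succ_right_eq n k
  have h3 : 0 < n.choose k := Nat.choose_pos hkn
  have h4 : n.choose (k + 1) < 5 * (k + 1) * n.choose k := by
    refine Nat.lt_of_mul_lt_mul_right (a := k + 1) ?_
    rw [h2]
    have : n - k < 5 * (k + 1) ^ 2 := by omega
    calc n.choose k * (n - k) < n.choose k * (5 * (k + 1) ^ 2) := Nat.mul_lt_mul_of_pos_left this h3
      _ = _ := by ring
  omega

lemma exists_levels (s f : ℕ)
    (hf : 2 * f ≤ (5 * (s + 2) ^ 2).choose (s + 2)) :
    ∃ c : ℕ → ℕ, (∀ x, c x ≤ x) ∧ (∀ z x, z < x → c x = x ∨ c z = z ∨ c x ≤ c z) ∧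
      ∑ x ∈ Finset.range (5 * (s + 2) ^ 2), (c x).choose (s + 1) = f := by
  obtain ⟨m, hm⟩ : ∃ m, m = 5 * (s + 2) ^ 2 := ⟨_, rfl⟩
  have hm' : m = 5 * (s * s) + 20 * s + 20 := by rw [hm]; ring
  have hhalf : 2 * (m - 5 * (s + 2)).choose (s + 2) < m.choose (s + 2) := by
    rw [hm]
    exact two_mul_choose_sub_lt (s + 1)
  rw [← hm] at hf ⊢
  -- the initial dominating vertices
  obtain ⟨M, R, hM, hMm, hR, hfR⟩ : ∃ M R, m ≤ M + 5 * (s + 2) ∧ M < m ∧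
      R < M.choose (s + 1) ∧ f + (M + 1).choose (s + 2) = m.choose (s + 2) + R := by
    have hex : ∃ b, f + (m - b).choose (s + 2) < m.choose (s + 2) := ⟨5 * (s + 2), by omega⟩
    have hb := Nat.find_spec hex
    have hb5 : Nat.find hex ≤ 5 * (s + 2) := Nat.find_min' hex (by omega)
    have hb0 : Nat.find hex ≠ 0 := fun h => by rw [h] at hb; simp at hb
    have hb1 := Nat.find_min hex (m := Nat.find hex - 1) (by omega)
    set b := Nat.find hex
    have e : m - (b - 1) = (m - b) + 1 := by omega
    rw [e] at hb1
    have h1 : (m - b + 1).choose (s + 2) = (m - b).choose (s + 1) + (m - b).choose (s + 2) :=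
      Nat.choose_succ_succ _ _
    refine ⟨m - b, f + ((m - b) + 1).choose (s + 2) - m.choose (s + 2), by omega, by omega, ?_, ?_⟩
    · omega
    · omega
  -- the sparse dominating vertices
  obtain ⟨X, n, hX, hX', hXM⟩ : ∃ X n, 3 * (s + 1) ≤ X ∧ X ≤ 3 * (s + 1) + 1 ∧ M = X + 2 * n :=
    ⟨M - 2 * ((M - 3 * (s + 1)) / 2), (M - 3 * (s + 1)) / 2, by omega, by omega, by omega⟩
  obtain ⟨A, hA, hAcard, R', hR', hRA⟩ := exists_sparse_expansion s X hX n R (hXM ▸ hR)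
  -- the final clique
  obtain ⟨y, R₁, hyX, hR₁, hR'y⟩ : ∃ y R₁, y ≤ X ∧ R₁ < y.choose (s + 1) ∧
      R' = y.choose (s + 2) + R₁ := by
    have hex : ∃ y, R' < (y + 1).choose (s + 2) :=
      ⟨X, by rw [Nat.choose_succ_succ]; exact hR'.trans_le (Nat.le_add_right _ _)⟩
    have hy := Nat.find_spec hex
    have hyX : Nat.find hex ≤ X := Nat.find_min' hex
      (by rw [Nat.choose_succ_succ]; exact hR'.trans_le (Nat.le_add_right _ _))
    have hmin : (Nat.find hex).choose (s + 2) ≤ R' := by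
      rcases Nat.eq_zero_or_pos (Nat.find hex) with h | h
      · rw [h]; simp
      · have := Nat.find_min hex (m := Nat.find hex - 1) (by omega)
        rw [Nat.sub_add_cancel h] at this
        exact not_lt.1 this
    have hsucc : (Nat.find hex + 1).choose (s + 2) =
        (Nat.find hex).choose (s + 1) + (Nat.find hex).choose (s + 2) := Nat.choose_succ_succ _ _
    exact ⟨Nat.find hex, R' - (Nat.find hex).choose (s + 2), hyX, by omega, by omega⟩
  have hyu : s + 1 ≤ y := by
    by_contra h
    rw [Nat.choose_eq_zero_of_lt (not_le.1 h)] at hR₁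
    omega
  obtain ⟨k, rfl⟩ := Nat.exists_eq_add_of_le hyu
  obtain ⟨e, he, hey, hez, hesum⟩ := exists_repeated_expansion (s + 1) (Nat.succ_pos s) k R₁ hR₁
  set y := s + 1 + k with hy
  set S := {x ∈ Finset.range m | y ≤ x ∧ x ≤ M ∧ x ∉ A} with hS
  have hScard : k * (s + 1) ≤ S.card := by
    have h1 : Finset.Icc X M \ A ⊆ S := by
      intro x hx
      simp only [Finset.mem_sdiff, Finset.mem_Icc] at hx
      simp only [hS, Finset.mem_filter, Finset.mem_range]
      exact ⟨by omega, by omega, by omega, hx.2⟩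
    have h2 := Finset.le_card_sdiff A (Finset.Icc X M)
    rw [Nat.card_Icc] at h2
    have h3 := Finset.card_le_card h1
    have h4 : k * (s + 1) ≤ (2 * (s + 1) + 1) * (s + 1) := Nat.mul_le_mul_right _ (by omega)
    have h5 : (2 * (s + 1) + 1) * (s + 1) = 2 * (s * s) + 5 * s + 3 := by ring
    omega
  refine ⟨fun x => if x ∈ S then e {z ∈ S | z < x}.card else x, ?_, ?_, ?_⟩
  · intro x
    by_cases hx : x ∈ S
    · have h1 := hey {z ∈ S | z < x}.card
      have h2 := (Finset.mem_filter.1 hx).2.1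
      simp only [hx, if_true]
      omega
    · simp [hx]
  · intro z x hzx
    by_cases hx : x ∈ S
    · by_cases hz : z ∈ S
      · right; right
        simp only [hx, hz, if_true]
        exact he (Finset.card_le_card fun w hw => by
          simp only [Finset.mem_filter] at hw ⊢
          exact ⟨hw.1, hw.2.trans hzx⟩)
      · right; left; simp [hz]
    · left; simp [hx]
  · have hsplit : ∀ x ∈ Finset.range m,
        (if x ∈ S then e {z ∈ S | z < x}.card else x).choose (s + 1) =
          (if x ∈ S then (e {z ∈ S | z < x}.card).choose (s + 1) else 0) +
          (if x ∈ A then x.choose (s + 1) else 0) +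
          (if x ∈ Finset.range y then x.choose (s + 1) else 0) +
          (if x ∈ Finset.Ico (M + 1) m then x.choose (s + 1) else 0) := by
      intro x hx
      have hxm := Finset.mem_range.1 hx
      by_cases hxA : x ∈ A
      · have h1 := Finset.mem_Ico.1 (hA hxA)
        have h2 : ¬ x < y := by omega
        have h3 : ¬ M + 1 ≤ x := by omega
        simp [hS, hxA, h2, h3]
      · by_cases hxy : x < y
        · have h3 : ¬ M + 1 ≤ x := by omega
          have h4 : x ∉ S := fun h => by have := (Finset.mem_filter.1 h).2.1; omega
          simp [hxA, hxy, h3, h4]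
        · by_cases hxM : M + 1 ≤ x
          · have h4 : x ∉ S := fun h => by have := (Finset.mem_filter.1 h).2.2.1; omega
            simp [hxA, hxy, hxM, h4, hxm]
          · have h4 : x ∈ S := Finset.mem_filter.2 ⟨hx, by omega, by omega, hxA⟩
            simp [hxA, hxy, hxM, h4]
    have sub {B : Finset ℕ} (hB : B ⊆ Finset.range m) (g : ℕ → ℕ) :
        ∑ x ∈ Finset.range m, (if x ∈ B then g x else 0) = ∑ x ∈ B, g x := by
      rw [Finset.sum_ite_mem, Finset.inter_eq_right.2 hB]
    have hsumS : ∑ x ∈ S, (e {z ∈ S | z < x}.card).choose (s + 1) = R₁ := by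
      rw [sum_card_filter_lt S (fun k => (e k).choose (s + 1)), ← hesum]
      symm
      refine Finset.sum_subset (Finset.range_subset_range.2 hScard) fun i _ hi => ?_
      rw [hez i (by simpa using hi)]
      simp
    rw [Finset.sum_congr rfl hsplit, Finset.sum_add_distrib, Finset.sum_add_distrib,
      Finset.sum_add_distrib, sub (Finset.filter_subset _ _), hsumS,
      sub (hA.trans fun x hx => by
        have := Finset.mem_Ico.1 hx
        exact Finset.mem_range.2 (by omega)),
      sub (Finset.range_subset_range.2 (by omega)),
      sub (fun x hx => Finset.mem_range.2 (Finset.mem_Ico.1 hx).2)]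
    have hsum (n : ℕ) : ∑ x ∈ Finset.range n, x.choose (s + 1) = n.choose (s + 2) :=
      sum_range_choose_const _ _
    have htop := Finset.sum_range_add_sum_Ico (fun x => x.choose (s + 1)) (show M + 1 ≤ m by omega)
    rw [hsum, hsum] at htop
    rw [hsum]
    omega

theorem stmt7 (r : ℕ) (hr : 4 ≤ r) :
    ∃ c₀ : ℝ, 0 < c₀ ∧
      ∀ f : ℕ, f ≤ Nat.choose (5 * r ^ 2) r →
        ∃ H : SimpleGraph (Fin (5 * r ^ 2 - r + 2)),
          (∑ i : Fin (5 * r ^ 2 - r + 2), ∑ j : Fin (5 * r ^ 2 - r + 2),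
            if i < j ∧ H.Adj i j then Nat.choose (5 * r ^ 2 - (j.val + 1)) (r - 2)
            else 0) = f ∧
          OrderedEH H c₀ := by
  obtain ⟨s, rfl⟩ := Nat.exists_eq_add_of_le' (le_trans (by norm_num : 2 ≤ 4) hr)
  have hN : 5 * (s + 2) ^ 2 - (s + 2) + 2 = 5 * (s + 2) ^ 2 - s := by
    have : s + 2 ≤ 5 * (s + 2) ^ 2 := by nlinarith
    omega
  rw [hN, Nat.add_sub_cancel]
  have hpos : 0 < 5 * (s + 2) ^ 2 - s := by omega
  set m := 5 * (s + 2) ^ 2 with hm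
  refine ⟨1 / (2 * ((m - s : ℕ) : ℝ)), by positivity, fun f hf => ?_⟩
  have main (g : ℕ) (hg : 2 * g ≤ m.choose (s + 2)) : ∃ p : ℕ → ℕ,
      (∀ i j, i < j → j < m - s → p i ≤ i + 1 ∨ p j ≤ j + 1 ∨ p j ≤ p i) ∧
        weight m s (thresholdGraph (m - s) p) = g := by
    obtain ⟨c, hc, hcc, hsum⟩ := exists_levels s g hg
    refine ⟨fun i => m - c (m - 1 - i), fun i j hij hj => ?_, ?_⟩
    · rcases hcc (m - 1 - j) (m - 1 - i) (by omega) with h | h | h <;> dsimp only <;> omega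
    · rw [weight_thresholdGraph c fun x _ => hc x, hsum]
  by_cases h2 : 2 * f ≤ m.choose (s + 2)
  · obtain ⟨p, hp, hw⟩ := main f h2
    refine ⟨thresholdGraph _ p, hw, orderedEH_of_threshold hpos _ p True hp fun i j hij => ?_⟩
    rw [thresholdGraph_adj_of_lt p hij, iff_true]
  · obtain ⟨p, hp, hw⟩ := main (m.choose (s + 2) - f) (by omega)
    have htot := weight_add_weight_compl m s (thresholdGraph (m - s) p)
    refine ⟨(thresholdGraph _ p)ᶜ, ?_, orderedEH_of_threshold hpos _ p False hp fun i j hij => ?_⟩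
    · change weight m s _ = f
      omega
    · rw [SimpleGraph.compl_adj, thresholdGraph_adj_of_lt p hij, iff_false]
      exact and_iff_right hij.ne
end

section
/- Let a, b, c, d, e be rational numbers such that neither (a = b = c/3) nor (a = −b and c = 0) holds. Then there is a constant C > 0 (depending only on a, b, c, d, e) such that for every positive integer m, the function f(x₁,...,x_m) = a·Σ_{1≤i<j≤m} x_i x_j² + b·Σ_{1≤i<j≤m} x_i² x_j + c·Σ_{1≤i<j<k≤m} x_i x_j x_k + d·Σ_{1≤i≤m} x_i² + e·Σ_{1≤i<j≤m} x_i x_j takes at least C·m³ distinct values on the set of integer vectors (x₁,...,x_m) with x₁,...,x_m ≥ 0 and x₁ + ... + x_m = m. -/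
/-- The sum of the `k`-th powers of the entries of a list. -/
def powerSum (k : ℕ) (l : List ℕ) : ℚ := (l.map fun x : ℕ => (x : ℚ) ^ k).sum

/-- The antisymmetric form `∑_{i < j} x_i x_j (x_j - x_i)`. -/
def asymSum : List ℕ → ℚ
  | [] => 0
  | x :: l => x * powerSum 2 l - (x : ℚ) ^ 2 * powerSum 1 l + asymSum l

@[simp] lemma powerSum_nil (k : ℕ) : powerSum k [] = 0 := rfl

@[simp] lemma powerSum_cons (k x : ℕ) (l : List ℕ) :
    powerSum k (x :: l) = (x : ℚ) ^ k + powerSum k l := by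
  simp [powerSum]

@[simp] lemma powerSum_append (k : ℕ) (l₁ l₂ : List ℕ) :
    powerSum k (l₁ ++ l₂) = powerSum k l₁ + powerSum k l₂ := by
  simp [powerSum]

@[simp] lemma powerSum_replicate (k n x : ℕ) :
    powerSum k (List.replicate n x) = n * (x : ℚ) ^ k := by
  simp [powerSum]

lemma powerSum_one (l : List ℕ) : powerSum 1 l = (l.sum : ℕ) := by
  induction l with
  | nil => simp
  | cons x l ih => simp [ih]

lemma powerSum_ofFn (k : ℕ) {m : ℕ} (x : Fin m → ℕ) :
    powerSum k (List.ofFn x) = ∑ i, (x i : ℚ) ^ k := by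
  simp [powerSum, List.map_ofFn, List.sum_ofFn]

@[simp] lemma asymSum_nil : asymSum [] = 0 := rfl

@[simp] lemma asymSum_cons (x : ℕ) (l : List ℕ) :
    asymSum (x :: l) = x * powerSum 2 l - (x : ℚ) ^ 2 * powerSum 1 l + asymSum l := rfl

@[simp] lemma asymSum_append (l₁ l₂ : List ℕ) :
    asymSum (l₁ ++ l₂) = asymSum l₁ + asymSum l₂
      + powerSum 1 l₁ * powerSum 2 l₂ - powerSum 2 l₁ * powerSum 1 l₂ := by
  induction l₁ with
  | nil => simp
  | cons x l ih => simp [ih]; ring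

@[simp] lemma asymSum_replicate (n x : ℕ) : asymSum (List.replicate n x) = 0 := by
  induction n with
  | zero => simp
  | succ n ih => simp [List.replicate_succ, ih]; ring

/-- The cubic form of the theorem, in terms of power sums and the antisymmetric form. -/
def cubicForm (a b c d e : ℚ) (l : List ℕ) : ℚ :=
  (a + b) / 2 * (powerSum 1 l * powerSum 2 l - powerSum 3 l)
    + (a - b) / 2 * asymSum l
    + c / 6 * (powerSum 1 l ^ 3 - 3 * powerSum 1 l * powerSum 2 l + 2 * powerSum 3 l)
    + d * powerSum 2 l + e / 2 * (powerSum 1 l ^ 2 - powerSum 2 l)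

lemma sum_lt_mul {m : ℕ} (x : Fin m → ℕ) :
    ∑ i, ∑ j, (if i < j then (x i : ℚ) * (x j : ℚ) else 0)
      = (powerSum 1 (List.ofFn x) ^ 2 - powerSum 2 (List.ofFn x)) / 2 := by
  induction m with
  | zero => simp
  | succ m ih =>
    simp [Fin.sum_univ_succ, List.ofFn_succ, ih, powerSum_ofFn, ← Finset.mul_sum]
    ring

lemma sum_lt_mul_sq {m : ℕ} (x : Fin m → ℕ) :
    ∑ i, ∑ j, (if i < j then (x i : ℚ) * (x j : ℚ) ^ 2 else 0)
      = (powerSum 1 (List.ofFn x) * powerSum 2 (List.ofFn x) - powerSum 3 (List.ofFn x)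
        + asymSum (List.ofFn x)) / 2 := by
  induction m with
  | zero => simp
  | succ m ih =>
    simp [Fin.sum_univ_succ, List.ofFn_succ, ih, powerSum_ofFn, ← Finset.mul_sum]
    ring

lemma sum_lt_sq_mul {m : ℕ} (x : Fin m → ℕ) :
    ∑ i, ∑ j, (if i < j then (x i : ℚ) ^ 2 * (x j : ℚ) else 0)
      = (powerSum 1 (List.ofFn x) * powerSum 2 (List.ofFn x) - powerSum 3 (List.ofFn x)
        - asymSum (List.ofFn x)) / 2 := by
  induction m with
  | zero => simp
  | succ m ih =>
    simp [Fin.sum_univ_succ, List.ofFn_succ, ih, powerSum_ofFn, ← Finset.mul_sum]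
    ring

lemma sum_lt_lt_mul {m : ℕ} (x : Fin m → ℕ) :
    ∑ i, ∑ j, ∑ k, (if i < j ∧ j < k then (x i : ℚ) * (x j : ℚ) * (x k : ℚ) else 0)
      = (powerSum 1 (List.ofFn x) ^ 3 - 3 * powerSum 1 (List.ofFn x) * powerSum 2 (List.ofFn x)
        + 2 * powerSum 3 (List.ofFn x)) / 6 := by
  induction m with
  | zero => simp
  | succ m ih =>
    have h : ∑ j : Fin m, ∑ k : Fin m,
        (if j < k then (x 0 : ℚ) * (x j.succ : ℚ) * (x k.succ : ℚ) else 0)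
        = x 0 * ∑ j : Fin m, ∑ k : Fin m,
          (if j < k then (x j.succ : ℚ) * (x k.succ : ℚ) else 0) := by
      simp only [Finset.mul_sum, mul_ite, mul_zero, mul_assoc]
    simp [Fin.sum_univ_succ, List.ofFn_succ, ih, h, sum_lt_mul (fun i => x (Fin.succ i))]
    ring

lemma exists_ofFn_eq_append_replicate {m : ℕ} (l : List ℕ) (hl : l.length ≤ m) :
    ∃ x : Fin m → ℕ, List.ofFn x = l ++ List.replicate (m - l.length) 0 := by
  have h : (l ++ List.replicate (m - l.length) 0).length = m := by simp; omega
  exact ⟨fun i => (l ++ List.replicate (m - l.length) 0).get (i.cast h.symm), by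
    apply List.ext_get <;> simp [hl]⟩

lemma finite_setOf_sum_eq (m : ℕ) : {x : Fin m → ℕ | ∑ i, x i = m}.Finite := by
  refine (Set.finite_Icc (0 : Fin m → ℕ) fun _ => m).subset
    fun x hx => ⟨fun i => by simp, fun i => ?_⟩
  refine le_of_le_of_eq ?_ (hx : ∑ i, x i = m)
  exact Finset.single_le_sum (f := x) (fun _ _ => Nat.zero_le _) (Finset.mem_univ i)

lemma card_le_ncard_image (a b c d e : ℚ) (m : ℕ) {ι : Type*} (s : Finset ι) (g : ι → List ℕ)
    (hlen : ∀ i ∈ s, (g i).length ≤ m) (hsum : ∀ i ∈ s, (g i).sum = m)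
    (hinj : Set.InjOn (fun i => cubicForm a b c d e (g i)) s) :
    s.card ≤ Set.ncard ((fun x : Fin m → ℕ =>
              a * ∑ i : Fin m, ∑ j : Fin m,
                    (if i < j then (x i : ℚ) * (x j : ℚ) ^ 2 else 0)
            + b * ∑ i : Fin m, ∑ j : Fin m,
                    (if i < j then (x i : ℚ) ^ 2 * (x j : ℚ) else 0)
            + c * ∑ i : Fin m, ∑ j : Fin m, ∑ k : Fin m,
                    (if i < j ∧ j < k then (x i : ℚ) * (x j : ℚ) * (x k : ℚ) else 0)
            + d * ∑ i : Fin m, (x i : ℚ) ^ 2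
            + e * ∑ i : Fin m, ∑ j : Fin m,
                    (if i < j then (x i : ℚ) * (x j : ℚ) else 0)) ''
            {x : Fin m → ℕ | ∑ i : Fin m, x i = m}) := by
  rw [← Set.ncard_coe_finset s, ← hinj.ncard_image]
  refine Set.ncard_le_ncard ?_ ((finite_setOf_sum_eq m).image _)
  rintro _ ⟨i, hi, rfl⟩
  obtain ⟨x, hx⟩ := exists_ofFn_eq_append_replicate (g i) (hlen i hi)
  refine ⟨x, ?_, ?_⟩
  · change ∑ i, x i = m
    rw [← List.sum_ofFn, hx]
    simp [hsum i hi]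
  · simp only [sum_lt_mul, sum_lt_mul_sq, sum_lt_sq_mul, sum_lt_lt_mul, ← powerSum_ofFn, hx,
      cubicForm]
    simp
    ring


lemma eq_zero_of_add_mul_eq_zero {M u v : ℤ} (hu : |u| < M) (h : u + M * v = 0) : v = 0 := by
  by_contra hv
  have h1 : 1 ≤ |v| := Int.one_le_abs hv
  have h2 : |u| = M * |v| := by
    rw [show u = -(M * v) by linarith, abs_neg, abs_mul, abs_of_pos ((abs_nonneg u).trans_lt hu)]
  nlinarith [abs_nonneg u]

lemma linear_weights_injective {n i j k i' j' k' : ℤ} (hn : 1 ≤ n) (hi : 0 ≤ i) (hi' : 0 ≤ i')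
    (hj : 0 ≤ j) (hj' : 0 ≤ j') (hin : i < n ^ 2) (hin' : i' < n ^ 2)
    (hjn : j < n ^ 2) (hjn' : j' < n ^ 2)
    (h : 2 * i + 2 * n * (2 * n - 1) * j + 3 * n ^ 2 * (3 * n ^ 2 - 1) * k
      = 2 * i' + 2 * n * (2 * n - 1) * j' + 3 * n ^ 2 * (3 * n ^ 2 - 1) * k') :
    i = i' ∧ j = j' ∧ k = k' := by
  have hn2 : n ≤ n ^ 2 := by nlinarith
  have hk : k - k' = 0 := by
    apply eq_zero_of_add_mul_eq_zero (M := 3 * n ^ 2 * (3 * n ^ 2 - 1))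
      (u := 2 * (i - i') + 2 * n * (2 * n - 1) * (j - j'))
    · have hM : 0 ≤ 2 * n * (2 * n - 1) := by nlinarith
      have e1 : 2 * n * (2 * n - 1) * (j - j') ≤ 2 * n * (2 * n - 1) * (n ^ 2 - 1) :=
        mul_le_mul_of_nonneg_left (by linarith) hM
      have e2 : 2 * n * (2 * n - 1) * (j' - j) ≤ 2 * n * (2 * n - 1) * (n ^ 2 - 1) :=
        mul_le_mul_of_nonneg_left (by linarith) hM
      have e3 : n ^ 2 ≤ n ^ 4 := by nlinarith
      have e4 : n ^ 2 ≤ n ^ 3 := by nlinarith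
      rw [abs_lt]
      constructor <;> nlinarith
    · linarith
  obtain rfl : k = k' := by linarith
  have hj0 : j - j' = 0 := by
    apply eq_zero_of_add_mul_eq_zero (M := 2 * n * (2 * n - 1)) (u := 2 * (i - i'))
    · rw [abs_lt]
      constructor <;> nlinarith
    · linarith
  obtain rfl : j = j' := by linarith
  exact ⟨by linarith, rfl, rfl⟩

lemma le_of_quadratic_weights {n w v i w' v' i' : ℤ} (hn : 1 ≤ n) (hw : n ≤ w)
    (hv' : n ≤ v') (hv2 : v < 2 * n) (hi' : 0 ≤ i') (hi2 : i < n ^ 2)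
    (h : 4 * n ^ 2 * w' ^ 2 + 2 * n * v' ^ 2 + i' = 4 * n ^ 2 * w ^ 2 + 2 * n * v ^ 2 + i)
    (hv : n ≤ v) : w' ≤ w := by
  by_contra! hlt
  have h1 : (w + 1) ^ 2 ≤ w' ^ 2 := by nlinarith
  have h2 : n ^ 2 ≤ v' ^ 2 := by nlinarith
  have h3 : v ^ 2 ≤ 4 * n ^ 2 := by nlinarith
  have h4 : n ^ 2 * (w + 1) ^ 2 ≤ n ^ 2 * w' ^ 2 := by gcongr
  have h5 : n * n ^ 2 ≤ n * v' ^ 2 := by gcongr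
  have h6 : n * v ^ 2 ≤ n * (4 * n ^ 2) := by gcongr
  have h7 : n ^ 2 * n ≤ n ^ 2 * w := by gcongr
  nlinarith

lemma quadratic_weights_injective {n w v i w' v' i' : ℤ} (hn : 1 ≤ n) (hw : n ≤ w) (hw' : n ≤ w')
    (hv : n ≤ v) (hv' : n ≤ v') (hv2 : v < 2 * n) (hv2' : v' < 2 * n)
    (hi : 0 ≤ i) (hi' : 0 ≤ i') (hi2 : i < n ^ 2) (hi2' : i' < n ^ 2)
    (h : 4 * n ^ 2 * w' ^ 2 + 2 * n * v' ^ 2 + i' = 4 * n ^ 2 * w ^ 2 + 2 * n * v ^ 2 + i) :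
    w = w' ∧ v = v' ∧ i = i' := by
  obtain rfl : w = w' := le_antisymm
    (le_of_quadratic_weights hn hw' hv hv2' hi hi2' h.symm hv')
    (le_of_quadratic_weights hn hw hv' hv2 hi' hi2 h hv)
  have hv0 : v' - v = 0 := by
    apply eq_zero_of_add_mul_eq_zero (M := 2 * n * (v' + v)) (u := i' - i)
    · rw [abs_lt]
      constructor <;> nlinarith
    · linarith
  obtain rfl : v = v' := by linarith
  exact ⟨rfl, rfl, by linarith⟩

lemma quadratic_weights_lt {n w v i : ℕ} (hn : 1 ≤ n) (hw : w < n) (hv : v < n)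
    (hi : i < n ^ 2) : 4 * n ^ 2 * (n + w) ^ 2 + 2 * n * (n + v) ^ 2 + i < 25 * n ^ 4 := by
  have e1 : (n + w) ^ 2 ≤ (2 * n) ^ 2 := Nat.pow_le_pow_left (by omega) 2
  have e2 : (n + v) ^ 2 ≤ (2 * n) ^ 2 := Nat.pow_le_pow_left (by omega) 2
  have e3 : n ^ 2 ≤ n ^ 4 := Nat.pow_le_pow_right hn (by norm_num)
  have e4 : n ^ 3 ≤ n ^ 4 := Nat.pow_le_pow_right hn (by norm_num)
  have e5 : 4 * n ^ 2 * (n + w) ^ 2 ≤ 4 * n ^ 2 * (2 * n) ^ 2 := Nat.mul_le_mul_left _ e1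
  have e6 : 2 * n * (n + v) ^ 2 ≤ 2 * n * (2 * n) ^ 2 := Nat.mul_le_mul_left _ e2
  nlinarith

lemma exists_separated_interval (γ k : ℚ) (hk : 10 ≤ k) :
    ∃ p : ℕ, (p = 1 ∨ p = 3) ∧ ∀ y y' : ℚ, p * k ≤ y → y ≤ (p + 1) * k → p * k ≤ y' →
      y' ≤ (p + 1) * k →
      3 / 2 * k ^ 2 ≤ |y ^ 2 + y * y' + y' ^ 2 - 1 + γ * (y + y' - 1)| := by
  by_cases hγ : -(15 / 4) * k ≤ γ
  · refine ⟨3, Or.inr rfl, fun y y' h1 h2 h3 h4 => le_abs.2 (Or.inl ?_)⟩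
    push_cast at *
    have : -(15 / 4) * k * (y + y' - 1) ≤ γ * (y + y' - 1) := by
      apply mul_le_mul_of_nonneg_right hγ; linarith
    nlinarith [sq_nonneg (y - y')]
  · refine ⟨1, Or.inl rfl, fun y y' h1 h2 h3 h4 => le_abs.2 (Or.inr ?_)⟩
    push_cast at *
    push Not at hγ
    have : γ * (y + y' - 1) ≤ -(15 / 4) * k * (y + y' - 1) := by
      apply mul_le_mul_of_nonneg_right hγ.le; linarith
    nlinarith [mul_nonneg (sub_nonneg.2 h1) (sub_nonneg.2 h3),
      mul_nonneg (sub_nonneg.2 (add_le_add h1 h3)) (sub_nonneg.2 (add_le_add h2 h4))]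

/-- Append ones to a list so that its sum becomes `m`. -/
def padOnes (m : ℕ) (l : List ℕ) : List ℕ := l ++ List.replicate (m - l.sum) 1

lemma sum_padOnes {m : ℕ} {l : List ℕ} (h : l.sum ≤ m) : (padOnes m l).sum = m := by
  simp [padOnes, h]

lemma length_padOnes_le {m : ℕ} {l : List ℕ} (hl : l.length ≤ l.sum) (h : l.sum ≤ m) :
    (padOnes m l).length ≤ m := by
  simp [padOnes]; omega

lemma powerSum_padOnes {m : ℕ} {l : List ℕ} (h : l.sum ≤ m) (k : ℕ) :
    powerSum k (padOnes m l) = powerSum k l + (m - powerSum 1 l) := by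
  simp [padOnes, powerSum_one, Nat.cast_sub h]

lemma asymSum_padOnes {m : ℕ} {l : List ℕ} (h : l.sum ≤ m) :
    asymSum (padOnes m l) = asymSum l + (powerSum 1 l - powerSum 2 l) * (m - powerSum 1 l) := by
  simp [padOnes, powerSum_one, Nat.cast_sub h]
  ring

lemma cubicForm_self_padOnes (a c d e : ℚ) {m : ℕ} {l : List ℕ} (h : l.sum ≤ m) :
    cubicForm a a c d e (padOnes m l)
      = (c / 3 - a) * (powerSum 3 l - powerSum 1 l)
        + (a * m - c / 2 * m + d - e / 2) * (powerSum 2 l - powerSum 1 l)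
        + (a * (m ^ 2 - m) + c / 6 * (m ^ 3 - 3 * m ^ 2 + 2 * m) + d * m + e / 2 * (m ^ 2 - m)) := by
  simp only [cubicForm, powerSum_padOnes h]
  ring

/-- A run of `L` ones with the entry `t` inserted at position `i`. -/
def insertOnes (L t i : ℕ) : List ℕ := List.replicate i 1 ++ t :: List.replicate (L - i) 1

lemma sum_insertOnes {L i : ℕ} (t : ℕ) (h : i ≤ L) : (insertOnes L t i).sum = L + t := by
  simp [insertOnes]; omega

lemma length_insertOnes {L i : ℕ} (t : ℕ) (h : i ≤ L) :
    (insertOnes L t i).length = L + 1 := by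
  simp [insertOnes]; omega

lemma powerSum_insertOnes {L i : ℕ} (t k : ℕ) (h : i ≤ L) :
    powerSum k (insertOnes L t i) = L + (t : ℚ) ^ k := by
  simp [insertOnes, Nat.cast_sub h]; ring

lemma asymSum_insertOnes {L i : ℕ} (t : ℕ) (h : i ≤ L) :
    asymSum (insertOnes L t i) = ((t : ℚ) ^ 2 - t) * (2 * i - L) := by
  simp [insertOnes, Nat.cast_sub h]; ring

/-- The vectors used when `a ≠ b`: the order of the entries varies, the entries do not. -/
def asymVector (m n : ℕ) (q : ℕ × ℕ × ℕ) : List ℕ :=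
  padOnes m (insertOnes (n ^ 2) 2 q.1 ++ insertOnes (n ^ 2) (2 * n) q.2.1
    ++ insertOnes (n ^ 2) (3 * n ^ 2) q.2.2)

lemma injOn_cubicForm_asymVector {a b : ℚ} (c d e : ℚ) (hab : a ≠ b) {m n : ℕ} (hn : 1 ≤ n)
    (hm : 78 * n ^ 2 ≤ m) :
    Set.InjOn (fun q => cubicForm a b c d e (asymVector m n q))
      (Finset.range (n ^ 2) ×ˢ Finset.range (n ^ 2) ×ˢ Finset.range (n ^ 2) :
        Finset (ℕ × ℕ × ℕ)) := by
  rintro ⟨i, j, k⟩ hq ⟨i', j', k'⟩ hq' h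
  simp only [Finset.coe_product, Finset.coe_range, Set.mem_prod, Set.mem_Iio] at hq hq'
  obtain ⟨hi, hj, hk⟩ := hq
  obtain ⟨hi', hj', hk'⟩ := hq'
  have hle : n ≤ n ^ 2 := by nlinarith
  have hs : ∀ {i j k : ℕ}, i < n ^ 2 → j < n ^ 2 → k < n ^ 2 →
      (insertOnes (n ^ 2) 2 i ++ insertOnes (n ^ 2) (2 * n) j
        ++ insertOnes (n ^ 2) (3 * n ^ 2) k).sum ≤ m := by
    intro i j k hi hj hk
    simp only [List.sum_append, sum_insertOnes _ hi.le, sum_insertOnes _ hj.le,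
      sum_insertOnes _ hk.le]
    linarith
  simp only [cubicForm, asymVector, powerSum_padOnes (hs hi hj hk),
    powerSum_padOnes (hs hi' hj' hk'), asymSum_padOnes (hs hi hj hk),
    asymSum_padOnes (hs hi' hj' hk'), powerSum_append, asymSum_append,
    powerSum_insertOnes _ _ hi.le, powerSum_insertOnes _ _ hj.le, powerSum_insertOnes _ _ hk.le,
    powerSum_insertOnes _ _ hi'.le, powerSum_insertOnes _ _ hj'.le,
    powerSum_insertOnes _ _ hk'.le, asymSum_insertOnes _ hi.le, asymSum_insertOnes _ hj.le,
    asymSum_insertOnes _ hk.le, asymSum_insertOnes _ hi'.le, asymSum_insertOnes _ hj'.le,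
    asymSum_insertOnes _ hk'.le] at h
  push_cast at h
  have hQ : (2 * i + 2 * n * (2 * n - 1) * j + 3 * n ^ 2 * (3 * n ^ 2 - 1) * k : ℚ)
      = 2 * i' + 2 * n * (2 * n - 1) * j' + 3 * n ^ 2 * (3 * n ^ 2 - 1) * k' := by
    apply mul_left_cancel₀ (sub_ne_zero.2 hab)
    linear_combination h
  have hZ : (2 * i + 2 * n * (2 * n - 1) * j + 3 * n ^ 2 * (3 * n ^ 2 - 1) * k : ℤ)
      = 2 * i' + 2 * n * (2 * n - 1) * j' + 3 * n ^ 2 * (3 * n ^ 2 - 1) * k' := by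
    exact_mod_cast hQ
  obtain ⟨h1, h2, h3⟩ := linear_weights_injective (by exact_mod_cast hn) (by positivity)
    (by positivity) (by positivity) (by positivity) (by exact_mod_cast hi) (by exact_mod_cast hi')
    (by exact_mod_cast hj) (by exact_mod_cast hj') hZ
  simp only [Prod.mk.injEq]
  exact ⟨by exact_mod_cast h1, by exact_mod_cast h2, by exact_mod_cast h3⟩

/-- The entries different from one of the vectors used when `a = b`. The pairs
`4 * n ^ 2 + 1 ± w`, `2 * n + 1 ± v` and the threes are balanced by twos. -/
def symCore (n y w v i : ℕ) : List ℕ :=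
  [y, 4 * n ^ 2 + 1 + w, 4 * n ^ 2 + 1 - w, 2 * n + 1 + v, 2 * n + 1 - v]
    ++ List.replicate i 3
    ++ List.replicate (3 * (n ^ 2 - i) + (4 * n ^ 2 - w ^ 2) + (4 * n ^ 2 - v ^ 2)) 2

section symCore

variable {n y w v i : ℕ}

lemma sum_symCore_le (hw : w < 2 * n) (hv : v < 2 * n) (hi : i < n ^ 2) :
    (symCore n y w v i).sum ≤ y + 30 * n ^ 2 + 4 * n + 4 := by
  have h1 : w ≤ 4 * n ^ 2 + 1 := by nlinarith
  simp [symCore]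
  omega

lemma length_symCore_le (hw : w < 2 * n) (hv : v < 2 * n) (hy : 1 ≤ y) :
    (symCore n y w v i).length ≤ (symCore n y w v i).sum := by
  have h1 : w < 4 * n ^ 2 + 1 := by nlinarith
  simp [symCore]
  omega

lemma powerSum_two_symCore (hw : w < 2 * n) (hv : v < 2 * n) (hi : i < n ^ 2) :
    powerSum 2 (symCore n y w v i) - powerSum 1 (symCore n y w v i)
      = (y : ℚ) ^ 2 - y + (32 * n ^ 4 + 8 * n ^ 2 + 8 * n ^ 2 + 4 * n + 22 * n ^ 2) := by
  have h1 : w ≤ 4 * n ^ 2 + 1 := by nlinarith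
  have h2 : v ≤ 2 * n + 1 := by omega
  have h3 : w ^ 2 ≤ 4 * n ^ 2 := by nlinarith
  have h4 : v ^ 2 ≤ 4 * n ^ 2 := by nlinarith
  simp [symCore, Nat.cast_sub h1, Nat.cast_sub h2, Nat.cast_sub h3, Nat.cast_sub h4,
    Nat.cast_sub hi.le]
  ring

lemma powerSum_three_symCore (hw : w < 2 * n) (hv : v < 2 * n) (hi : i < n ^ 2) :
    powerSum 3 (symCore n y w v i) - powerSum 1 (symCore n y w v i)
      = (y : ℚ) ^ 3 - y + 6 * (4 * n ^ 2 * w ^ 2 + 2 * n * v ^ 2 + i)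
        + (2 * (4 * n ^ 2 + 1) ^ 3 - 2 * (4 * n ^ 2 + 1) + 2 * (2 * n + 1) ^ 3 - 2 * (2 * n + 1)
          + 66 * n ^ 2) := by
  have h1 : w ≤ 4 * n ^ 2 + 1 := by nlinarith
  have h2 : v ≤ 2 * n + 1 := by omega
  have h3 : w ^ 2 ≤ 4 * n ^ 2 := by nlinarith
  have h4 : v ^ 2 ≤ 4 * n ^ 2 := by nlinarith
  simp [symCore, Nat.cast_sub h1, Nat.cast_sub h2, Nat.cast_sub h3, Nat.cast_sub h4,
    Nat.cast_sub hi.le]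
  ring

end symCore

/-- The vectors used when `a = b`. -/
def symVector (m n p : ℕ) (q : ℕ × ℕ × ℕ × ℕ) : List ℕ :=
  padOnes m (symCore n (10 * p * n ^ 2 + q.1) (n + q.2.1) (n + q.2.2.1) q.2.2.2)

lemma exists_injOn_cubicForm_symVector {a c : ℚ} (d e : ℚ) (hac : a ≠ c / 3) {m n : ℕ} (hn : 1 ≤ n)
    (hm : 78 * n ^ 2 ≤ m) : ∃ p : ℕ, (p = 1 ∨ p = 3) ∧
    Set.InjOn (fun q => cubicForm a a c d e (symVector m n p q))
      (Finset.range (n ^ 2) ×ˢ Finset.range n ×ˢ Finset.range n ×ˢ Finset.range (n ^ 2) :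
        Finset (ℕ × ℕ × ℕ × ℕ)) := by
  have hα : c / 3 - a ≠ 0 := fun h => hac (by linarith)
  have hle : n ≤ n ^ 2 := by nlinarith
  have hnQ : (1 : ℚ) ≤ n := by exact_mod_cast hn
  have hn1 : (1 : ℚ) ≤ n ^ 2 := one_le_pow₀ hnQ
  obtain ⟨p, hp, hsep⟩ := exists_separated_interval
    ((a * m - c / 2 * m + d - e / 2) / (c / 3 - a)) (10 * n ^ 2) (by linarith)
  obtain ⟨γ, hγ⟩ : ∃ γ, γ = (a * m - c / 2 * m + d - e / 2) / (c / 3 - a) := ⟨_, rfl⟩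
  rw [← hγ] at hsep
  have hγ' : a * m - c / 2 * m + d - e / 2 = (c / 3 - a) * γ := by
    rw [hγ, mul_div_cancel₀ _ hα]
  refine ⟨p, hp, ?_⟩
  have hp3 : p ≤ 3 := by omega
  rintro ⟨t, w, v, i⟩ hq ⟨t', w', v', i'⟩ hq' h
  simp only [Finset.coe_product, Finset.coe_range, Set.mem_prod, Set.mem_Iio] at hq hq'
  obtain ⟨ht, hw, hv, hi⟩ := hq
  obtain ⟨ht', hw', hv', hi'⟩ := hq'
  have hs : ∀ {t w v i : ℕ}, t < n ^ 2 → w < n → v < n → i < n ^ 2 →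
      (symCore n (10 * p * n ^ 2 + t) (n + w) (n + v) i).sum ≤ m := by
    intro t w v i ht hw hv hi
    refine (sum_symCore_le (by omega) (by omega) hi).trans ?_
    nlinarith
  simp only [symVector, cubicForm_self_padOnes _ _ _ _ (hs ht hw hv hi),
    cubicForm_self_padOnes _ _ _ _ (hs ht' hw' hv' hi')] at h
  rw [powerSum_two_symCore (by omega) (by omega) hi, powerSum_two_symCore (by omega) (by omega) hi',
    powerSum_three_symCore (by omega) (by omega) hi,
    powerSum_three_symCore (by omega) (by omega) hi', hγ'] at h
  push_cast at h
  obtain ⟨E, hE⟩ : ∃ E : ℕ, E = 4 * n ^ 2 * (n + w) ^ 2 + 2 * n * (n + v) ^ 2 + i := ⟨_, rfl⟩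
  obtain ⟨E', hE'⟩ : ∃ E : ℕ, E = 4 * n ^ 2 * (n + w') ^ 2 + 2 * n * (n + v') ^ 2 + i' := ⟨_, rfl⟩
  have hEb : (E : ℚ) < 25 * n ^ 4 := by
    exact_mod_cast hE ▸ quadratic_weights_lt hn hw hv hi
  have hEb' : (E' : ℚ) < 25 * n ^ 4 := by
    exact_mod_cast hE' ▸ quadratic_weights_lt hn hw' hv' hi'
  have hE0 : (0 : ℚ) ≤ E := by positivity
  have hE0' : (0 : ℚ) ≤ E' := by positivity
  have hEQ : (E : ℚ) = 4 * n ^ 2 * (n + w) ^ 2 + 2 * n * (n + v) ^ 2 + i := by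
    rw [hE]; push_cast; ring
  have hEQ' : (E' : ℚ) = 4 * n ^ 2 * (n + w') ^ 2 + 2 * n * (n + v') ^ 2 + i' := by
    rw [hE']; push_cast; ring
  have htQ : (t : ℚ) ≤ n ^ 2 := by exact_mod_cast ht.le
  have htQ' : (t' : ℚ) ≤ n ^ 2 := by exact_mod_cast ht'.le
  have ht0 : (0 : ℚ) ≤ t := by positivity
  have ht0' : (0 : ℚ) ≤ t' := by positivity
  have hΦ := hsep (10 * p * n ^ 2 + t) (10 * p * n ^ 2 + t') (by linarith) (by linarith)
    (by linarith) (by linarith)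
  obtain ⟨Φ, hΦd⟩ : ∃ Φ, Φ = (10 * p * n ^ 2 + t : ℚ) ^ 2
    + (10 * p * n ^ 2 + t) * (10 * p * n ^ 2 + t') + (10 * p * n ^ 2 + t') ^ 2 - 1
    + γ * ((10 * p * n ^ 2 + t) + (10 * p * n ^ 2 + t') - 1) := ⟨_, rfl⟩
  rw [← hΦd] at hΦ
  have hmain : ((t : ℚ) - t') * Φ = 6 * (E' - E) := by
    apply mul_left_cancel₀ hα
    rw [hΦd, hEQ, hEQ']
    linear_combination h
  have htt : t = t' := by
    by_contra hne
    have h1 : (1 : ℚ) ≤ |(t : ℚ) - t'| := by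
      have : (1 : ℤ) ≤ |(t : ℤ) - t'| := Int.one_le_abs (by omega)
      exact_mod_cast this
    have h5 : |(t : ℚ) - t'| * |Φ| < 150 * n ^ 4 := by
      rw [← abs_mul, hmain, abs_lt]
      constructor <;> linarith
    have h6 := le_mul_of_one_le_left (abs_nonneg Φ) h1
    linarith
  subst htt
  have hEE : E' = E := by
    rw [sub_self, zero_mul] at hmain
    have : (E' : ℚ) = E := by linarith
    exact_mod_cast this
  obtain ⟨g1, g2, g3⟩ := quadratic_weights_injective (n := n) (w := n + w) (v := n + v) (i := i)
    (w' := n + w') (v' := n + v') (i' := i') (by omega) (by omega) (by omega) (by omega) (by omega)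
    (by omega) (by omega) (by omega) (by omega) (by exact_mod_cast hi) (by exact_mod_cast hi')
    (by rw [hE, hE'] at hEE; exact_mod_cast hEE)
  simp only [Prod.mk.injEq, true_and]
  omega

theorem stmt8 (a b c d e : ℚ)
    (h1 : ¬ (a = b ∧ b = c / 3)) (h2 : ¬ (a = -b ∧ c = 0)) :
    ∃ C : ℝ, 0 < C ∧
      ∀ m : ℕ, 0 < m →
        C * (m : ℝ) ^ 3 ≤
          (Set.ncard ((fun x : Fin m → ℕ =>
              a * ∑ i : Fin m, ∑ j : Fin m,
                    (if i < j then (x i : ℚ) * (x j : ℚ) ^ 2 else 0)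
            + b * ∑ i : Fin m, ∑ j : Fin m,
                    (if i < j then (x i : ℚ) ^ 2 * (x j : ℚ) else 0)
            + c * ∑ i : Fin m, ∑ j : Fin m, ∑ k : Fin m,
                    (if i < j ∧ j < k then (x i : ℚ) * (x j : ℚ) * (x k : ℚ) else 0)
            + d * ∑ i : Fin m, (x i : ℚ) ^ 2
            + e * ∑ i : Fin m, ∑ j : Fin m,
                    (if i < j then (x i : ℚ) * (x j : ℚ) else 0)) ''
            {x : Fin m → ℕ | ∑ i : Fin m, x i = m}) : ℝ) := by
  refine ⟨1 / 312 ^ 3, by norm_num, fun m hm => ?_⟩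
  rcases lt_or_ge m 78 with hm78 | hm78
  · have h := card_le_ncard_image a b c d e m {()} (fun _ => List.replicate m 1)
      (by simp) (by simp) (by simp)
    have h1 := Nat.cast_le (α := ℝ).2 h
    have h2 : (m : ℝ) ^ 3 ≤ 312 ^ 3 := by
      gcongr
      exact_mod_cast (by omega : m ≤ 312)
    simp only [Finset.card_singleton, Nat.cast_one] at h1
    refine le_trans ?_ h1
    linarith
  obtain ⟨n, hn, hnm, hmn⟩ : ∃ n : ℕ, 1 ≤ n ∧ 78 * n ^ 2 ≤ m ∧ m ≤ 312 * n ^ 2 := by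
    have h1 : 1 ≤ Nat.sqrt (m / 78) := Nat.le_sqrt.2 (by omega)
    have h2 := Nat.sqrt_le' (m / 78)
    have h3 := Nat.lt_succ_sqrt' (m / 78)
    refine ⟨Nat.sqrt (m / 78), h1, by omega, ?_⟩
    have h4 : (Nat.sqrt (m / 78) + 1) ^ 2 ≤ 4 * Nat.sqrt (m / 78) ^ 2 := by nlinarith
    simp only [Nat.succ_eq_add_one] at h3
    omega
  have hle : n ≤ n ^ 2 := by nlinarith
  suffices h : n ^ 6 ≤ _ by
    refine le_trans ?_ (Nat.cast_le (α := ℝ).2 h)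
    have h1 : (m : ℝ) ^ 3 ≤ (312 * n ^ 2) ^ 3 := by
      gcongr
      exact_mod_cast hmn
    push_cast
    nlinarith
  by_cases hab : a = b
  · subst hab
    obtain ⟨p, hp, hinj⟩ := exists_injOn_cubicForm_symVector d e (fun h => h1 ⟨rfl, h⟩) hn hnm
    have hp3 : p ≤ 3 := by omega
    have hp1 : 1 ≤ p := by omega
    have hs : ∀ {t w v i : ℕ}, t < n ^ 2 → w < n → v < n → i < n ^ 2 →
        (symCore n (10 * p * n ^ 2 + t) (n + w) (n + v) i).sum ≤ m := by
      intro t w v i ht hw hv hi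
      refine (sum_symCore_le (by omega) (by omega) hi).trans ?_
      nlinarith
    refine le_of_eq_of_le ?_ (card_le_ncard_image a a c d e m _ _ ?_ ?_ hinj)
    · simp only [Finset.card_product, Finset.card_range]
      ring
    · rintro ⟨t, w, v, i⟩ hq
      simp only [Finset.mem_product, Finset.mem_range] at hq
      obtain ⟨ht, hw, hv, hi⟩ := hq
      exact length_padOnes_le (length_symCore_le (y := 10 * p * n ^ 2 + t) (w := n + w) (v := n + v)
        (by omega) (by omega) (by nlinarith))
        (hs ht hw hv hi)
    · rintro ⟨t, w, v, i⟩ hq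
      simp only [Finset.mem_product, Finset.mem_range] at hq
      obtain ⟨ht, hw, hv, hi⟩ := hq
      exact sum_padOnes (hs ht hw hv hi)
  · refine le_of_eq_of_le ?_ (card_le_ncard_image a b c d e m _ _ ?_ ?_
      (injOn_cubicForm_asymVector c d e hab hn hnm))
    · simp only [Finset.card_product, Finset.card_range]
      ring
    all_goals
      rintro ⟨i, j, k⟩ hq
      simp only [Finset.mem_product, Finset.mem_range] at hq
      obtain ⟨hi, hj, hk⟩ := hq
    · apply length_padOnes_le
      · simp only [List.length_append, List.sum_append, sum_insertOnes _ hi.le,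
          sum_insertOnes _ hj.le, sum_insertOnes _ hk.le, length_insertOnes _ hi.le,
          length_insertOnes _ hj.le, length_insertOnes _ hk.le]
        omega
      · simp only [List.sum_append, sum_insertOnes _ hi.le,
          sum_insertOnes _ hj.le, sum_insertOnes _ hk.le]
        omega
    · apply sum_padOnes
      simp only [List.sum_append, sum_insertOnes _ hi.le,
        sum_insertOnes _ hj.le, sum_insertOnes _ hk.le]
      omega
end

section
/- For every m ≥ 3 there is a constant ε = ε(m) > 0 such that the following holds. Let G be an n-vertex 3-graph, with n sufficiently large, which contains no homogeneous set of size at least n^ε. Then G or its complement contains one of the following structures: (a) pairwise disjoint subsets A₁, ..., A_m of the vertex set with |A_i| ≥ m, together with a, b, c, d ∈ {0,1} not all equal, such that for all (not necessarily distinct) i, j, k ∈ {1,...,m}: d(A_i,A_j,A_k) = a if i < j = k, d(A_i,A_j,A_k) = b if i = j < k, d(A_i,A_j,A_k) = c if i < j < k, and d(A_i,A_j,A_k) = d if i = j = k; or (b) pairwise disjoint subsets A₁, ..., A_m, B₁, ..., B_m of the vertex set with |A_i|, |B_i| ≥ m, together with b₁, b₂, c₁, c₂, c₃, c₄, c₅,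 c₆ ∈ {0,1}, such that: d(A_i,A_j,B_j) = 1, d(B_i,A_j,B_j) = 1, d(A_i,B_i,A_j) = b₁ and d(A_i,B_i,B_j) = b₂ for all 1 ≤ i < j ≤ m; d(A_i,A_j,B_k) = c₁, d(A_i,B_j,A_k) = c₂, d(A_i,B_j,B_k) = c₃, d(B_i,A_j,A_k) = c₄, d(B_i,A_j,B_k) = c₅ and d(B_i,B_j,A_k) = c₆ for all 1 ≤ i < j < k ≤ m; d(X,Y,Z) = 0 whenever X, Y, Z ∈ {A₁,...,A_m,B₁,...,B_m} are not pairwise distinct; and d(X,Y,Z) = 0 whenever X, Y, Z ∈ {A₁,...,A_m} or X, Y, Z ∈ {B₁,...,B_m}. -/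
open Classical

/-- The set of 3-element vertex sets `{x,y,z}` with `x ∈ X`, `y ∈ Y`, `z ∈ Z`. -/
noncomputable def triples3 (n : ℕ) (X Y Z : Finset (Fin n)) : Finset (Finset (Fin n)) :=
  (Finset.powersetCard 3 (Finset.univ : Finset (Fin n))).filter
    (fun e => ∃ x ∈ X, ∃ y ∈ Y, ∃ z ∈ Z, e = {x, y, z})

/-- The density `d(X,Y,Z)` in the 3-graph with edge set `E`: the fraction of 3-element
sets `{x,y,z}` with `x ∈ X`, `y ∈ Y`, `z ∈ Z` that are edges. -/
noncomputable def dens3 (n : ℕ) (E : Finset (Finset (Fin n))) (X Y Z : Finset (Fin n)) : ℝ :=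
  (((triples3 n X Y Z).filter (fun e => e ∈ E)).card : ℝ) / ((triples3 n X Y Z).card : ℝ)

/-- `S` is a clique in the `3`-graph with edge set `E`. -/
def IsClique3 {n : ℕ} (E : Finset (Finset (Fin n))) (S : Finset (Fin n)) : Prop :=
  ∀ e : Finset (Fin n), e ⊆ S → e.card = 3 → e ∈ E

/-- `S` is an independent set in the `3`-graph with edge set `E`. -/
def IsIndep3 {n : ℕ} (E : Finset (Finset (Fin n))) (S : Finset (Fin n)) : Prop :=
  ∀ e : Finset (Fin n), e ⊆ S → e.card = 3 → e ∉ E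

/-- Structure (a): `m` disjoint sets of size at least `m` with densities `a,b,c,d ∈ {0,1}`
(not all equal) according to the type of the triple of indices. -/
def StructA (n m : ℕ) (E : Finset (Finset (Fin n))) : Prop :=
  ∃ A : Fin m → Finset (Fin n),
    (∀ i j, i ≠ j → Disjoint (A i) (A j)) ∧ (∀ i, m ≤ (A i).card) ∧
    ∃ a b c d : ℝ,
      a ∈ ({0, 1} : Set ℝ) ∧ b ∈ ({0, 1} : Set ℝ) ∧
      c ∈ ({0, 1} : Set ℝ) ∧ d ∈ ({0, 1} : Set ℝ) ∧
      ¬ (a = b ∧ b = c ∧ c = d) ∧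
      ∀ i j k : Fin m,
        (i < j ∧ j = k → dens3 n E (A i) (A j) (A k) = a) ∧
        (i = j ∧ j < k → dens3 n E (A i) (A j) (A k) = b) ∧
        (i < j ∧ j < k → dens3 n E (A i) (A j) (A k) = c) ∧
        (i = j ∧ j = k → dens3 n E (A i) (A j) (A k) = d)

/-- Structure (b): `2m` disjoint sets `A₁,…,A_m,B₁,…,B_m` of size at least `m`
with the prescribed density pattern. -/
def StructB (n m : ℕ) (E : Finset (Finset (Fin n))) : Prop :=
  ∃ A B : Fin m → Finset (Fin n),
    (∀ i j, i ≠ j → Disjoint (A i) (A j)) ∧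
    (∀ i j, i ≠ j → Disjoint (B i) (B j)) ∧
    (∀ i j, Disjoint (A i) (B j)) ∧
    (∀ i, m ≤ (A i).card) ∧ (∀ i, m ≤ (B i).card) ∧
    ∃ b₁ b₂ c₁ c₂ c₃ c₄ c₅ c₆ : ℝ,
      b₁ ∈ ({0, 1} : Set ℝ) ∧ b₂ ∈ ({0, 1} : Set ℝ) ∧
      c₁ ∈ ({0, 1} : Set ℝ) ∧ c₂ ∈ ({0, 1} : Set ℝ) ∧
      c₃ ∈ ({0, 1} : Set ℝ) ∧ c₄ ∈ ({0, 1} : Set ℝ) ∧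
      c₅ ∈ ({0, 1} : Set ℝ) ∧ c₆ ∈ ({0, 1} : Set ℝ) ∧
      (∀ i j : Fin m, i < j →
        dens3 n E (A i) (A j) (B j) = 1 ∧ dens3 n E (B i) (A j) (B j) = 1 ∧
        dens3 n E (A i) (B i) (A j) = b₁ ∧ dens3 n E (A i) (B i) (B j) = b₂) ∧
      (∀ i j k : Fin m, i < j → j < k →
        dens3 n E (A i) (A j) (B k) = c₁ ∧ dens3 n E (A i) (B j) (A k) = c₂ ∧
        dens3 n E (A i) (B j) (B k) = c₃ ∧ dens3 n E (B i) (A j) (A k) = c₄ ∧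
        dens3 n E (B i) (A j) (B k) = c₅ ∧ dens3 n E (B i) (B j) (A k) = c₆) ∧
      (∀ X Y Z : Finset (Fin n),
        X ∈ Set.range A ∪ Set.range B → Y ∈ Set.range A ∪ Set.range B →
        Z ∈ Set.range A ∪ Set.range B → (X = Y ∨ Y = Z ∨ X = Z) →
        dens3 n E X Y Z = 0) ∧
      (∀ i j k : Fin m,
        dens3 n E (A i) (A j) (A k) = 0 ∧ dens3 n E (B i) (B j) (B k) = 0)

theorem exists_card_forall_homogeneous {C : Type*} [Finite C] (k : ℕ) :
    ∀ m : ℕ, ∃ K : ℕ, ∀ (S : Finset ℕ) (f : Finset ℕ → C), K ≤ S.card →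
      ∃ T ⊆ S, T.card = m ∧ ∃ c, ∀ e ⊆ T, e.card = k → f e = c := by
  induction k with
  | zero =>
    intro m
    refine ⟨m, fun S f hS => ?_⟩
    obtain ⟨T, hTS, hT⟩ := Finset.exists_subset_card_eq hS
    refine ⟨T, hTS, hT, f ∅, fun e _ he => ?_⟩
    rw [Finset.card_eq_zero.1 he]
  | succ k ih =>
    have key : ∀ l : ℕ, ∃ K : ℕ, ∀ (S : Finset ℕ) (f : Finset ℕ → C), K ≤ S.card →
        ∃ T ⊆ S, T.card = l ∧ ∃ φ : ℕ → C, ∀ x ∈ T, ∀ e ⊆ T, e.card = k →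
          (∀ y ∈ e, x < y) → f (insert x e) = φ x := by
      intro l
      induction l with
      | zero =>
        exact ⟨0, fun S f _ => ⟨∅, by simp, rfl, fun _ => f ∅, by simp⟩⟩
      | succ l ihl =>
        obtain ⟨K₁, hK₁⟩ := ihl
        obtain ⟨K₂, hK₂⟩ := ih K₁
        refine ⟨K₂ + 1, fun S f hS => ?_⟩
        have hne : S.Nonempty := Finset.card_pos.1 (by omega)
        set x := S.min' hne with hx
        have hxS : x ∈ S := S.min'_mem hne
        obtain ⟨T₁, hT₁, hT₁c, c, hc⟩ := hK₂ (S.erase x) (fun e => f (insert x e))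
          (by rw [Finset.card_erase_of_mem hxS]; omega)
        obtain ⟨T, hT, hTc, φ, hφ⟩ := hK₁ T₁ f hT₁c.ge
        have hlt : ∀ y ∈ T, x < y := fun y hy => by
          have := Finset.mem_erase.1 (hT₁ (hT hy))
          exact lt_of_le_of_ne (S.min'_le y this.2) (Ne.symm this.1)
        have hxT : x ∉ T := fun h => lt_irrefl _ (hlt x h)
        refine ⟨insert x T, ?_, by rw [Finset.card_insert_of_notMem hxT, hTc],
          Function.update φ x c, ?_⟩
        · intro y hy
          rcases Finset.mem_insert.1 hy with rfl | hy
          · exact hxS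
          · exact Finset.mem_of_mem_erase (hT₁ (hT hy))
        · intro y hy e he hec hye
          have hxe : x ∉ e := by
            intro h
            rcases Finset.mem_insert.1 hy with rfl | hy
            · exact lt_irrefl _ (hye _ h)
            · exact lt_asymm (hlt y hy) (hye _ h)
          have heT : e ⊆ T := fun z hz => by
            rcases Finset.mem_insert.1 (he hz) with rfl | h
            · exact absurd hz hxe
            · exact h
          rcases Finset.mem_insert.1 hy with rfl | hy
          · rw [Function.update_self]
            exact hc e (heT.trans hT) hec
          · rw [Function.update_of_ne (hlt y hy).ne']
            exact hφ y hy e heT hec hye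
    intro m
    have := Fintype.ofFinite C
    obtain ⟨K, hK⟩ := key (Fintype.card C * m)
    refine ⟨K, fun S f hS => ?_⟩
    obtain ⟨T, hTS, hTc, φ, hφ⟩ := hK S f hS
    have hC : (Finset.univ : Finset C).Nonempty := ⟨f ∅, Finset.mem_univ _⟩
    obtain ⟨c, -, hc⟩ := Finset.exists_le_card_fiber_of_mul_le_card_of_maps_to
      (s := T) (t := Finset.univ) (f := φ) (n := m) (by simp) hC (by rw [hTc]; rfl)
    obtain ⟨T', hT', hT'c⟩ := Finset.exists_subset_card_eq hc
    have hT'T : T' ⊆ T := hT'.trans (Finset.filter_subset _ _)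
    refine ⟨T', hT'T.trans hTS, hT'c, c, fun e he hec => ?_⟩
    have hne : e.Nonempty := Finset.card_pos.1 (by omega)
    have hmem := e.min'_mem hne
    rw [← Finset.insert_erase hmem, hφ _ (hT'T (he hmem)) (e.erase (e.min' hne))
      ((Finset.erase_subset _ _).trans (he.trans hT'T))
      (by rw [Finset.card_erase_of_mem hmem]; omega)
      (fun y hy => lt_of_le_of_ne (e.min'_le y (Finset.mem_of_mem_erase hy))
        (Finset.ne_of_mem_erase hy).symm)]
    exact (Finset.mem_filter.1 (hT' (he hmem))).2

/-- Ramsey's theorem for finite colourings of increasing triples. -/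
theorem exists_strictMono_triple_homogeneous {C : Type*} [Finite C] (m : ℕ) :
    ∃ K : ℕ, ∀ f : ℕ → ℕ → ℕ → C, ∃ g : Fin m → ℕ, StrictMono g ∧ (∀ i, g i < K) ∧
      ∃ c, ∀ i j k, i < j → j < k → f (g i) (g j) (g k) = c := by
  obtain ⟨K, hK⟩ := exists_card_forall_homogeneous (C := C) 3 m
  refine ⟨K, fun f => ?_⟩
  obtain ⟨T, hT, hTc, c, hc⟩ := hK (Finset.range K)
    (fun e => if h : e.card = 3 then
      f (e.orderEmbOfFin h 0) (e.orderEmbOfFin h 1) (e.orderEmbOfFin h 2) else f 0 0 0) (by simp)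
  refine ⟨T.orderEmbOfFin hTc, (T.orderEmbOfFin hTc).strictMono,
    fun i => Finset.mem_range.1 (hT (T.orderEmbOfFin_mem hTc i)), c, fun i j k hij hjk => ?_⟩
  set g := T.orderEmbOfFin hTc
  have h1 : g i < g j := g.strictMono hij
  have h2 : g j < g k := g.strictMono hjk
  have hcard : ({g i, g j, g k} : Finset ℕ).card = 3 :=
    Finset.card_eq_three.2 ⟨_, _, _, h1.ne, (h1.trans h2).ne, h2.ne, rfl⟩
  have h := hc {g i, g j, g k} (by
    intro x hx
    simp only [Finset.mem_insert, Finset.mem_singleton] at hx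
    rcases hx with rfl | rfl | rfl <;> exact T.orderEmbOfFin_mem hTc _) hcard
  rw [dif_pos hcard] at h
  have hu : ![g i, g j, g k] = ({g i, g j, g k} : Finset ℕ).orderEmbOfFin hcard := by
    apply Finset.orderEmbOfFin_unique
    · intro x; fin_cases x <;> simp
    · intro a b hab
      fin_cases a <;> fin_cases b <;> (simp_all; try omega)
  rw [← hu] at h
  exact h

/-- Invariance of a ternary relation under permutations of its arguments. -/
structure SymmRel {V : Type*} (E : V → V → V → Prop) : Prop where
  swap₁₂ : ∀ {x y z}, E x y z → E y x z
  swap₂₃ : ∀ {x y z}, E x y z → E x z y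

theorem exists_subparts_relation_constant (N w : ℕ) :
    ∃ K : ℕ, ∀ {V : Type} (E : V → V → V → Prop), SymmRel E → ∀ P : Fin N → Finset V,
      (∀ i, K ≤ (P i).card) → ∃ Q : Fin N → Finset V, (∀ i, Q i ⊆ P i) ∧ (∀ i, (Q i).card = w) ∧
        ∃ col : Fin N → Fin N → Fin N → Prop, ∀ i j k, ∀ x ∈ Q i, ∀ y ∈ Q j, ∀ z ∈ Q k,
          x ≠ y → x ≠ z → y ≠ z → (E x y z ↔ col i j k) := by
  obtain ⟨K, hK⟩ := exists_strictMono_triple_homogeneous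
    (C := Fin N → Fin N → Fin N → Prop) (N * w)
  refine ⟨K + 1, fun {V} E hE P hP => ?_⟩
  have hp : ∀ i, ∃ p : ℕ → V, (∀ t, t < K → p t ∈ P i) ∧
      ∀ t t', t < K → t' < K → p t = p t' → t = t' := by
    intro i
    have h0 : 0 < (P i).card := by have := hP i; omega
    refine ⟨fun t => if h : t < (P i).card then ((P i).equivFin.symm ⟨t, h⟩ : V)
      else ((P i).equivFin.symm ⟨0, h0⟩ : V), fun t ht => ?_, fun t t' ht ht' h => ?_⟩
    · have : t < (P i).card := by have := hP i; omega
      simp [this]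
    · have h1 : t < (P i).card := by have := hP i; omega
      have h2 : t' < (P i).card := by have := hP i; omega
      simpa [h1, h2, Subtype.ext_iff] using h
  choose p hpP hpinj using hp
  obtain ⟨g, hg, hgK, c, hc⟩ := hK (fun a b c i j k => E (p i a) (p j b) (p k c))
  have hc' : ∀ a b d, a < b → b < d → ∀ i j k,
      (E (p i (g a)) (p j (g b)) (p k (g d)) ↔ c i j k) := fun a b d h1 h2 i j k => by
    rw [← hc a b d h1 h2]
  have hord : ∀ (i j : Fin N) (s t : Fin w),
      finProdFinEquiv (i, s) < finProdFinEquiv (j, t) → i ≤ j := by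
    intro i j s t h
    by_contra hlt
    push Not at hlt
    have h1 : (s : ℕ) + w * i < t + w * j := by
      simpa [Fin.lt_def, finProdFinEquiv] using h
    have h2 : (j : ℕ) + 1 ≤ i := hlt
    have h3 : w * ((j : ℕ) + 1) ≤ w * i := Nat.mul_le_mul_left _ h2
    have := t.2
    rw [Nat.mul_add] at h3
    omega
  refine ⟨fun i => Finset.univ.image fun s : Fin w => p i (g (finProdFinEquiv (i, s))), ?_, ?_,
    fun i j k => c (min i (min j k)) (max (min i j) (min (max i j) k)) (max i (max j k)), ?_⟩
  · intro i x hx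
    obtain ⟨s, -, rfl⟩ := Finset.mem_image.1 hx
    exact hpP i _ (hgK _)
  · intro i
    rw [Finset.card_image_of_injective, Finset.card_univ, Fintype.card_fin]
    intro s t h
    have := hg.injective (hpinj i _ _ (hgK _) (hgK _) h)
    simpa using this
  · intro i j k x hx y hy z hz hxy hxz hyz
    obtain ⟨s, -, rfl⟩ := Finset.mem_image.1 hx
    obtain ⟨t, -, rfl⟩ := Finset.mem_image.1 hy
    obtain ⟨u, -, rfl⟩ := Finset.mem_image.1 hz
    have ne : ∀ (i j : Fin N) (s t : Fin w),
        p i (g (finProdFinEquiv (i, s))) ≠ p j (g (finProdFinEquiv (j, t))) →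
        finProdFinEquiv (i, s) ≠ finProdFinEquiv (j, t) := by
      intro i j s t h h'
      have := finProdFinEquiv.injective h'
      simp only [Prod.mk.injEq] at this
      obtain ⟨rfl, rfl⟩ := this
      exact h rfl
    have h12 := ne _ _ _ _ hxy
    have h13 := ne _ _ _ _ hxz
    have h23 := ne _ _ _ _ hyz
    have e12 : ∀ {x y z}, E x y z ↔ E y x z := ⟨hE.swap₁₂, hE.swap₁₂⟩
    have e23 : ∀ {x y z}, E x y z ↔ E x z y := ⟨hE.swap₂₃, hE.swap₂₃⟩
    rcases lt_or_gt_of_ne h12 with a | a <;> rcases lt_or_gt_of_ne h13 with b | b <;>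
      rcases lt_or_gt_of_ne h23 with d | d <;>
      have a' := hord _ _ _ _ a <;> have b' := hord _ _ _ _ b <;> have d' := hord _ _ _ _ d
    · rw [hc' _ _ _ a d]; simp [*]
    · rw [e23, hc' _ _ _ b d]; simp [*]
    · exact absurd (a.trans d) b.asymm
    · rw [e23, e12, hc' _ _ _ b a]; simp [*]
    · rw [e12, hc' _ _ _ a b]; simp [*]
    · exact absurd (b.trans d) a.asymm
    · rw [e12, e23, hc' _ _ _ d b]; simp [*]
    · rw [e23, e12, e23, hc' _ _ _ d a]; simp [*]

/-- Two triples of indices have the same order type. -/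
def SameOrderType {L : Type*} [LT L] (i j k i' j' k' : L) : Prop :=
  (i < j ↔ i' < j') ∧ (j < i ↔ j' < i') ∧ (i < k ↔ i' < k') ∧ (k < i ↔ k' < i') ∧
    (j < k ↔ j' < k') ∧ (k < j ↔ k' < j')

set_option linter.unusedSimpArgs false in
theorem exists_sorted_extension {m : ℕ} (i j k i' j' k' : Fin m)
    (h : SameOrderType i j k i' j' k') :
    ∃ (a b c : Fin 3) (l l' : Fin 3 → Fin (m + 2)),
      l 0 < l 1 ∧ l 1 < l 2 ∧ l' 0 < l' 1 ∧ l' 1 < l' 2 ∧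
      l a = i.castAdd 2 ∧ l b = j.castAdd 2 ∧ l c = k.castAdd 2 ∧
      l' a = i'.castAdd 2 ∧ l' b = j'.castAdd 2 ∧ l' c = k'.castAdd 2 := by
  obtain ⟨h1, h2, h3, h4, h5, h6⟩ := h
  simp only [Fin.lt_def] at h1 h2 h3 h4 h5 h6
  let e : Fin m → Fin (m + 2) := Fin.castAdd 2
  let u : Fin (m + 2) := ⟨m, by omega⟩
  let v : Fin (m + 2) := ⟨m + 1, by omega⟩
  rcases lt_trichotomy (i : ℕ) j with a | a | a <;>
    rcases lt_trichotomy (i : ℕ) k with b | b | b <;>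
    rcases lt_trichotomy (j : ℕ) k with c | c | c <;> try (exfalso; omega)
  · exact ⟨0, 1, 2, ![e i, e j, e k], ![e i', e j', e k'], by
      simp [e, u, v, Fin.lt_def, Fin.ext_iff, -Fin.val_fin_lt]; omega⟩
  · exact ⟨0, 1, 1, ![e i, e j, u], ![e i', e j', u], by
      simp [e, u, v, Fin.lt_def, Fin.ext_iff, -Fin.val_fin_lt]; omega⟩
  · exact ⟨0, 2, 1, ![e i, e k, e j], ![e i', e k', e j'], by
      simp [e, u, v, Fin.lt_def, Fin.ext_iff, -Fin.val_fin_lt]; omega⟩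
  · exact ⟨0, 1, 0, ![e i, e j, u], ![e i', e j', u], by
      simp [e, u, v, Fin.lt_def, Fin.ext_iff, -Fin.val_fin_lt]; omega⟩
  · exact ⟨1, 2, 0, ![e k, e i, e j], ![e k', e i', e j'], by
      simp [e, u, v, Fin.lt_def, Fin.ext_iff, -Fin.val_fin_lt]; omega⟩
  · exact ⟨0, 0, 1, ![e i, e k, u], ![e i', e k', u], by
      simp [e, u, v, Fin.lt_def, Fin.ext_iff, -Fin.val_fin_lt]; omega⟩
  · exact ⟨0, 0, 0, ![e i, u, v], ![e i', u, v], by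
      simp [e, u, v, Fin.lt_def, Fin.ext_iff, -Fin.val_fin_lt]; omega⟩
  · exact ⟨1, 1, 0, ![e k, e i, u], ![e k', e i', u], by
      simp [e, u, v, Fin.lt_def, Fin.ext_iff, -Fin.val_fin_lt]; omega⟩
  · exact ⟨1, 0, 2, ![e j, e i, e k], ![e j', e i', e k'], by
      simp [e, u, v, Fin.lt_def, Fin.ext_iff, -Fin.val_fin_lt]; omega⟩
  · exact ⟨1, 0, 1, ![e j, e i, u], ![e j', e i', u], by
      simp [e, u, v, Fin.lt_def, Fin.ext_iff, -Fin.val_fin_lt]; omega⟩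
  · exact ⟨2, 0, 1, ![e j, e k, e i], ![e j', e k', e i'], by
      simp [e, u, v, Fin.lt_def, Fin.ext_iff, -Fin.val_fin_lt]; omega⟩
  · exact ⟨1, 0, 0, ![e j, e i, u], ![e j', e i', u], by
      simp [e, u, v, Fin.lt_def, Fin.ext_iff, -Fin.val_fin_lt]; omega⟩
  · exact ⟨2, 1, 0, ![e k, e j, e i], ![e k', e j', e i'], by
      simp [e, u, v, Fin.lt_def, Fin.ext_iff, -Fin.val_fin_lt]; omega⟩

/-- The truth value of `E` on distinct triples from the parts depends only on the second indices
and on the order type of the first indices. -/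
def UniformParts {V : Type} (E : V → V → V → Prop) {w q : ℕ} (Q : Fin w → Fin q → Finset V) :
    Prop :=
  ∀ i j k i' j' k', SameOrderType i j k i' j' k' → ∀ s t u,
    ∀ x ∈ Q i s, ∀ y ∈ Q j t, ∀ z ∈ Q k u, x ≠ y → x ≠ z → y ≠ z →
    ∀ x' ∈ Q i' s, ∀ y' ∈ Q j' t, ∀ z' ∈ Q k' u, x' ≠ y' → x' ≠ z' → y' ≠ z' →
      (E x y z ↔ E x' y' z')

theorem exists_uniformParts (q w : ℕ) :
    ∃ L K : ℕ, ∀ {V : Type} (E : V → V → V → Prop), SymmRel E →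
      ∀ P : ℕ → Fin q → Finset V, (∀ i < L, ∀ s, K ≤ (P i s).card) →
      ∃ ι : Fin w → ℕ, StrictMono ι ∧ (∀ i, ι i < L) ∧ ∃ Q : Fin w → Fin q → Finset V,
        (∀ i s, Q i s ⊆ P (ι i) s) ∧ (∀ i s, (Q i s).card = w) ∧ UniformParts E Q := by
  obtain ⟨L, hL⟩ := exists_strictMono_triple_homogeneous
    (C := Fin 3 × Fin q → Fin 3 × Fin q → Fin 3 × Fin q → Prop) (w + 2)
  obtain ⟨K, hK⟩ := exists_subparts_relation_constant (L * q) w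
  refine ⟨L, K, fun {V} E hE P hP => ?_⟩
  obtain ⟨Q, hQP, hQc, col, hcol⟩ := hK E hE
    (fun r => P (finProdFinEquiv.symm r).1 (finProdFinEquiv.symm r).2)
    (fun r => hP _ (Fin.is_lt _) _)
  let R : ℕ → Fin q → ℕ → Fin q → ℕ → Fin q → Prop := fun i s j t k u =>
    ∃ (hi : i < L) (hj : j < L) (hk : k < L), col (finProdFinEquiv (⟨i, hi⟩, s))
      (finProdFinEquiv (⟨j, hj⟩, t)) (finProdFinEquiv (⟨k, hk⟩, u))
  obtain ⟨g, hg, hgL, c, hc⟩ := hL (fun a b d x y z =>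
    R ((![a, b, d] : Fin 3 → ℕ) x.1) x.2 ((![a, b, d] : Fin 3 → ℕ) y.1) y.2
      ((![a, b, d] : Fin 3 → ℕ) z.1) z.2)
  have hR : ∀ l : Fin 3 → Fin (w + 2), l 0 < l 1 → l 1 < l 2 → ∀ α β γ s t u,
      (R (g (l α)) s (g (l β)) t (g (l γ)) u ↔ c (α, s) (β, t) (γ, u)) := by
    intro l h1 h2 α β γ s t u
    rw [← hc _ _ _ h1 h2]
    have : ∀ δ : Fin 3, (![g (l 0), g (l 1), g (l 2)] : Fin 3 → ℕ) δ = g (l δ) := by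
      intro δ; fin_cases δ <;> rfl
    simp only [this]
  refine ⟨fun i => g (i.castAdd 2), fun i j hij => hg hij, fun i => hgL _,
    fun i s => Q (finProdFinEquiv (⟨g (i.castAdd 2), hgL _⟩, s)), fun i s => ?_,
    fun i s => hQc _, ?_⟩
  · simpa using hQP (finProdFinEquiv (⟨g (i.castAdd 2), hgL _⟩, s))
  · intro i j k i' j' k' h s t u x hx y hy z hz hxy hxz hyz x' hx' y' hy' z' hz' hxy' hxz' hyz'
    rw [hcol _ _ _ x hx y hy z hz hxy hxz hyz, hcol _ _ _ x' hx' y' hy' z' hz' hxy' hxz' hyz']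
    obtain ⟨α, β, γ, l, l', h1, h2, h1', h2', e1, e2, e3, e1', e2', e3'⟩ :=
      exists_sorted_extension i j k i' j' k' h
    have H := hR l h1 h2 α β γ s t u
    have K := hR l' h1' h2' α β γ s t u
    rw [e1, e2, e3] at H
    rw [e1', e2', e3', ← H] at K
    simpa [R, hgL] using K.symm

/-- All pairs of distinct vertices of `X` form an `E`-triple with `z`. -/
def LinkComplete {V : Type} (E : V → V → V → Prop) (X : Finset V) (z : V) : Prop :=
  ∀ x ∈ X, ∀ y ∈ X, x ≠ y → E x y z

/-- No three distinct vertices of `X` form an `E`-triple. -/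
def TripleFree {V : Type} (E : V → V → V → Prop) (X : Finset V) : Prop :=
  ∀ x ∈ X, ∀ y ∈ X, ∀ z ∈ X, x ≠ y → x ≠ z → y ≠ z → ¬ E x y z

/-- On distinct triples from `X × Y × Z` the relation `E` has constant truth value `p`. -/
def ConstOn {V : Type} (E : V → V → V → Prop) (X Y Z : Finset V) (p : Prop) : Prop :=
  ∀ x ∈ X, ∀ y ∈ Y, ∀ z ∈ Z, x ≠ y → x ≠ z → y ≠ z → (E x y z ↔ p)

/-- Structure (a) for a ternary relation on an arbitrary vertex type. -/
def OrderedBlowup {V : Type} (E : V → V → V → Prop) (m : ℕ) : Prop :=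
  ∃ A : Fin m → Finset V, (∀ i j, i ≠ j → Disjoint (A i) (A j)) ∧ (∀ i, m ≤ (A i).card) ∧
    ∃ a b c d : Prop, ¬ ((a ↔ b) ∧ (b ↔ c) ∧ (c ↔ d)) ∧
      (∀ i j, i < j → ConstOn E (A i) (A j) (A j) a) ∧
      (∀ i j, i < j → ConstOn E (A i) (A i) (A j) b) ∧
      (∀ i j k, i < j → j < k → ConstOn E (A i) (A j) (A k) c) ∧
      ∀ i, ConstOn E (A i) (A i) (A i) d

/-- Structure (b) for a ternary relation on an arbitrary vertex type. -/
def PairedBlowup {V : Type} (E : V → V → V → Prop) (m : ℕ) : Prop :=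
  ∃ A B : Fin m → Finset V,
    (∀ i j, i ≠ j → Disjoint (A i) (A j)) ∧ (∀ i j, i ≠ j → Disjoint (B i) (B j)) ∧
    (∀ i j, Disjoint (A i) (B j)) ∧ (∀ i, m ≤ (A i).card) ∧ (∀ i, m ≤ (B i).card) ∧
    ∃ b₁ b₂ c₁ c₂ c₃ c₄ c₅ c₆ : Prop,
      (∀ i j, i < j → ConstOn E (A i) (A j) (B j) True ∧ ConstOn E (B i) (A j) (B j) True ∧
        ConstOn E (A i) (B i) (A j) b₁ ∧ ConstOn E (A i) (B i) (B j) b₂) ∧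
      (∀ i j k, i < j → j < k → ConstOn E (A i) (A j) (B k) c₁ ∧
        ConstOn E (A i) (B j) (A k) c₂ ∧ ConstOn E (A i) (B j) (B k) c₃ ∧
        ConstOn E (B i) (A j) (A k) c₄ ∧ ConstOn E (B i) (A j) (B k) c₅ ∧
        ConstOn E (B i) (B j) (A k) c₆) ∧
      (∀ X ∈ Set.range A ∪ Set.range B, ∀ Y ∈ Set.range A ∪ Set.range B,
        ConstOn E X X Y False) ∧
      ∀ i j k, ConstOn E (A i) (A j) (A k) False ∧ ConstOn E (B i) (B j) (B k) False

section
variable {V : Type} {E : V → V → V → Prop}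

theorem TripleFree.mono {X Y : Finset V} (h : TripleFree E Y) (hXY : X ⊆ Y) : TripleFree E X :=
  fun x hx y hy z hz => h x (hXY hx) y (hXY hy) z (hXY hz)

theorem LinkComplete.mono {X Y : Finset V} {z : V} (h : LinkComplete E Y z) (hXY : X ⊆ Y) :
    LinkComplete E X z :=
  fun x hx y hy => h x (hXY hx) y (hXY hy)

theorem UniformParts.exists_constOn {w q : ℕ} {Q : Fin w → Fin q → Finset V}
    (hQ : UniformParts E Q) (i₀ j₀ k₀ : Fin w) (s t u : Fin q) :
    ∃ p : Prop, ∀ i j k, SameOrderType i₀ j₀ k₀ i j k →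
      ConstOn E (Q i s) (Q j t) (Q k u) p := by
  refine ⟨∃ i j k, SameOrderType i₀ j₀ k₀ i j k ∧ ∃ x ∈ Q i s, ∃ y ∈ Q j t, ∃ z ∈ Q k u,
    x ≠ y ∧ x ≠ z ∧ y ≠ z ∧ E x y z, fun i j k h x hx y hy z hz hxy hxz hyz =>
    ⟨fun hE => ⟨i, j, k, h, x, hx, y, hy, z, hz, hxy, hxz, hyz, hE⟩, ?_⟩⟩
  rintro ⟨i', j', k', h', x', hx', y', hy', z', hz', hxy', hxz', hyz', hE⟩
  refine (hQ i' j' k' i j k ?_ s t u x' hx' y' hy' z' hz' hxy' hxz' hyz'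
    x hx y hy z hz hxy hxz hyz).1 hE
  obtain ⟨a₁, a₂, a₃, a₄, a₅, a₆⟩ := h
  obtain ⟨b₁, b₂, b₃, b₄, b₅, b₆⟩ := h'
  exact ⟨b₁.symm.trans a₁, b₂.symm.trans a₂, b₃.symm.trans a₃, b₄.symm.trans a₄,
    b₅.symm.trans a₅, b₆.symm.trans a₆⟩

theorem orderedBlowup_of_groups {m : ℕ} (hm : 3 ≤ m) :
    ∃ M r : ℕ, ∀ {V : Type} (E : V → V → V → Prop), SymmRel E → ∀ A : ℕ → Finset V,
      (∀ i < M, TripleFree E (A i) ∧ (A i).card = r) →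
      (∀ i j, i < j → j < M → Disjoint (A i) (A j)) →
      ((∀ i j, i < j → j < M → ∀ z ∈ A j, LinkComplete E (A i) z) ∨
        (∀ i j, i < j → j < M → ∀ x ∈ A i, LinkComplete E (A j) x)) →
      OrderedBlowup E m := by
  obtain ⟨M, r, h⟩ := exists_uniformParts 1 m
  refine ⟨M, r, fun {V} E hE A hA hd hlink => ?_⟩
  obtain ⟨ι, hι, hιM, Q, hQA, hQc, hQ⟩ := h E hE (fun i _ => A i) (fun i hi _ => (hA i hi).2.ge)
  let i₀ : Fin m := ⟨0, by omega⟩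
  let i₁ : Fin m := ⟨1, by omega⟩
  let i₂ : Fin m := ⟨2, by omega⟩
  have h01 : i₀ < i₁ := by simp [i₀, i₁]
  have h12 : i₁ < i₂ := by simp [i₂, i₁]
  obtain ⟨a, ha⟩ := hQ.exists_constOn i₀ i₁ i₁ 0 0 0
  obtain ⟨b, hb⟩ := hQ.exists_constOn i₀ i₀ i₁ 0 0 0
  obtain ⟨c, hc⟩ := hQ.exists_constOn i₀ i₁ i₂ 0 0 0
  have disj : ∀ i j, i < j → Disjoint (Q i 0) (Q j 0) := fun i j hij =>
    Finset.disjoint_of_subset_left (hQA i 0)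
      (Finset.disjoint_of_subset_right (hQA j 0) (hd _ _ (hι hij) (hιM j)))
  have hab : a ∨ b := by
    obtain ⟨x, hx, x', hx', hxx⟩ := Finset.one_lt_card.1
      (show 1 < (Q i₀ 0).card by rw [hQc]; omega)
    obtain ⟨y, hy, y', hy', hyy⟩ := Finset.one_lt_card.1
      (show 1 < (Q i₁ 0).card by rw [hQc]; omega)
    have hne : ∀ {u v}, u ∈ Q i₀ 0 → v ∈ Q i₁ 0 → u ≠ v := fun hu hv =>
      Finset.disjoint_iff_ne.1 (disj _ _ h01) _ hu _ hv
    rcases hlink with hl | hl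
    · right
      exact (hb i₀ i₀ i₁ (by simp [SameOrderType]) x hx x' hx' y hy hxx (hne hx hy)
        (hne hx' hy)).1 (hl _ _ (hι h01) (hιM _) y (hQA _ _ hy) x (hQA _ _ hx) x'
          (hQA _ _ hx') hxx)
    · left
      exact (ha i₀ i₁ i₁ (by simp [SameOrderType]) x hx y hy y' hy' (hne hx hy) (hne hx hy')
        hyy).1 (hE.swap₁₂ (hE.swap₂₃ (hl _ _ (hι h01) (hιM _) x (hQA _ _ hx) y (hQA _ _ hy) y'
          (hQA _ _ hy') hyy)))
  refine ⟨fun i => Q i 0, fun i j hij => ?_, fun i => (hQc i 0).ge, a, b, c, False, by tauto,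
    fun i j hij => ha _ _ _ ?_, fun i j hij => hb _ _ _ ?_,
    fun i j k hij hjk => hc _ _ _ ?_, fun i x hx y hy z hz hxy hxz hyz => ?_⟩
  · rcases lt_or_gt_of_ne hij with h | h
    · exact disj _ _ h
    · exact (disj _ _ h).symm
  · simp only [SameOrderType, Fin.lt_def] at *; omega
  · simp only [SameOrderType, Fin.lt_def] at *; omega
  · simp only [SameOrderType, Fin.lt_def] at *; omega
  · exact iff_false_intro ((hA _ (hιM i)).1 x (hQA _ _ hx) y (hQA _ _ hy) z (hQA _ _ hz)
      hxy hxz hyz)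

/-- A family of sets of vertices, thought of as the polynomially large ones, satisfying the
pigeonhole and dependent-random-choice properties for the relation `E`. -/
structure LargeFamily (E : V → V → V → Prop) (𝓛 : Set (Set V)) : Prop where
  nonempty : 𝓛.Nonempty
  sdiff_mem : ∀ S ∈ 𝓛, ∀ F : Finset V, S \ F ∈ 𝓛
  link_split : ∀ S ∈ 𝓛, ∀ X : Finset V,
    {z ∈ S | LinkComplete E X z} ∈ 𝓛 ∨ {z ∈ S | ¬ LinkComplete E X z} ∈ 𝓛
  exists_common_link : ∀ S ∈ 𝓛, ∀ R : ℕ, ∃ W ∈ 𝓛, W ⊆ S ∧ ∀ A : Finset V, ↑A ⊆ W → A.card ≤ R →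
    ∃ W' ∈ 𝓛, W' ⊆ S ∧ ∀ B : Finset V, ↑B ⊆ W' → B.card ≤ R →
      {z ∈ S | ∀ a ∈ A, ∀ b ∈ B, E a b z} ∈ 𝓛

namespace LargeFamily
variable {𝓛 : Set (Set V)}

theorem restrict (h : LargeFamily E 𝓛) {U : Set V} (hU : U ∈ 𝓛) :
    LargeFamily E {S ∈ 𝓛 | S ⊆ U} where
  nonempty := ⟨U, hU, le_rfl⟩
  sdiff_mem S hS F := ⟨h.sdiff_mem S hS.1 F, Set.sdiff_subset.trans hS.2⟩
  link_split S hS X := (h.link_split S hS.1 X).imp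
    (fun h' => ⟨h', fun _ hz => hS.2 hz.1⟩) (fun h' => ⟨h', fun _ hz => hS.2 hz.1⟩)
  exists_common_link S hS R := by
    obtain ⟨W, hW, hWS, H⟩ := h.exists_common_link S hS.1 R
    refine ⟨W, ⟨hW, hWS.trans hS.2⟩, hWS, fun A hA hAR => ?_⟩
    obtain ⟨W', hW', hWS', H'⟩ := H A hA hAR
    exact ⟨W', ⟨hW', hWS'.trans hS.2⟩, hWS', fun B hB hBR =>
      ⟨H' B hB hBR, fun _ hz => hS.2 hz.1⟩⟩

end LargeFamily

theorem exists_subset_forall_finset {𝓛 : Set (Set V)} {ι : Type*} (I : Finset ι)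
    (p : ι → Set V → Prop) (mono : ∀ i S S', S' ⊆ S → p i S → p i S')
    (ex : ∀ i ∈ I, ∀ S ∈ 𝓛, ∃ S' ∈ 𝓛, S' ⊆ S ∧ p i S') :
    ∀ S ∈ 𝓛, ∃ S' ∈ 𝓛, S' ⊆ S ∧ ∀ i ∈ I, p i S' := by
  induction I using Finset.induction_on with
  | empty => exact fun S hS => ⟨S, hS, le_rfl, by simp⟩
  | insert i I _ ih =>
    intro S hS
    obtain ⟨S₁, hS₁, h₁, H₁⟩ := ih (fun j hj => ex j (Finset.mem_insert_of_mem hj)) S hS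
    obtain ⟨S₂, hS₂, h₂, H₂⟩ := ex i (Finset.mem_insert_self _ _) S₁ hS₁
    refine ⟨S₂, hS₂, h₂.trans h₁, fun j hj => ?_⟩
    rcases Finset.mem_insert.1 hj with rfl | hj
    · exact H₂
    · exact mono _ _ _ h₂ (H₁ j hj)

/-- `X` is disjoint from `S`, and neither triples of type `XXS` nor triples of type `XSS`
are complete on large subsets from the family `𝓖`. -/
def Unlinked (E : V → V → V → Prop) (𝓖 : Finset V → Prop) (r k : ℕ) (X : Finset V) (S : Set V) :
    Prop :=
  Disjoint (X : Set V) S ∧ (∀ X₀ ⊆ X, X₀.card = r → ∀ z ∈ S, ¬ LinkComplete E X₀ z) ∧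
    ∀ X₀ ⊆ X, X₀.card = r → ∀ Y : Finset V, ↑Y ⊆ S → 𝓖 Y → Y.card = k →
      ¬ ∀ x ∈ X₀, LinkComplete E Y x

theorem Unlinked.mono {𝓖 : Finset V → Prop} {r k : ℕ} {X : Finset V} {S S' : Set V}
    (h : Unlinked E 𝓖 r k X S) (hS : S' ⊆ S) : Unlinked E 𝓖 r k X S' :=
  ⟨h.1.mono_right hS, fun X₀ hX hr z hz => h.2.1 X₀ hX hr z (hS hz),
    fun X₀ hX hr Y hY => h.2.2 X₀ hX hr Y (hY.trans hS)⟩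

/-- A hereditary family of triple-free sets, found in all large sets, whose members have no
complete links to large sets in either direction. -/
structure UnlinkedFamily (E : V → V → V → Prop) (𝓛 : Set (Set V)) (𝓖 : Finset V → Prop)
    (r k K : ℕ) : Prop where
  mono : ∀ X Y, X ⊆ Y → 𝓖 Y → 𝓖 X
  tripleFree : ∀ X, 𝓖 X → TripleFree E X
  exists_subset : ∀ S ∈ 𝓛, ∃ Y : Finset V, ↑Y ⊆ S ∧ 𝓖 Y ∧ Y.card = K
  notMem : ∀ S₀ ∈ 𝓛, ∀ X : Finset V, ↑X ⊆ S₀ → 𝓖 X → X.card = r → ∀ S ∈ 𝓛,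
    {z ∈ S | LinkComplete E X z} ∉ 𝓛
  exists_avoiding : ∀ S₀ ∈ 𝓛, ∀ X : Finset V, ↑X ⊆ S₀ → 𝓖 X → X.card = r → ∀ S ∈ 𝓛,
    ∃ S' ∈ 𝓛, S' ⊆ S ∧ ∀ Y : Finset V, ↑Y ⊆ S' → 𝓖 Y → Y.card = k →
      ¬ ∀ x ∈ X, LinkComplete E Y x

theorem UnlinkedFamily.exists_unlinked {𝓛 : Set (Set V)} {𝓖 : Finset V → Prop} {r k K : ℕ}
    (hG : UnlinkedFamily E 𝓛 𝓖 r k K) (hL : LargeFamily E 𝓛) {S₀ : Set V} (hS₀ : S₀ ∈ 𝓛)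
    {X : Finset V} (hX : ↑X ⊆ S₀) (hXG : 𝓖 X) {S : Set V} (hS : S ∈ 𝓛) :
    ∃ S' ∈ 𝓛, S' ⊆ S ∧ Unlinked E 𝓖 r k X S' := by
  obtain ⟨S₁, hS₁, hs₁, H₁⟩ := exists_subset_forall_finset (Finset.powersetCard r X)
    (fun X₀ S => ∀ z ∈ S, ¬ LinkComplete E X₀ z) (fun X₀ S S' h h' z hz => h' z (h hz))
    (fun X₀ hX₀ S hS => by
      obtain ⟨hs, hc⟩ := Finset.mem_powersetCard.1 hX₀
      have := hG.notMem S₀ hS₀ X₀ ((Finset.coe_subset.2 hs).trans hX) (hG.mono _ _ hs hXG) hc S hS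
      exact ⟨_, (hL.link_split S hS X₀).resolve_left this, fun z hz => hz.1, fun z hz => hz.2⟩)
    (S \ X) (hL.sdiff_mem S hS X)
  obtain ⟨S₂, hS₂, hs₂, H₂⟩ := exists_subset_forall_finset (Finset.powersetCard r X)
    (fun X₀ S => ∀ Y : Finset V, ↑Y ⊆ S → 𝓖 Y → Y.card = k → ¬ ∀ x ∈ X₀, LinkComplete E Y x)
    (fun X₀ S S' h h' Y hY => h' Y (hY.trans h))
    (fun X₀ hX₀ S hS => by
      obtain ⟨hs, hc⟩ := Finset.mem_powersetCard.1 hX₀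
      exact hG.exists_avoiding S₀ hS₀ X₀ ((Finset.coe_subset.2 hs).trans hX)
        (hG.mono _ _ hs hXG) hc S hS) S₁ hS₁
  have hsub := hs₂.trans hs₁
  exact ⟨S₂, hS₂, hsub.trans Set.sdiff_subset,
    Set.disjoint_left.2 fun x hx hx' => (hsub hx').2 hx,
    fun X₀ h h' z hz => H₁ X₀ (Finset.mem_powersetCard.2 ⟨h, h'⟩) z (hs₂ hz),
    fun X₀ hs hc => H₂ X₀ (Finset.mem_powersetCard.2 ⟨hs, hc⟩)⟩

/-- Repeatedly choosing pairs of parts that are complete to everything chosen later. -/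
theorem UnlinkedFamily.exists_pairs {𝓛 : Set (Set V)} {𝓖 : Finset V → Prop} {r k K : ℕ}
    (hG : UnlinkedFamily E 𝓛 𝓖 r k K) (hL : LargeFamily E 𝓛) (l : ℕ) :
    ∃ P : ℕ → Fin 2 → Finset V, ∃ S ∈ 𝓛,
      (∀ i < l, ∀ s, 𝓖 (P i s) ∧ (P i s).card = K ∧ Unlinked E 𝓖 r k (P i s) S) ∧
      (∀ i < l, Unlinked E 𝓖 r k (P i 0) (P i 1)) ∧
      (∀ i < l, ∀ x ∈ P i 0, ∀ y ∈ P i 1, ∀ z ∈ S, E x y z) ∧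
      (∀ i j, i < j → j < l → ∀ s t, Unlinked E 𝓖 r k (P i s) (P j t)) ∧
      (∀ i j, i < j → j < l → ∀ t, ∀ x ∈ P i 0, ∀ y ∈ P i 1, ∀ z ∈ P j t, E x y z) := by
  induction l with
  | zero =>
    obtain ⟨S, hS⟩ := hL.nonempty
    exact ⟨fun _ _ => ∅, S, hS, by simp, by simp, by simp, by simp, by simp⟩
  | succ l ih =>
    obtain ⟨P, S, hS, h1, h2, h3, h4, h5⟩ := ih
    obtain ⟨W, hW, hWS, HW⟩ := hL.exists_common_link S hS K
    obtain ⟨A, hAW, hAG, hAc⟩ := hG.exists_subset W hW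
    obtain ⟨W₁, hW₁, hWS₁, HW₁⟩ := HW A hAW hAc.le
    obtain ⟨W₂, hW₂, hW₂₁, hAW₂⟩ := hG.exists_unlinked hL hW hAW hAG hW₁
    obtain ⟨B, hBW, hBG, hBc⟩ := hG.exists_subset W₂ hW₂
    have hZ := HW₁ B (hBW.trans hW₂₁) hBc.le
    obtain ⟨S₁, hS₁, hs₁, hAS⟩ := hG.exists_unlinked hL hW hAW hAG hZ
    obtain ⟨S₂, hS₂, hs₂, hBS⟩ := hG.exists_unlinked hL hW₂ hBW hBG hS₁
    have hS₂S : S₂ ⊆ S := fun z hz => (hs₁ (hs₂ hz)).1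
    have hAS' : (A : Set V) ⊆ S := hAW.trans hWS
    have hBS' : (B : Set V) ⊆ S := hBW.trans (hW₂₁.trans hWS₁)
    have hnew : ∀ t, ((![A, B] : Fin 2 → Finset V) t : Set V) ⊆ S := by
      intro t; fin_cases t
      · exact hAS'
      · exact hBS'
    refine ⟨Function.update P l ![A, B], S₂, hS₂, fun i hi s => ?_, fun i hi => ?_,
      fun i hi => ?_, fun i j hij hj s t => ?_, fun i j hij hj t => ?_⟩
    · rcases Nat.lt_succ_iff_lt_or_eq.1 hi with h | rfl
      · rw [Function.update_of_ne h.ne]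
        exact ⟨(h1 i h s).1, (h1 i h s).2.1, (h1 i h s).2.2.mono hS₂S⟩
      · rw [Function.update_self]
        fin_cases s
        · exact ⟨hAG, hAc, hAS.mono hs₂⟩
        · exact ⟨hBG, hBc, hBS⟩
    · rcases Nat.lt_succ_iff_lt_or_eq.1 hi with h | rfl
      · rw [Function.update_of_ne h.ne]
        exact h2 i h
      · rw [Function.update_self]
        exact hAW₂.mono hBW
    · rcases Nat.lt_succ_iff_lt_or_eq.1 hi with h | rfl
      · rw [Function.update_of_ne h.ne]
        exact fun x hx y hy z hz => h3 i h x hx y hy z (hS₂S hz)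
      · rw [Function.update_self]
        exact fun x hx y hy z hz => (hs₁ (hs₂ hz)).2 x hx y hy
    · rcases Nat.lt_succ_iff_lt_or_eq.1 hj with h | rfl
      · rw [Function.update_of_ne h.ne, Function.update_of_ne (hij.trans h).ne]
        exact h4 i j hij h s t
      · rw [Function.update_self, Function.update_of_ne hij.ne]
        exact (h1 i hij s).2.2.mono (hnew t)
    · rcases Nat.lt_succ_iff_lt_or_eq.1 hj with h | rfl
      · rw [Function.update_of_ne h.ne, Function.update_of_ne (hij.trans h).ne]
        exact h5 i j hij h t
      · rw [Function.update_self, Function.update_of_ne hij.ne]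
        exact fun x hx y hy z hz => h3 i hij x hx y hy z (hnew t hz)

end

section
variable {V : Type} {E : V → V → V → Prop}

theorem ConstOn.swap₁₂ (hE : SymmRel E) {X Y Z : Finset V} {p : Prop} (h : ConstOn E X Y Z p) :
    ConstOn E Y X Z p := fun y hy x hx z hz hyx hyz hxz =>
  ⟨fun h' => (h x hx y hy z hz hyx.symm hxz hyz).1 (hE.swap₁₂ h'),
    fun hp => hE.swap₁₂ ((h x hx y hy z hz hyx.symm hxz hyz).2 hp)⟩

theorem ConstOn.swap₂₃ (hE : SymmRel E) {X Y Z : Finset V} {p : Prop} (h : ConstOn E X Y Z p) :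
    ConstOn E X Z Y p := fun x hx z hz y hy hxz hxy hzy =>
  ⟨fun h' => (h x hx y hy z hz hxy hxz hzy.symm).1 (hE.swap₂₃ h'),
    fun hp => hE.swap₂₃ ((h x hx y hy z hz hxy hxz hzy.symm).2 hp)⟩

theorem Unlinked.mono_left {𝓖 : Finset V → Prop} {r k : ℕ} {X X' : Finset V} {S : Set V}
    (h : Unlinked E 𝓖 r k X S) (hX : X' ⊆ X) : Unlinked E 𝓖 r k X' S :=
  ⟨h.1.mono_left (Finset.coe_subset.2 hX), fun X₀ h' => h.2.1 X₀ (h'.trans hX),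
    fun X₀ h' => h.2.2 X₀ (h'.trans hX)⟩

theorem Unlinked.constOn_left {𝓖 : Finset V → Prop} {r k : ℕ} {X Y : Finset V}
    (h : Unlinked E 𝓖 r k X Y) (hr : r ≤ X.card) (hY : Y.Nonempty) {p : Prop}
    (hp : ConstOn E X X Y p) : ConstOn E X X Y False := by
  suffices ¬ p by rwa [eq_false this] at hp
  intro hp'
  obtain ⟨X₀, hX₀, hc⟩ := Finset.exists_subset_card_eq hr
  obtain ⟨z, hz⟩ := hY
  have hne : ∀ x ∈ X₀, x ≠ z := fun x hx hxz =>
    Set.disjoint_left.1 h.1 (hX₀ hx) (hxz ▸ hz)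
  exact h.2.1 X₀ hX₀ hc z hz fun x hx y hy hxy =>
    (hp x (hX₀ hx) y (hX₀ hy) z hz hxy (hne x hx) (hne y hy)).2 hp'

theorem Unlinked.constOn_right {𝓖 : Finset V → Prop} {r k : ℕ} {X Y : Finset V}
    (h : Unlinked E 𝓖 r k X Y) (hG : ∀ Y' ⊆ Y, 𝓖 Y') (hr : r ≤ X.card) (hk : k ≤ Y.card)
    {p : Prop} (hp : ConstOn E Y Y X p) : ConstOn E Y Y X False := by
  suffices ¬ p by rwa [eq_false this] at hp
  intro hp'
  obtain ⟨X₀, hX₀, hc⟩ := Finset.exists_subset_card_eq hr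
  obtain ⟨Y₀, hY₀, hc'⟩ := Finset.exists_subset_card_eq hk
  have hne : ∀ x ∈ X₀, ∀ y ∈ Y₀, y ≠ x := fun x hx y hy hxy =>
    Set.disjoint_left.1 h.1 (hX₀ hx) (hxy ▸ hY₀ hy)
  exact h.2.2 X₀ hX₀ hc Y₀ (Finset.coe_subset.2 hY₀) (hG Y₀ hY₀) hc' fun z hz x hx y hy hxy =>
    (hp x (hY₀ hx) y (hY₀ hy) z (hX₀ hz) hxy (hne z hz x hx) (hne z hz y hy)).2 hp'

theorem UnlinkedFamily.blowup {m : ℕ} (hm : 3 ≤ m) (r k : ℕ) :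
    ∃ K : ℕ, ∀ {V : Type} {E : V → V → V → Prop} {𝓛 : Set (Set V)} {𝓖 : Finset V → Prop},
      SymmRel E → LargeFamily E 𝓛 → UnlinkedFamily E 𝓛 𝓖 r k K →
      OrderedBlowup E m ∨ PairedBlowup E m := by
  obtain ⟨L, K, h⟩ := exists_uniformParts 2 (m + r + k)
  refine ⟨K, fun {V E 𝓛 𝓖} hE hL hG => ?_⟩
  obtain ⟨P, S, hS, h1, h2, h3, h4, h5⟩ := hG.exists_pairs hL L
  obtain ⟨ι, hι, hιL, Q, hQP, hQc, hQ⟩ := h E hE P (fun i hi s => (h1 i hi s).2.1.ge)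
  have hGQ : ∀ i s, ∀ Y ⊆ Q i s, 𝓖 Y := fun i s Y hY =>
    hG.mono _ _ (hY.trans (hQP i s)) (h1 _ (hιL i) s).1
  have hne : ∀ i s, (Q i s).Nonempty := fun i s =>
    Finset.card_pos.1 (by rw [hQc]; omega)
  have unl : ∀ i s j t, (i < j ∨ i = j ∧ s < t) → Unlinked E 𝓖 r k (Q i s) (Q j t) := by
    rintro i s j t (hij | ⟨rfl, hst⟩)
    · exact ((h4 _ _ (hι hij) (hιL j) s t).mono (Finset.coe_subset.2 (hQP j t))).mono_left
        (hQP i s)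
    · obtain ⟨rfl, rfl⟩ : s = 0 ∧ t = 1 := by omega
      exact ((h2 _ (hιL i)).mono (Finset.coe_subset.2 (hQP i 1))).mono_left (hQP i 0)
  have disj : ∀ i s j t, (i ≠ j ∨ s ≠ t) → Disjoint (Q i s) (Q j t) := by
    intro i s j t hne
    rcases lt_trichotomy i j with hij | rfl | hij
    · exact Finset.disjoint_coe.1 (unl i s j t (.inl hij)).1
    · rcases lt_or_gt_of_ne (hne.resolve_left (by simp)) with hst | hst
      · exact Finset.disjoint_coe.1 (unl i s i t (.inr ⟨rfl, hst⟩)).1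
      · exact (Finset.disjoint_coe.1 (unl i t i s (.inr ⟨rfl, hst⟩)).1).symm
    · exact (Finset.disjoint_coe.1 (unl j t i s (.inl hij)).1).symm
  have zero : ∀ i s j t, ConstOn E (Q i s) (Q i s) (Q j t) False := by
    intro i s j t
    have refl : SameOrderType i i j i i j := by simp [SameOrderType]
    obtain ⟨p, hp⟩ := hQ.exists_constOn i i j s s t
    replace hp := hp i i j refl
    by_cases heq : i = j ∧ s = t
    · obtain ⟨rfl, rfl⟩ := heq
      exact fun x hx y hy z hz hxy hxz hyz =>
        iff_false_intro (hG.tripleFree _ (hGQ i s _ le_rfl) x hx y hy z hz hxy hxz hyz)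
    · by_cases hlt : i < j ∨ i = j ∧ s < t
      · exact (unl i s j t hlt).constOn_left (by rw [hQc]; omega) (hne j t) hp
      · exact (unl j t i s (by omega)).constOn_right (hGQ i s) (by rw [hQc]; omega)
          (by rw [hQc]; omega) hp
  let e : Fin m → Fin (m + r + k) := fun i => Fin.castLE (by omega) (Fin.rev i)
  have he : ∀ {i j}, i < j → e j < e i := fun hij => by simpa [e] using hij
  have hinj : ∀ {i j}, i ≠ j → e i ≠ e j := fun hij => by simpa [e] using hij
  let i₀ : Fin m := ⟨0, by omega⟩
  let i₁ : Fin m := ⟨1, by omega⟩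
  let i₂ : Fin m := ⟨2, by omega⟩
  have h01 : e i₁ < e i₀ := he (by simp [i₀, i₁])
  have h12 : e i₂ < e i₁ := he (by simp [i₂, i₁])
  have hb : ∀ s t u, ∃ b : Prop, ∀ i j, i < j →
      ConstOn E (Q (e i) s) (Q (e i) t) (Q (e j) u) b := fun s t u => by
    obtain ⟨b, hb⟩ := hQ.exists_constOn (e i₀) (e i₀) (e i₁) s t u
    refine ⟨b, fun i j hij => hb _ _ _ ?_⟩
    have := he hij
    simp only [SameOrderType]; omega
  have hc : ∀ s t u, ∃ c : Prop, ∀ i j k, i < j → j < k →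
      ConstOn E (Q (e i) s) (Q (e j) t) (Q (e k) u) c := fun s t u => by
    obtain ⟨c, hc⟩ := hQ.exists_constOn (e i₀) (e i₁) (e i₂) s t u
    refine ⟨c, fun i j k hij hjk => hc _ _ _ ?_⟩
    have := he hij
    have := he hjk
    simp only [SameOrderType]; omega
  have card : ∀ i s, m ≤ (Q (e i) s).card := fun i s => by rw [hQc]; omega
  have pair : ∀ i j, i < j → ∀ s, ConstOn E (Q (e i) s) (Q (e j) 0) (Q (e j) 1) True :=
    fun i j hij s x hx y hy z hz _ _ _ => iff_true_intro <| hE.swap₁₂ <| hE.swap₂₃ <|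
      h5 _ _ (hι (he hij)) (hιL _) s y (hQP _ _ hy) z (hQP _ _ hz) x (hQP _ _ hx)
  by_cases ho : ∃ s, ∀ i j k, i < j → j < k →
      ConstOn E (Q (e i) s) (Q (e j) s) (Q (e k) s) True
  · obtain ⟨s, hs⟩ := ho
    exact .inl ⟨fun i => Q (e i) s, fun i j hij => disj _ _ _ _ (.inl (hinj hij)),
      fun i => card i s, False, False, True, False, by tauto,
      fun i j _ => ((zero (e j) s (e i) s).swap₂₃ hE).swap₁₂ hE, fun i j _ => zero _ _ _ _,
      hs, fun i => zero _ _ _ _⟩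
  have same : ∀ s i j k, ConstOn E (Q (e i) s) (Q (e j) s) (Q (e k) s) False := by
    intro s
    obtain ⟨c, hc⟩ := hc s s s
    have hcf : ¬ c := fun h => ho ⟨s, by rwa [eq_true h] at hc⟩
    rw [eq_false hcf] at hc
    intro i j k
    by_cases hij : i = j
    · subst hij; exact zero _ _ _ _
    by_cases hik : i = k
    · subst hik; exact (zero _ _ _ _).swap₂₃ hE
    by_cases hjk : j = k
    · subst hjk; exact ((zero _ _ _ _).swap₂₃ hE).swap₁₂ hE
    rcases lt_or_gt_of_ne hij with h | h <;> rcases lt_or_gt_of_ne hik with h' | h' <;>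
      rcases lt_or_gt_of_ne hjk with h'' | h''
    · exact hc _ _ _ h h''
    · exact (hc _ _ _ h' h'').swap₂₃ hE
    · exact absurd (h.trans h'') h'.not_gt
    · exact ((hc _ _ _ h' h).swap₁₂ hE).swap₂₃ hE
    · exact (hc _ _ _ h h').swap₁₂ hE
    · exact absurd (h''.trans h) h'.not_gt
    · exact ((hc _ _ _ h'' h').swap₂₃ hE).swap₁₂ hE
    · exact (((hc _ _ _ h'' h).swap₂₃ hE).swap₁₂ hE).swap₂₃ hE
  obtain ⟨b₁, hb₁⟩ := hb 0 1 0
  obtain ⟨b₂, hb₂⟩ := hb 0 1 1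
  obtain ⟨c₁, hc₁⟩ := hc 0 0 1
  obtain ⟨c₂, hc₂⟩ := hc 0 1 0
  obtain ⟨c₃, hc₃⟩ := hc 0 1 1
  obtain ⟨c₄, hc₄⟩ := hc 1 0 0
  obtain ⟨c₅, hc₅⟩ := hc 1 0 1
  obtain ⟨c₆, hc₆⟩ := hc 1 1 0
  refine .inr ⟨fun i => Q (e i) 0, fun i => Q (e i) 1,
    fun i j hij => disj _ _ _ _ (.inl (hinj hij)), fun i j hij => disj _ _ _ _ (.inl (hinj hij)),
    fun i j => disj _ _ _ _ (.inr (by simp)), fun i => card i 0, fun i => card i 1,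
    b₁, b₂, c₁, c₂, c₃, c₄, c₅, c₆,
    fun i j hij => ⟨pair i j hij 0, pair i j hij 1, hb₁ i j hij, hb₂ i j hij⟩,
    fun i j k hij hjk => ⟨hc₁ _ _ _ hij hjk, hc₂ _ _ _ hij hjk, hc₃ _ _ _ hij hjk,
      hc₄ _ _ _ hij hjk, hc₅ _ _ _ hij hjk, hc₆ _ _ _ hij hjk⟩, ?_,
    fun i j k => ⟨same 0 i j k, same 1 i j k⟩⟩
  rintro X (⟨i, rfl⟩ | ⟨i, rfl⟩) Y (⟨j, rfl⟩ | ⟨j, rfl⟩) <;> exact zero _ _ _ _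

end

section
variable {V : Type} {E : V → V → V → Prop}

/-- `X` is triple-free and completely linked from each vertex of the first `l` sets `A i`. -/
def LinkedFrom (E : V → V → V → Prop) (A : ℕ → Finset V) (l : ℕ) (X : Finset V) : Prop :=
  TripleFree E X ∧ ∀ i < l, ∀ x ∈ A i, LinkComplete E X x

/-- A sequence of `l` triple-free sets of size `r`, each completely linked to the later ones,
which extends into every large subset of `U` by a set of size `k`. -/
structure ForwardChain (E : V → V → V → Prop) (𝓛 : Set (Set V)) (r l k : ℕ)
    (A : ℕ → Finset V) (U : Set V) : Prop where
  tripleFree : ∀ i < l, TripleFree E (A i) ∧ (A i).card = r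
  disjoint : ∀ i j, i < j → j < l → Disjoint (A i) (A j)
  linked : ∀ i j, i < j → j < l → ∀ x ∈ A i, LinkComplete E (A j) x
  mem : U ∈ 𝓛
  disjoint_left : ∀ i < l, Disjoint (A i : Set V) U
  extend : ∀ S ∈ 𝓛, S ⊆ U → ∃ Y : Finset V, ↑Y ⊆ S ∧ LinkedFrom E A l Y ∧ Y.card = k

theorem ForwardChain.update {𝓛 : Set (Set V)} {r l k k' : ℕ} {A : ℕ → Finset V} {U S : Set V}
    (h : ForwardChain E 𝓛 r l k A U) (hL : LargeFamily E 𝓛) {X : Finset V} (hX : ↑X ⊆ U)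
    (hXl : LinkedFrom E A l X) (hXr : X.card = r) (hS : S ∈ 𝓛) (hSU : S ⊆ U)
    (hex : ∀ S' ∈ 𝓛, S' ⊆ S → ∃ Y : Finset V, ↑Y ⊆ S' ∧ LinkedFrom E A l Y ∧ Y.card = k' ∧
      ∀ x ∈ X, LinkComplete E Y x) :
    ForwardChain E 𝓛 r (l + 1) k' (Function.update A l X) (S \ X) where
  tripleFree i hi := by
    rcases Nat.lt_succ_iff_lt_or_eq.1 hi with hi | rfl
    · simpa [Function.update_of_ne hi.ne] using h.tripleFree i hi
    · simpa using ⟨hXl.1, hXr⟩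
  disjoint i j hij hj := by
    rcases Nat.lt_succ_iff_lt_or_eq.1 hj with hj | rfl
    · simpa [Function.update_of_ne hj.ne, Function.update_of_ne (hij.trans hj).ne]
        using h.disjoint i j hij hj
    · simpa [Function.update_of_ne hij.ne] using
        Finset.disjoint_coe.1 ((h.disjoint_left i hij).mono_right hX)
  linked i j hij hj := by
    rcases Nat.lt_succ_iff_lt_or_eq.1 hj with hj | rfl
    · simpa [Function.update_of_ne hj.ne, Function.update_of_ne (hij.trans hj).ne]
        using h.linked i j hij hj
    · simpa [Function.update_of_ne hij.ne] using hXl.2 i hij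
  mem := hL.sdiff_mem S hS X
  disjoint_left i hi := by
    rcases Nat.lt_succ_iff_lt_or_eq.1 hi with hi | rfl
    · rw [Function.update_of_ne hi.ne]
      exact (h.disjoint_left i hi).mono_right (Set.sdiff_subset.trans hSU)
    · simpa using Set.disjoint_sdiff_right
  extend S' hS' hsub := by
    obtain ⟨Y, hY, hYl, hYc, hYX⟩ := hex S' hS' (hsub.trans Set.sdiff_subset)
    refine ⟨Y, hY, ⟨hYl.1, fun i hi => ?_⟩, hYc⟩
    rcases Nat.lt_succ_iff_lt_or_eq.1 hi with hi | rfl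
    · simpa [Function.update_of_ne hi.ne] using hYl.2 i hi
    · simpa using hYX

theorem exists_backwardChain {𝓛 : Set (Set V)} (hL : LargeFamily E 𝓛) {r : ℕ}
    (h : ∀ S ∈ 𝓛, ∃ X : Finset V, ↑X ⊆ S ∧ TripleFree E X ∧ X.card = r ∧
      ∃ S' ∈ 𝓛, S' ⊆ S ∧ ∀ z ∈ S', LinkComplete E X z) (l : ℕ) :
    ∃ A : ℕ → Finset V, ∃ S ∈ 𝓛, (∀ i < l, TripleFree E (A i) ∧ (A i).card = r) ∧
      (∀ i j, i < j → j < l → Disjoint (A i) (A j)) ∧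
      (∀ i j, i < j → j < l → ∀ z ∈ A j, LinkComplete E (A i) z) ∧
      (∀ i < l, Disjoint (A i : Set V) S) ∧ ∀ i < l, ∀ z ∈ S, LinkComplete E (A i) z := by
  induction l with
  | zero =>
    obtain ⟨S, hS⟩ := hL.nonempty
    exact ⟨fun _ => ∅, S, hS, by simp, by simp, by simp, by simp, by simp⟩
  | succ l ih =>
    obtain ⟨A, S, hS, h1, h2, h3, h4, h5⟩ := ih
    obtain ⟨X, hXS, hXf, hXr, S', hS', hS'S, hX⟩ := h S hS
    refine ⟨Function.update A l X, S' \ X, hL.sdiff_mem S' hS' X, fun i hi => ?_,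
      fun i j hij hj => ?_, fun i j hij hj => ?_, fun i hi => ?_, fun i hi => ?_⟩
    · rcases Nat.lt_succ_iff_lt_or_eq.1 hi with hi | rfl
      · simpa [Function.update_of_ne hi.ne] using h1 i hi
      · simpa using ⟨hXf, hXr⟩
    · rcases Nat.lt_succ_iff_lt_or_eq.1 hj with hj | rfl
      · simpa [Function.update_of_ne hj.ne, Function.update_of_ne (hij.trans hj).ne]
          using h2 i j hij hj
      · simpa [Function.update_of_ne hij.ne] using
          Finset.disjoint_coe.1 ((h4 i hij).mono_right hXS)
    · rcases Nat.lt_succ_iff_lt_or_eq.1 hj with hj | rfl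
      · simpa [Function.update_of_ne hj.ne, Function.update_of_ne (hij.trans hj).ne]
          using h3 i j hij hj
      · simpa [Function.update_of_ne hij.ne] using fun z hz => h5 i hij z (hXS hz)
    · rcases Nat.lt_succ_iff_lt_or_eq.1 hi with hi | rfl
      · rw [Function.update_of_ne hi.ne]
        exact (h4 i hi).mono_right (Set.sdiff_subset.trans hS'S)
      · simpa using Set.disjoint_sdiff_right
    · rcases Nat.lt_succ_iff_lt_or_eq.1 hi with hi | rfl
      · simpa [Function.update_of_ne hi.ne] using fun z hz _ => h5 i hi z (hS'S hz)
      · simpa using fun z hz _ => hX z hz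

theorem LargeFamily.blowup {m : ℕ} (hm : 3 ≤ m) :
    ∃ K : ℕ, ∀ {V : Type} {E : V → V → V → Prop} {𝓛 : Set (Set V)}, SymmRel E →
      LargeFamily E 𝓛 →
      (∀ S ∈ 𝓛, ∃ Y : Finset V, ↑Y ⊆ S ∧ TripleFree E Y ∧ Y.card = K) →
      OrderedBlowup E m ∨ PairedBlowup E m := by
  obtain ⟨M, r, hMr⟩ := orderedBlowup_of_groups hm
  choose f hf using fun k => UnlinkedFamily.blowup hm r k
  refine ⟨f^[M] 0, fun {V E 𝓛} hE hL hK => ?_⟩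
  by_cases hback : ∀ S ∈ 𝓛, ∃ X : Finset V, ↑X ⊆ S ∧ TripleFree E X ∧ X.card = r ∧
      ∃ S' ∈ 𝓛, S' ⊆ S ∧ ∀ z ∈ S', LinkComplete E X z
  · obtain ⟨A, S, -, h1, h2, h3, -⟩ := exists_backwardChain hL hback M
    exact .inl (hMr E hE A h1 h2 (.inl h3))
  push Not at hback
  obtain ⟨U₁, hU₁, hback⟩ := hback
  have game : ∀ j l, l + j = M → ∀ A U, U ⊆ U₁ → ForwardChain E 𝓛 r l (f^[j] 0) A U →
      OrderedBlowup E m ∨ PairedBlowup E m := by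
    intro j
    induction j with
    | zero =>
      rintro l rfl A U - h
      exact .inl (hMr E hE A h.tripleFree h.disjoint (.inr h.linked))
    | succ j ih =>
      intro l hl A U hU h
      by_contra hcon
      refine hcon (hf (f^[j] 0) hE (hL.restrict h.mem) (𝓖 := LinkedFrom E A l) ?_)
      refine ⟨fun X Y hXY hY => ⟨hY.1.mono hXY, fun i hi x hx => (hY.2 i hi x hx).mono hXY⟩,
        fun X hX => hX.1, fun S hS => ?_, fun S₀ hS₀ X hX hXl hXr S hS hmem => ?_,
        fun S₀ hS₀ X hX hXl hXr S hS => ?_⟩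
      · have := h.extend S hS.1 hS.2
        rwa [Function.iterate_succ_apply'] at this
      · obtain ⟨z, hz, hz'⟩ := hback X (hX.trans (hS₀.2.trans hU)) hXl.1 hXr _ hmem.1
          (hmem.2.trans hU)
        exact hz' hz.2
      · by_contra! hno
        refine hcon (ih (l + 1) (by omega) _ _ ?_ (h.update hL (hX.trans hS₀.2) hXl hXr hS.1 hS.2
          fun S' hS' hsub => ?_))
        · exact Set.sdiff_subset.trans (hS.2.trans hU)
        · exact hno S' ⟨hS', hsub.trans hS.2⟩ hsub
  refine game M 0 (by omega) (fun _ => ∅) U₁ le_rfl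
    ⟨by simp, by simp, by simp, hU₁, by simp, fun S hS _ => ?_⟩
  obtain ⟨Y, hY, hYf, hYc⟩ := hK S hS
  exact ⟨Y, hY, ⟨hYf, by simp⟩, hYc⟩

theorem SymmRel.not (hE : SymmRel E) : SymmRel fun x y z => ¬ E x y z :=
  ⟨fun h h' => h (hE.swap₁₂ h'), fun h h' => h (hE.swap₂₃ h')⟩

theorem LargeFamily.exists_subset_card_eq {𝓛 : Set (Set V)} (hL : LargeFamily E 𝓛)
    (hne : ∀ S ∈ 𝓛, S.Nonempty) (K : ℕ) : ∀ S ∈ 𝓛, ∃ Y : Finset V, ↑Y ⊆ S ∧ Y.card = K := by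
  induction K with
  | zero => exact fun S _ => ⟨∅, by simp⟩
  | succ K ih =>
    intro S hS
    obtain ⟨Y, hY, hc⟩ := ih S hS
    obtain ⟨z, hz, hzY⟩ := hne _ (hL.sdiff_mem S hS Y)
    refine ⟨insert z Y, ?_, by rw [Finset.card_insert_of_notMem (by simpa using hzY), hc]⟩
    rw [Finset.coe_insert]
    exact Set.insert_subset hz hY

theorem LargeFamily.blowup_or_compl {m : ℕ} (hm : 3 ≤ m) {𝓛 : Set (Set V)} (hE : SymmRel E)
    (hne : ∀ S ∈ 𝓛, S.Nonempty) (h₁ : LargeFamily E 𝓛)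
    (h₂ : LargeFamily (fun x y z => ¬ E x y z) 𝓛) :
    (OrderedBlowup E m ∨ PairedBlowup E m) ∨
      OrderedBlowup (fun x y z => ¬ E x y z) m ∨ PairedBlowup (fun x y z => ¬ E x y z) m := by
  obtain ⟨K, hK⟩ := LargeFamily.blowup hm
  obtain ⟨K', hK'⟩ := exists_subparts_relation_constant 1 K
  have ramsey : ∀ S ∈ 𝓛, ∃ Y : Finset V, ↑Y ⊆ S ∧ Y.card = K ∧
      (TripleFree E Y ∨ TripleFree (fun x y z => ¬ E x y z) Y) := by
    intro S hS
    obtain ⟨Y, hY, hc⟩ := h₁.exists_subset_card_eq hne K' S hS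
    obtain ⟨Q, hQ, hQc, col, hcol⟩ := hK' E hE (fun _ => Y) (fun _ => hc.ge)
    refine ⟨Q 0, (Finset.coe_subset.2 (hQ 0)).trans hY, hQc 0, ?_⟩
    by_cases h : col 0 0 0
    · exact .inr fun x hx y hy z hz hxy hxz hyz =>
        not_not.2 ((hcol 0 0 0 x hx y hy z hz hxy hxz hyz).2 h)
    · exact .inl fun x hx y hy z hz hxy hxz hyz h' =>
        h ((hcol 0 0 0 x hx y hy z hz hxy hxz hyz).1 h')
  by_cases hall : ∀ S ∈ 𝓛, ∃ Y : Finset V, ↑Y ⊆ S ∧ TripleFree E Y ∧ Y.card = K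
  · exact .inl (hK hE h₁ hall)
  · push Not at hall
    obtain ⟨U, hU, hno⟩ := hall
    refine .inr (hK hE.not (h₂.restrict hU) fun S hS => ?_)
    obtain ⟨Y, hY, hc, hf | hf⟩ := ramsey S hS.1
    · exact absurd hc (hno Y (hY.trans hS.2) hf)
    · exact ⟨Y, hY, hf, hc⟩

end

theorem sum_card_filter_forall_eq {α β : Type*} (P : Finset α) (Q : Finset β) (r : α → β → Prop)
    (t : ℕ) :
    ∑ z ∈ Fintype.piFinset (fun _ : Fin t => Q), (P.filter fun a => ∀ i, r a (z i)).card =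
      ∑ a ∈ P, (Q.filter (r a)).card ^ t := by
  simp_rw [Finset.card_filter]
  rw [Finset.sum_comm]
  refine Finset.sum_congr rfl fun a _ => ?_
  rw [← Finset.card_filter, ← Finset.card_filter]
  have : (Fintype.piFinset fun _ : Fin t => Q).filter (fun z => ∀ i, r a (z i)) =
      Fintype.piFinset fun _ : Fin t => Q.filter (r a) := by
    ext z
    simp [Fintype.mem_piFinset, forall_and]
  rw [this, Fintype.card_piFinset]
  simp

/-- Dependent random choice: a dense bipartite graph contains a large set all of whose `s`-tuples
have many common neighbours. -/
theorem exists_subset_forall_tuple_common_neighbors {α β : Type*} (P : Finset α) (Q : Finset β)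
    (r : α → β → Prop) (N D s u : ℕ) (hP : P.Nonempty) (hQ : Q.Nonempty)
    (hD : P.card * Q.card ≤ D * ∑ a ∈ P, (Q.filter (r a)).card)
    (hs : 2 * D ^ (2 * u + 2) * P.card ^ s * N ^ (u + 1) ≤ Q.card ^ (2 * u + 2)) :
    ∃ W ⊆ P, P.card ≤ 2 * D ^ (2 * u + 2) * W.card ∧ ∀ a : Fin s → α, (∀ i, a i ∈ W) →
      N ≤ (Q.filter fun b => ∀ i, r (a i) b).card ^ 2 := by
  by_contra! hcon
  set t := 2 * u + 2 with ht
  let Z := Fintype.piFinset fun _ : Fin t => Q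
  let W : (Fin t → β) → Finset α := fun z => P.filter fun a => ∀ i, r a (z i)
  obtain ⟨q, hq'⟩ : ∃ q : (Fin s → α) → β → Prop, ∀ a b, q a b ↔ ∀ i, r (a i) b :=
    ⟨_, fun _ _ => Iff.rfl⟩
  let B := (Fintype.piFinset fun _ : Fin s => P).filter fun a => (Q.filter (q a)).card ^ 2 < N
  let bad : (Fin t → β) → Finset (Fin s → α) := fun z =>
    B.filter fun a => ∀ j, q a (z j)
  have hp := hP.card_pos
  have hq := hQ.card_pos
  have hsum : P.card * Q.card ^ t ≤ D ^ t * ∑ z ∈ Z, (W z).card := by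
    rw [sum_card_filter_forall_eq]
    refine Nat.le_of_mul_le_mul_left (c := P.card ^ (2 * u + 1)) ?_ (Nat.pow_pos hp)
    calc P.card ^ (2 * u + 1) * (P.card * Q.card ^ t) = (P.card * Q.card) ^ t := by
          rw [ht]; ring
      _ ≤ (D * ∑ a ∈ P, (Q.filter (r a)).card) ^ t := Nat.pow_le_pow_left hD t
      _ = D ^ t * (∑ a ∈ P, (Q.filter (r a)).card) ^ (2 * u + 1 + 1) := by rw [mul_pow]
      _ ≤ D ^ t * (P.card ^ (2 * u + 1) * ∑ a ∈ P, (Q.filter (r a)).card ^ (2 * u + 1 + 1)) := by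
          gcongr
          exact pow_sum_le_card_mul_sum_pow (fun _ _ => Nat.zero_le _) _
      _ = _ := by rw [ht]; ring
  have hbad : ∑ z ∈ Z, (bad z).card ≤ P.card ^ s * N ^ (u + 1) := by
    calc ∑ z ∈ Z, (bad z).card = ∑ a ∈ B, (Q.filter (q a)).card ^ t :=
          sum_card_filter_forall_eq B Q q t
      _ ≤ ∑ a ∈ B, N ^ (u + 1) := by
          refine Finset.sum_le_sum fun a ha => ?_
          rw [show t = 2 * (u + 1) by omega, pow_mul]
          exact Nat.pow_le_pow_left (Finset.mem_filter.1 ha).2.le _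
      _ = B.card * N ^ (u + 1) := by simp
      _ ≤ _ := by
          gcongr
          exact (Finset.card_filter_le _ _).trans (by simp)
  have hz : ∀ z ∈ Z, 2 * D ^ t * (W z).card < P.card + 2 * D ^ t * P.card * (bad z).card := by
    intro z _
    by_cases h : P.card ≤ 2 * D ^ t * (W z).card
    · obtain ⟨a, ha, hN⟩ := hcon (W z) (Finset.filter_subset _ _) h
      have hab : a ∈ bad z := by
        simp only [bad, B, Finset.mem_filter, Fintype.mem_piFinset, hq']
        exact ⟨⟨fun i => (Finset.mem_filter.1 (ha i)).1, hN⟩,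
          fun j i => (Finset.mem_filter.1 (ha i)).2 j⟩
      have h1 : 1 ≤ (bad z).card := Finset.card_pos.2 ⟨a, hab⟩
      have h2 : (W z).card ≤ P.card := Finset.card_filter_le _ _
      calc 2 * D ^ t * (W z).card ≤ 2 * D ^ t * (P.card * (bad z).card) := by
            gcongr; nlinarith
        _ = 2 * D ^ t * P.card * (bad z).card := by ring
        _ < P.card + 2 * D ^ t * P.card * (bad z).card := by omega
    · omega
  have hZ : Z.Nonempty := Fintype.piFinset_nonempty.2 fun _ => hQ
  have hlt := Finset.sum_lt_sum_of_nonempty hZ hz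
  rw [← Finset.mul_sum, Finset.sum_add_distrib, ← Finset.mul_sum, Finset.sum_const,
    smul_eq_mul, show Z.card = Q.card ^ t by simp [Z]] at hlt
  have h3 : 2 * D ^ t * P.card * ∑ z ∈ Z, (bad z).card ≤ P.card * Q.card ^ t := by
    calc 2 * D ^ t * P.card * ∑ z ∈ Z, (bad z).card
        ≤ 2 * D ^ t * P.card * (P.card ^ s * N ^ (u + 1)) := by gcongr
      _ = P.card * (2 * D ^ t * P.card ^ s * N ^ (u + 1)) := by ring
      _ ≤ _ := by gcongr
  nlinarith

theorem exists_rich_subsets (R : ℕ) :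
    ∃ C : ℕ, ∀ {α : Type} (S : Finset α) (r : α → α → α → Prop) (D : ℕ), 2 ≤ D →
      D ^ C ≤ S.card →
      S.card ^ 3 ≤ D * ∑ p ∈ S ×ˢ S, (S.filter (r p.1 p.2)).card →
      ∃ W ⊆ S, S.card ≤ W.card ^ 2 ∧ ∀ a : Fin R → α, (∀ i, a i ∈ W) →
        ∃ W' ⊆ S, S.card ≤ W'.card ^ 2 ∧ ∀ b : Fin R → α, (∀ i, b i ∈ W') →
          S.card ≤ (S.filter fun z => ∀ i j, r (a i) (b j) z).card ^ 2 := by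
  let v := 2 * (2 * (R * R)) + 2
  let v' := 2 * R + 2
  refine ⟨(v + 1) * (v' + 1) * 2, fun {α} S r D hD hC hdens => ?_⟩
  have hS : 0 < S.card := lt_of_lt_of_le (by positivity) hC
  have hSne := Finset.card_pos.1 hS
  have two : ∀ (D t : ℕ), 2 ≤ D → 2 * D ^ t ≤ D ^ (t + 1) := fun D t hD => by
    rw [pow_succ, mul_comm]; gcongr
  have h1 : 2 * D ^ v ≤ S.card := (two D v hD).trans (le_trans (by gcongr; omega; nlinarith) hC)
  obtain ⟨H, hHS, hH, hHr⟩ := exists_subset_forall_tuple_common_neighbors (S ×ˢ S) S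
    (fun p => r p.1 p.2) S.card D (R * R) (2 * (R * R)) (hSne.product hSne) hSne
    (by rw [Finset.card_product]; linarith [hdens]) (by
      rw [Finset.card_product]
      calc 2 * D ^ v * (S.card * S.card) ^ (R * R) * S.card ^ (2 * (R * R) + 1)
          ≤ S.card * (S.card * S.card) ^ (R * R) * S.card ^ (2 * (R * R) + 1) := by gcongr
        _ = S.card ^ (2 * (2 * (R * R)) + 2) := by ring)
  set D' := D ^ (v + 1) with hD'
  have hD'2 : 2 ≤ D' := hD.trans (Nat.le_self_pow (by omega) D)
  have h2 : D' ^ (v' + 1) * D' ^ (v' + 1) ≤ S.card := by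
    rw [← pow_add, ← two_mul, mul_comm 2, hD', ← pow_mul, ← mul_assoc]
    exact hC
  obtain ⟨q, hh⟩ : ∃ q : α → α → Prop, ∀ a b, q a b ↔ (a, b) ∈ H := ⟨_, fun _ _ => Iff.rfl⟩
  have hcount : H.card = ∑ a ∈ S, (S.filter (q a)).card := by
    conv_lhs => rw [← Finset.inter_eq_right.2 hHS, ← Finset.filter_mem_eq_inter,
      Finset.card_filter, Finset.sum_product]
    simp_rw [Finset.card_filter, hh]
  obtain ⟨W, hWS, hW, hWr⟩ := exists_subset_forall_tuple_common_neighbors S S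
    q S.card D' R R hSne hSne (by
      rw [← hcount, ← Finset.card_product]
      exact hH.trans (Nat.mul_le_mul_right _ (two D v hD))) (by
      calc 2 * D' ^ v' * S.card ^ R * S.card ^ (R + 1)
          ≤ S.card * S.card ^ R * S.card ^ (R + 1) := by
            gcongr
            exact (two D' v' hD'2).trans ((Nat.le_mul_of_pos_right _ (by positivity)).trans h2)
        _ = S.card ^ (2 * R + 2) := by ring)
  refine ⟨W, hWS, ?_, fun a ha => ⟨_, Finset.filter_subset _ _, hWr a ha, fun b hb => ?_⟩⟩
  · have h3 : S.card ≤ D' ^ (v' + 1) * W.card :=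
      hW.trans (Nat.mul_le_mul_right _ (two D' v' hD'2))
    refine Nat.le_of_mul_le_mul_left (c := S.card) ?_ hS
    calc S.card * S.card ≤ (D' ^ (v' + 1) * W.card) * (D' ^ (v' + 1) * W.card) := by gcongr
      _ = (D' ^ (v' + 1) * D' ^ (v' + 1)) * W.card ^ 2 := by ring
      _ ≤ S.card * W.card ^ 2 := by gcongr
  · have h4 := hHr (fun k => (a (finProdFinEquiv.symm k).1, b (finProdFinEquiv.symm k).2))
      fun k => (hh _ _).1 ((Finset.mem_filter.1 (hb _)).2 _)
    refine h4.trans ?_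
    gcongr with z
    intro h i j
    simpa using h (finProdFinEquiv (i, j))

/-- The number of ordered triples of distinct elements of `T` in the relation `r`. -/
noncomputable def tripleCount {α : Type} (r : α → α → α → Prop) (T : Finset α) : ℕ :=
  ((T ×ˢ T ×ˢ T).filter fun p =>
    p.1 ≠ p.2.1 ∧ p.1 ≠ p.2.2 ∧ p.2.1 ≠ p.2.2 ∧ r p.1 p.2.1 p.2.2).card

theorem sum_tripleCount_erase {α : Type} (r : α → α → α → Prop) (T : Finset α) :
    ∑ x ∈ T, tripleCount r (T.erase x) = (T.card - 3) * tripleCount r T := by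
  have h : ∀ x ∈ T, tripleCount r (T.erase x) =
      (((T ×ˢ T ×ˢ T).filter fun p =>
        p.1 ≠ p.2.1 ∧ p.1 ≠ p.2.2 ∧ p.2.1 ≠ p.2.2 ∧ r p.1 p.2.1 p.2.2).filter fun p =>
          x ∉ ({p.1, p.2.1, p.2.2} : Finset α)).card := by
    intro x hx
    unfold tripleCount
    congr 1
    ext p
    simp only [Finset.mem_filter, Finset.mem_product, Finset.mem_erase, Finset.mem_insert,
      Finset.mem_singleton]
    tauto
  rw [Finset.sum_congr rfl h]
  simp_rw [Finset.card_filter]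
  rw [Finset.sum_comm]
  simp_rw [← Finset.card_filter]
  rw [Finset.sum_const_nat (m := T.card - 3), mul_comm]
  · rfl
  · intro p hp
    simp only [Finset.mem_filter, Finset.mem_product] at hp
    obtain ⟨⟨h1, h2, h3⟩, h4, h5, h6, -⟩ := hp
    rw [Finset.filter_not, Finset.filter_mem_eq_inter, Finset.inter_eq_right.2,
      Finset.card_sdiff_of_subset, Finset.card_eq_three.2 ⟨_, _, _, h4, h5, h6, rfl⟩]
    all_goals
      intro y hy
      simp only [Finset.mem_insert, Finset.mem_singleton] at hy
      rcases hy with rfl | rfl | rfl <;> assumption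

theorem le_mul_tripleCount {α : Type} (r : α → α → α → Prop) {h : ℕ} (h3 : 3 ≤ h) (n : ℕ)
    (hn : h ≤ n) (S : Finset α) (hS : S.card = n)
    (hr : ∀ T ⊆ S, T.card = h → 0 < tripleCount r T) :
    n * (n - 1) * (n - 2) ≤ h * (h - 1) * (h - 2) * tripleCount r S := by
  induction n, hn using Nat.le_induction generalizing S with
  | base => exact Nat.le_mul_of_pos_right _ (hr S le_rfl hS)
  | succ n hn ih =>
    obtain ⟨k, rfl⟩ : ∃ k, n = k + 3 := ⟨n - 3, by omega⟩
    have hsum : ∑ x ∈ S, (k + 3) * (k + 3 - 1) * (k + 3 - 2) ≤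
        ∑ x ∈ S, h * (h - 1) * (h - 2) * tripleCount r (S.erase x) :=
      Finset.sum_le_sum fun x hx => ih (S.erase x) (by rw [Finset.card_erase_of_mem hx, hS]; rfl)
        fun T hT => hr T (hT.trans (Finset.erase_subset _ _))
    rw [Finset.sum_const, ← Finset.mul_sum, sum_tripleCount_erase, hS, smul_eq_mul] at hsum
    refine Nat.le_of_mul_le_mul_left (c := k + 1) ?_ (by omega)
    have e1 : k + 3 - 1 = k + 2 := rfl
    have e2 : k + 3 - 2 = k + 1 := rfl
    have e3 : k + 3 + 1 - 3 = k + 1 := rfl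
    have e4 : k + 3 + 1 - 1 = k + 3 := rfl
    have e5 : k + 3 + 1 - 2 = k + 2 := rfl
    rw [e1, e2, e3] at hsum
    rw [e4, e5]
    linarith

theorem card_pow_three_le {α : Type} (r : α → α → α → Prop) {h : ℕ} (h3 : 3 ≤ h)
    (S : Finset α) (hS : h ≤ S.card) (hr : ∀ T ⊆ S, T.card = h → 0 < tripleCount r T) :
    S.card ^ 3 ≤ h ^ 6 * ∑ p ∈ S ×ˢ S, (S.filter (r p.1 p.2)).card := by
  have key := le_mul_tripleCount r h3 _ hS S rfl hr
  have hle : tripleCount r S ≤ ∑ p ∈ S ×ˢ S, (S.filter (r p.1 p.2)).card := by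
    have : ∑ p ∈ S ×ˢ S, (S.filter (r p.1 p.2)).card =
        ((S ×ˢ S ×ˢ S).filter fun p => r p.1 p.2.1 p.2.2).card := by
      simp_rw [Finset.card_filter]
      simp_rw [Finset.sum_product]
    rw [this]
    unfold tripleCount
    gcongr with p
    exact fun h => h.2.2.2
  obtain ⟨k, hk⟩ : ∃ k, S.card = k + 3 := ⟨S.card - 3, by omega⟩
  calc S.card ^ 3 ≤ 27 * (S.card * (S.card - 1) * (S.card - 2)) := by
        rw [hk, show k + 3 - 1 = k + 2 from rfl, show k + 3 - 2 = k + 1 from rfl]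
        nlinarith [sq_nonneg k, Nat.zero_le (k ^ 3)]
    _ ≤ 27 * (h * (h - 1) * (h - 2) * tripleCount r S) := by gcongr
    _ ≤ h ^ 3 * (h * h * h * ∑ p ∈ S ×ˢ S, (S.filter (r p.1 p.2)).card) := by
        gcongr
        · calc 27 = 3 ^ 3 := by norm_num
            _ ≤ h ^ 3 := by gcongr
        · omega
        · omega
    _ = _ := by ring

open Filter

section
variable (𝒰 : Ultrafilter ℕ) {α : ℕ → Type}

/-- A representative of an element of an ultraproduct. -/
noncomputable def ultraRep (x : Filter.Product (𝒰 : Filter ℕ) α) (k : ℕ) : α k :=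
  Quotient.out x k

/-- The internal subset of an ultraproduct defined by a sequence of sets. -/
def internalSet (S : ∀ k, Finset (α k)) : Set (Filter.Product (𝒰 : Filter ℕ) α) :=
  {x | ∀ᶠ k in 𝒰, ultraRep 𝒰 x k ∈ S k}

/-- The ultraproduct of a sequence of ternary relations. -/
def ultraRel (r : ∀ k, α k → α k → α k → Prop) (x y z : Filter.Product (𝒰 : Filter ℕ) α) : Prop :=
  ∀ᶠ k in 𝒰, r k (ultraRep 𝒰 x k) (ultraRep 𝒰 y k) (ultraRep 𝒰 z k)

/-- The sets `S k` have size at least polynomial in the size of `α k`. -/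
def PolyLarge [∀ k, Fintype (α k)] (S : ∀ k, Finset (α k)) : Prop :=
  ∃ j : ℕ, ∀ᶠ k in 𝒰, Fintype.card (α k) ≤ (S k).card ^ j

/-- The internal sets of polynomial size. -/
def polyLargeSets [∀ k, Fintype (α k)] : Set (Set (Filter.Product (𝒰 : Filter ℕ) α)) :=
  {U | ∃ S, PolyLarge 𝒰 S ∧ internalSet 𝒰 S = U}

variable {𝒰}

theorem exists_ultraRep_eq (f : ∀ k, α k) :
    ∃ x : Filter.Product (𝒰 : Filter ℕ) α, ∀ᶠ k in 𝒰, ultraRep 𝒰 x k = f k :=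
  ⟨Quotient.mk _ f, Quotient.mk_out (s := Filter.productSetoid (𝒰 : Filter ℕ) α) f⟩

theorem eventually_ultraRep_ne {x y : Filter.Product (𝒰 : Filter ℕ) α} (h : x ≠ y) :
    ∀ᶠ k in 𝒰, ultraRep 𝒰 x k ≠ ultraRep 𝒰 y k := by
  rw [Ultrafilter.eventually_not]
  intro h'
  refine h ?_
  rw [← Quotient.out_eq x, ← Quotient.out_eq y]
  exact Quotient.sound h'

theorem ultraRel_not (r : ∀ k, α k → α k → α k → Prop) :
    (ultraRel 𝒰 fun k x y z => ¬ r k x y z) = fun x y z => ¬ ultraRel 𝒰 r x y z := by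
  funext x y z
  exact propext Ultrafilter.eventually_not

theorem symmRel_ultraRel {r : ∀ k, α k → α k → α k → Prop} (h : ∀ k, SymmRel (r k)) :
    SymmRel (ultraRel 𝒰 r) :=
  ⟨fun h' => h'.mono fun k => (h k).swap₁₂, fun h' => h'.mono fun k => (h k).swap₂₃⟩

theorem eventually_transfer (r : ∀ k, α k → α k → α k → Prop)
    (F : Finset (Filter.Product (𝒰 : Filter ℕ) α)) :
    ∀ᶠ k in 𝒰, Set.InjOn (fun x => ultraRep 𝒰 x k) (F : Set (Filter.Product (𝒰 : Filter ℕ) α)) ∧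
      ∀ x ∈ F, ∀ y ∈ F, ∀ z ∈ F,
        (ultraRel 𝒰 r x y z ↔ r k (ultraRep 𝒰 x k) (ultraRep 𝒰 y k) (ultraRep 𝒰 z k)) := by
  refine Eventually.and ?_ ?_
  · have : ∀ᶠ k in 𝒰, ∀ x ∈ F, ∀ y ∈ F, x ≠ y → ultraRep 𝒰 x k ≠ ultraRep 𝒰 y k := by
      simp only [eventually_all_finset]
      intro x _ y _
      by_cases h : x = y
      · simp [h]
      · exact (eventually_ultraRep_ne h).mono fun k hk _ => hk
    refine this.mono fun k hk x hx y hy hxy => ?_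
    by_contra hne
    exact hk x hx y hy hne hxy
  · simp only [eventually_all_finset]
    intro x _ y _ z _
    by_cases h : ultraRel 𝒰 r x y z
    · exact h.mono fun k hk => iff_of_true h hk
    · exact (Ultrafilter.eventually_not.2 h).mono fun k hk => iff_of_false h hk

theorem exists_eventually_of_eventually_exists {p : ∀ k, Finset (α k) → Prop}
    (h : ∀ᶠ k in 𝒰, ∃ W, p k W) : ∃ W : ∀ k, Finset (α k), ∀ᶠ k in 𝒰, p k (W k) := by
  have : ∀ k, ∃ W, (∃ W', p k W') → p k W := fun k => by
    by_cases h' : ∃ W', p k W'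
    · exact ⟨h'.choose, fun _ => h'.choose_spec⟩
    · exact ⟨∅, fun h => absurd h h'⟩
  choose W hW using this
  exact ⟨W, h.mono fun k => hW k⟩

theorem internalSet_mono {S S' : ∀ k, Finset (α k)} (h : ∀ᶠ k in 𝒰, S k ⊆ S' k) :
    internalSet 𝒰 S ⊆ internalSet 𝒰 S' := fun _ hx =>
  (h.and hx).mono fun _ hk => hk.1 hk.2

theorem internalSet_nonempty [∀ k, Nonempty (α k)] {S : ∀ k, Finset (α k)}
    (h : ∀ᶠ k in 𝒰, (S k).Nonempty) : (internalSet 𝒰 S).Nonempty := by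
  obtain ⟨x, hx⟩ := exists_ultraRep_eq (𝒰 := 𝒰)
    fun k => if h : (S k).Nonempty then h.choose else Classical.arbitrary (α k)
  refine ⟨x, (hx.and h).mono fun k hk => ?_⟩
  rw [hk.1, dif_pos hk.2]
  exact hk.2.choose_spec

theorem internalSet_sdiff (S : ∀ k, Finset (α k))
    (F : Finset (Filter.Product (𝒰 : Filter ℕ) α)) :
    internalSet 𝒰 (fun k => S k \ F.image fun x => ultraRep 𝒰 x k) = internalSet 𝒰 S \ F := by
  ext x
  simp only [internalSet, Finset.mem_sdiff, Set.mem_sdiff, Set.mem_ofPred_eq, eventually_and]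
  refine and_congr_right fun _ => ⟨fun h hx => ?_, fun h => ?_⟩
  · obtain ⟨k, hk⟩ := h.exists
    exact hk (Finset.mem_image_of_mem _ hx)
  · have : ∀ᶠ k in 𝒰, ∀ y ∈ F, ultraRep 𝒰 x k ≠ ultraRep 𝒰 y k :=
      (eventually_all_finset F).2 fun y hy => eventually_ultraRep_ne fun h' => h (h' ▸ hy)
    refine this.mono fun k hk hmem => ?_
    obtain ⟨y, hy, hyx⟩ := Finset.mem_image.1 hmem
    exact hk y hy hyx.symm

theorem internalSet_filter (S : ∀ k, Finset (α k)) (p : ∀ k, α k → Prop)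
    [∀ k, DecidablePred (p k)] {q : Filter.Product (𝒰 : Filter ℕ) α → Prop}
    (h : ∀ x, (∀ᶠ k in 𝒰, p k (ultraRep 𝒰 x k)) ↔ q x) :
    internalSet 𝒰 (fun k => (S k).filter (p k)) = {x ∈ internalSet 𝒰 S | q x} := by
  ext x
  simp [internalSet, eventually_and, h]

theorem exists_fin_enum {β : Type*} {A : Finset β} (hA : A.Nonempty) {R : ℕ} (hR : A.card ≤ R) :
    ∃ a : Fin R → β, (∀ i, a i ∈ A) ∧ ∀ x ∈ A, ∃ i, a i = x := by
  obtain ⟨x₀, hx₀⟩ := hA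
  refine ⟨fun i => if h : (i : ℕ) < A.card then A.equivFin.symm ⟨i, h⟩ else x₀, fun i => ?_,
    fun x hx => ⟨Fin.castLE hR (A.equivFin ⟨x, hx⟩), by simp⟩⟩
  dsimp only
  split_ifs with h
  · exact (A.equivFin.symm ⟨i, h⟩).2
  · exact hx₀

variable [∀ k, Fintype (α k)]

theorem PolyLarge.of_le_sq {S S' : ∀ k, Finset (α k)} (hS : PolyLarge 𝒰 S)
    (h : ∀ᶠ k in 𝒰, (S k).card ≤ (S' k).card ^ 2) : PolyLarge 𝒰 S' := by
  obtain ⟨j, hj⟩ := hS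
  refine ⟨2 * j, (h.and hj).mono fun k hk => hk.2.trans ?_⟩
  rw [pow_mul]
  exact Nat.pow_le_pow_left hk.1 j

theorem PolyLarge.eventually_pow_le {S : ∀ k, Finset (α k)} (hS : PolyLarge 𝒰 S) {h : ℕ → ℕ}
    (h2 : ∀ᶠ k in 𝒰, 2 ≤ h k) (hh : ∀ s, ∀ᶠ k in 𝒰, h k ^ s ≤ Fintype.card (α k)) (s : ℕ) :
    ∀ᶠ k in 𝒰, h k ^ s ≤ (S k).card := by
  obtain ⟨j, hj⟩ := hS
  filter_upwards [h2, hj, hh (s * j + 1)] with k h2 hj hs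
  have hle := hs.trans hj
  rcases Nat.eq_zero_or_pos j with rfl | hj0
  · have : h k ^ (s * 0 + 1) ≤ 1 := hle
    simp at this
    omega
  · refine le_of_pow_le_pow_left₀ hj0.ne' (Nat.zero_le _) (le_trans ?_ hle)
    rw [← pow_mul]
    exact Nat.pow_le_pow_right (by omega) (by omega)

theorem PolyLarge.eventually_le {S : ∀ k, Finset (α k)} (hS : PolyLarge 𝒰 S)
    (hα : ∀ N, ∀ᶠ k in 𝒰, N ≤ Fintype.card (α k)) (N : ℕ) : ∀ᶠ k in 𝒰, N ≤ (S k).card := by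
  refine (hS.eventually_pow_le (h := fun _ => max N 2) (by simp) (fun s => hα _) 1).mono
    fun k hk => ?_
  rw [pow_one] at hk
  exact (le_max_left _ _).trans hk

theorem largeFamily_polyLargeSets {r : ∀ k, α k → α k → α k → Prop} {h : ℕ → ℕ}
    (h3 : ∀ᶠ k in 𝒰, 3 ≤ h k) (hh : ∀ s, ∀ᶠ k in 𝒰, h k ^ s ≤ Fintype.card (α k))
    (hr : ∀ᶠ k in 𝒰, ∀ T : Finset (α k), h k ≤ T.card → 0 < tripleCount (r k) T) :
    LargeFamily (ultraRel 𝒰 r) (polyLargeSets 𝒰) := by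
  have h2 : ∀ᶠ k in 𝒰, 2 ≤ h k := h3.mono fun k hk => by omega
  have hα : ∀ N, ∀ᶠ k in 𝒰, N ≤ Fintype.card (α k) := fun N =>
    (h2.and (hh N)).mono fun k hk =>
      (Nat.lt_pow_self (by omega : 1 < h k)).le.trans hk.2
  refine ⟨⟨_, fun k => Finset.univ, ⟨1, by simp [Finset.card_univ]⟩, rfl⟩, ?_, ?_, ?_⟩
  · rintro _ ⟨S, hS, rfl⟩ F
    refine ⟨_, hS.of_le_sq ?_, internalSet_sdiff S F⟩
    refine (hS.eventually_le hα (2 * F.card + 4)).mono fun k hk => ?_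
    have h1 : (S k).card - F.card ≤ (S k \ F.image fun x => ultraRep 𝒰 x k).card :=
      (Nat.sub_le_sub_left Finset.card_image_le _).trans (Finset.le_card_sdiff _ _)
    refine le_trans ?_ (Nat.pow_le_pow_left h1 2)
    obtain ⟨d, hd⟩ := Nat.exists_eq_add_of_le hk
    rw [hd, show 2 * F.card + 4 + d - F.card = F.card + 4 + d by omega]
    nlinarith
  · rintro _ ⟨S, hS, rfl⟩ X
    obtain ⟨p, hp'⟩ : ∃ p : ∀ k, α k → Prop, ∀ k z, p k z ↔ ∀ x ∈ X, ∀ y ∈ X, x ≠ y →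
      r k (ultraRep 𝒰 x k) (ultraRep 𝒰 y k) z := ⟨_, fun _ _ => Iff.rfl⟩
    have hp : ∀ z, (∀ᶠ k in 𝒰, p k (ultraRep 𝒰 z k)) ↔ LinkComplete (ultraRel 𝒰 r) X z := by
      intro z
      simp only [hp', eventually_all_finset, LinkComplete]
      refine forall₄_congr fun x _ y _ => ?_
      by_cases hxy : x = y
      · simp [hxy]
      · simp [hxy, ultraRel]
    have key : ∀ᶠ k in 𝒰, (S k).card ≤ ((S k).filter (p k)).card ^ 2 ∨
        (S k).card ≤ ((S k).filter fun z => ¬ p k z).card ^ 2 := by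
      refine (hS.eventually_le hα 4).mono fun k hk => ?_
      have := Finset.card_filter_add_card_filter_not (s := S k) (p k)
      by_contra! hcon
      nlinarith [sq_nonneg ((((S k).filter (p k)).card : ℤ) -
        ((S k).filter fun z => ¬ p k z).card)]
    refine (Ultrafilter.eventually_or.1 key).imp (fun h => ?_) (fun h => ?_)
    · exact ⟨_, hS.of_le_sq h, internalSet_filter S p hp⟩
    · exact ⟨_, hS.of_le_sq h, internalSet_filter S (fun k z => ¬ p k z)
        (q := fun z => ¬ LinkComplete (ultraRel 𝒰 r) X z)
        fun z => Ultrafilter.eventually_not.trans (not_congr (hp z))⟩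
  · rintro _ ⟨S, hS, rfl⟩ R
    obtain ⟨C, hC⟩ := exists_rich_subsets R
    obtain ⟨W, hW⟩ := exists_eventually_of_eventually_exists <|
      (h3.and (hr.and ((hS.eventually_pow_le h2 hh (6 * C)).and
        (hS.eventually_pow_le h2 hh 1)))).mono fun k hk =>
        hC (S k) (r k) (h k ^ 6) (le_trans (by omega) (Nat.le_self_pow (by omega : 6 ≠ 0) (h k)))
          (by rw [← pow_mul]; exact hk.2.2.1) (card_pow_three_le (r k) hk.1 (S k)
            (by simpa using hk.2.2.2) fun T _ hT => hk.2.1 T hT.ge)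
    refine ⟨_, ⟨W, hS.of_le_sq (hW.mono fun k hk => hk.2.1), rfl⟩,
      internalSet_mono (hW.mono fun k hk => hk.1), fun A hA hAR => ?_⟩
    rcases A.eq_empty_or_nonempty with rfl | hAne
    · exact ⟨_, ⟨S, hS, rfl⟩, le_rfl, fun B _ _ => ⟨S, hS, by simp⟩⟩
    obtain ⟨a, haA, hAa⟩ := exists_fin_enum hAne hAR
    have haW : ∀ᶠ k in 𝒰, ∀ i, ultraRep 𝒰 (a i) k ∈ W k :=
      eventually_all.2 fun i => hA (haA i)
    obtain ⟨W', hW'⟩ := exists_eventually_of_eventually_exists <|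
      (hW.and haW).mono fun k hk => hk.1.2.2 (fun i => ultraRep 𝒰 (a i) k) hk.2
    refine ⟨_, ⟨W', hS.of_le_sq (hW'.mono fun k hk => hk.2.1), rfl⟩,
      internalSet_mono (hW'.mono fun k hk => hk.1), fun B hB hBR => ?_⟩
    rcases B.eq_empty_or_nonempty with rfl | hBne
    · exact ⟨S, hS, by simp⟩
    obtain ⟨b, hbB, hBb⟩ := exists_fin_enum hBne hBR
    have hbW : ∀ᶠ k in 𝒰, ∀ i, ultraRep 𝒰 (b i) k ∈ W' k :=
      eventually_all.2 fun i => hB (hbB i)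
    obtain ⟨q, hq⟩ : ∃ q : ∀ k, α k → Prop, ∀ k z, q k z ↔
      ∀ i j, r k (ultraRep 𝒰 (a i) k) (ultraRep 𝒰 (b j) k) z := ⟨_, fun _ _ => Iff.rfl⟩
    refine ⟨_, hS.of_le_sq (S' := fun k => (S k).filter (q k)) ((hW'.and hbW).mono fun k hk => ?_),
      internalSet_filter S q fun z => ?_⟩
    · rw [Finset.filter_congr fun z _ => hq k z]
      convert hk.1.2.2 (fun i => ultraRep 𝒰 (b i) k) hk.2
    simp only [hq, eventually_all]
    refine ⟨fun H x hx y hy => ?_, fun H i j => H _ (haA i) _ (hbB j)⟩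
    obtain ⟨i, rfl⟩ := hAa x hx
    obtain ⟨j, rfl⟩ := hBb y hy
    exact H i j

end

section
variable {V V' : Type} {E' : V' → V' → V' → Prop} {E : V → V → V → Prop}

/-- `φ` is injective on `F` and preserves the relation on triples of distinct elements of `F`. -/
structure EmbedsOn (E : V → V → V → Prop) (E' : V' → V' → V' → Prop) (F : Finset V)
    (φ : V → V') : Prop where
  injOn : Set.InjOn φ F
  iff : ∀ x ∈ F, ∀ y ∈ F, ∀ z ∈ F, x ≠ y → x ≠ z → y ≠ z → (E x y z ↔ E' (φ x) (φ y) (φ z))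

theorem EmbedsOn.constOn {F X Y Z : Finset V} {φ : V → V'} (h : EmbedsOn E E' F φ) (hX : X ⊆ F)
    (hY : Y ⊆ F) (hZ : Z ⊆ F) {p : Prop} (hp : ConstOn E X Y Z p) :
    ConstOn E' (X.image φ) (Y.image φ) (Z.image φ) p := by
  intro x' hx' y' hy' z' hz' hxy hxz hyz
  obtain ⟨x, hx, rfl⟩ := Finset.mem_image.1 hx'
  obtain ⟨y, hy, rfl⟩ := Finset.mem_image.1 hy'
  obtain ⟨z, hz, rfl⟩ := Finset.mem_image.1 hz'
  have hxy' := ne_of_apply_ne φ hxy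
  have hxz' := ne_of_apply_ne φ hxz
  have hyz' := ne_of_apply_ne φ hyz
  rw [← h.iff x (hX hx) y (hY hy) z (hZ hz) hxy' hxz' hyz']
  exact hp x hx y hy z hz hxy' hxz' hyz'

theorem EmbedsOn.disjoint {F X Y : Finset V} {φ : V → V'} (h : EmbedsOn E E' F φ) (hX : X ⊆ F)
    (hY : Y ⊆ F) (hd : Disjoint X Y) : Disjoint (X.image φ) (Y.image φ) := by
  rw [Finset.disjoint_left] at hd ⊢
  intro a ha hb
  obtain ⟨x, hx, rfl⟩ := Finset.mem_image.1 ha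
  obtain ⟨y, hy, hyx⟩ := Finset.mem_image.1 hb
  exact hd hx (h.injOn (hY hy) (hX hx) hyx ▸ hy)

theorem EmbedsOn.card {F X : Finset V} {φ : V → V'} (h : EmbedsOn E E' F φ) (hX : X ⊆ F) :
    (X.image φ).card = X.card :=
  Finset.card_image_of_injOn (h.injOn.mono (Finset.coe_subset.2 hX))

theorem OrderedBlowup.transfer {m : ℕ} (h : OrderedBlowup E m) :
    ∃ F : Finset V, ∀ {V' : Type} {E' : V' → V' → V' → Prop} {φ : V → V'},
      EmbedsOn E E' F φ → OrderedBlowup E' m := by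
  obtain ⟨A, hd, hc, a, b, c, d, hne, h1, h2, h3, h4⟩ := h
  have hF : ∀ i, A i ⊆ Finset.univ.biUnion A := fun i =>
    Finset.subset_biUnion_of_mem A (Finset.mem_univ i)
  exact ⟨Finset.univ.biUnion A, fun {V' E' φ} h => ⟨fun i => (A i).image φ,
    fun i j hij => h.disjoint (hF i) (hF j) (hd i j hij), fun i => (hc i).trans (h.card (hF i)).ge,
    a, b, c, d, hne, fun i j hij => h.constOn (hF _) (hF _) (hF _) (h1 i j hij),
    fun i j hij => h.constOn (hF _) (hF _) (hF _) (h2 i j hij),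
    fun i j k hij hjk => h.constOn (hF _) (hF _) (hF _) (h3 i j k hij hjk),
    fun i => h.constOn (hF _) (hF _) (hF _) (h4 i)⟩⟩

theorem PairedBlowup.transfer {m : ℕ} (h : PairedBlowup E m) :
    ∃ F : Finset V, ∀ {V' : Type} {E' : V' → V' → V' → Prop} {φ : V → V'},
      EmbedsOn E E' F φ → PairedBlowup E' m := by
  obtain ⟨A, B, hA, hB, hAB, hcA, hcB, b₁, b₂, c₁, c₂, c₃, c₄, c₅, c₆, h1, h2, h3, h4⟩ := h
  have hF : ∀ i, A i ⊆ Finset.univ.biUnion A ∪ Finset.univ.biUnion B := fun i =>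
    (Finset.subset_biUnion_of_mem A (Finset.mem_univ i)).trans Finset.subset_union_left
  have hF' : ∀ i, B i ⊆ Finset.univ.biUnion A ∪ Finset.univ.biUnion B := fun i =>
    (Finset.subset_biUnion_of_mem B (Finset.mem_univ i)).trans Finset.subset_union_right
  refine ⟨Finset.univ.biUnion A ∪ Finset.univ.biUnion B, fun {V' E' φ} h =>
    ⟨fun i => (A i).image φ, fun i => (B i).image φ,
    fun i j hij => h.disjoint (hF i) (hF j) (hA i j hij),
    fun i j hij => h.disjoint (hF' i) (hF' j) (hB i j hij),
    fun i j => h.disjoint (hF i) (hF' j) (hAB i j),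
    fun i => (hcA i).trans (h.card (hF i)).ge, fun i => (hcB i).trans (h.card (hF' i)).ge,
    b₁, b₂, c₁, c₂, c₃, c₄, c₅, c₆, fun i j hij => ?_, fun i j k hij hjk => ?_, ?_,
    fun i j k => ⟨h.constOn (hF _) (hF _) (hF _) (h4 i j k).1,
      h.constOn (hF' _) (hF' _) (hF' _) (h4 i j k).2⟩⟩⟩
  · obtain ⟨g1, g2, g3, g4⟩ := h1 i j hij
    exact ⟨h.constOn (hF _) (hF _) (hF' _) g1, h.constOn (hF' _) (hF _) (hF' _) g2,
      h.constOn (hF _) (hF' _) (hF _) g3, h.constOn (hF _) (hF' _) (hF' _) g4⟩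
  · obtain ⟨g1, g2, g3, g4, g5, g6⟩ := h2 i j k hij hjk
    exact ⟨h.constOn (hF _) (hF _) (hF' _) g1, h.constOn (hF _) (hF' _) (hF _) g2,
      h.constOn (hF _) (hF' _) (hF' _) g3, h.constOn (hF' _) (hF _) (hF _) g4,
      h.constOn (hF' _) (hF _) (hF' _) g5, h.constOn (hF' _) (hF' _) (hF _) g6⟩
  · rintro X (⟨i, rfl⟩ | ⟨i, rfl⟩) Y (⟨j, rfl⟩ | ⟨j, rfl⟩)
    · exact h.constOn (hF _) (hF _) (hF _) (h3 _ (.inl ⟨i, rfl⟩) _ (.inl ⟨j, rfl⟩))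
    · exact h.constOn (hF _) (hF _) (hF' _) (h3 _ (.inl ⟨i, rfl⟩) _ (.inr ⟨j, rfl⟩))
    · exact h.constOn (hF' _) (hF' _) (hF _) (h3 _ (.inr ⟨i, rfl⟩) _ (.inl ⟨j, rfl⟩))
    · exact h.constOn (hF' _) (hF' _) (hF' _) (h3 _ (.inr ⟨i, rfl⟩) _ (.inr ⟨j, rfl⟩))

end

/-- The ternary relation of forming an edge. -/
def edgeRel {n : ℕ} (E : Finset (Finset (Fin n))) (x y z : Fin n) : Prop :=
  {x, y, z} ∈ E

theorem symmRel_edgeRel {n : ℕ} (E : Finset (Finset (Fin n))) : SymmRel (edgeRel E) where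
  swap₁₂ {x y z} h := by rwa [edgeRel, Finset.insert_comm]
  swap₂₃ {x y z} h := by rwa [edgeRel, Finset.pair_comm z y]

theorem edgeRel_compl {n : ℕ} (E : Finset (Finset (Fin n))) {x y z : Fin n} (hxy : x ≠ y)
    (hxz : x ≠ z) (hyz : y ≠ z) :
    edgeRel (Finset.powersetCard 3 Finset.univ \ E) x y z ↔ ¬ edgeRel E x y z := by
  simp [edgeRel, Finset.card_eq_three.2 ⟨x, y, z, hxy, hxz, hyz, rfl⟩]

theorem mem_iff_of_mem_triples3 {n : ℕ} {E : Finset (Finset (Fin n))} {X Y Z : Finset (Fin n)}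
    {p : Prop} (h : ConstOn (edgeRel E) X Y Z p) {e : Finset (Fin n)}
    (he : e ∈ triples3 n X Y Z) : e ∈ E ↔ p := by
  obtain ⟨hc, x, hx, y, hy, z, hz, rfl⟩ := Finset.mem_filter.1 he
  have hc := (Finset.mem_powersetCard.1 hc).2
  refine h x hx y hy z hz ?_ ?_ ?_ <;> rintro rfl
  · rw [Finset.insert_idem] at hc
    exact absurd (Finset.card_le_two (a := x) (b := z)) (by omega)
  · rw [Finset.pair_comm, Finset.insert_idem] at hc
    exact absurd (Finset.card_le_two (a := x) (b := y)) (by omega)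
  · rw [Finset.pair_eq_singleton] at hc
    exact absurd (Finset.card_le_two (a := x) (b := y)) (by omega)

theorem dens3_eq_zero {n : ℕ} {E : Finset (Finset (Fin n))} {X Y Z : Finset (Fin n)}
    (h : ConstOn (edgeRel E) X Y Z False) : dens3 n E X Y Z = 0 := by
  have : (triples3 n X Y Z).filter (fun e => e ∈ E) = ∅ :=
    Finset.filter_eq_empty_iff.2 fun e he => (mem_iff_of_mem_triples3 h he).1
  simp [dens3, this]

theorem dens3_eq_ite {n : ℕ} {E : Finset (Finset (Fin n))} {X Y Z : Finset (Fin n)} {p : Prop}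
    (hX : 3 ≤ X.card) (hY : 3 ≤ Y.card) (hZ : 3 ≤ Z.card) (h : ConstOn (edgeRel E) X Y Z p) :
    dens3 n E X Y Z = if p then 1 else 0 := by
  split_ifs with hp
  · have hall : (triples3 n X Y Z).filter (fun e => e ∈ E) = triples3 n X Y Z :=
      Finset.filter_true_of_mem fun e he => (mem_iff_of_mem_triples3 h he).2 hp
    obtain ⟨x, hx⟩ := Finset.card_pos.1 (show 0 < X.card by omega)
    obtain ⟨y, hy, hyx⟩ := Finset.exists_mem_notMem_of_card_lt_card
      (show ({x} : Finset (Fin n)).card < Y.card by rw [Finset.card_singleton]; omega)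
    obtain ⟨z, hz, hzxy⟩ := Finset.exists_mem_notMem_of_card_lt_card
      (show ({x, y} : Finset (Fin n)).card < Z.card from
        (Finset.card_le_two).trans_lt (by omega))
    simp only [Finset.mem_insert, Finset.mem_singleton, not_or] at hyx hzxy
    have hne : (triples3 n X Y Z).Nonempty := ⟨{x, y, z}, Finset.mem_filter.2
      ⟨Finset.mem_powersetCard.2 ⟨Finset.subset_univ _, Finset.card_eq_three.2
        ⟨x, y, z, Ne.symm hyx, Ne.symm hzxy.1, Ne.symm hzxy.2, rfl⟩⟩,
        x, hx, y, hy, z, hz, rfl⟩⟩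
    rw [dens3, hall, div_self (Nat.cast_ne_zero.2 hne.card_ne_zero)]
  · rw [eq_false hp] at h
    exact dens3_eq_zero h

theorem ite_mem_zero_one (p : Prop) : (if p then 1 else 0 : ℝ) ∈ ({0, 1} : Set ℝ) := by
  split_ifs <;> simp

theorem ite_one_zero_inj {p q : Prop} :
    (if p then 1 else 0 : ℝ) = (if q then 1 else 0) ↔ (p ↔ q) := by
  by_cases p <;> by_cases q <;> simp [*]

theorem OrderedBlowup.structA {n m : ℕ} {E : Finset (Finset (Fin n))} (hm : 3 ≤ m)
    (h : OrderedBlowup (edgeRel E) m) : StructA n m E := by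
  obtain ⟨A, hd, hc, a, b, c, d, hne, h1, h2, h3, h4⟩ := h
  have hA : ∀ i, 3 ≤ (A i).card := fun i => hm.trans (hc i)
  refine ⟨A, hd, hc, _, _, _, _, ite_mem_zero_one a, ite_mem_zero_one b, ite_mem_zero_one c,
    ite_mem_zero_one d, by simpa only [ite_one_zero_inj] using hne, fun i j k => ⟨?_, ?_, ?_, ?_⟩⟩
  · rintro ⟨hij, rfl⟩
    exact dens3_eq_ite (hA _) (hA _) (hA _) (h1 i j hij)
  · rintro ⟨rfl, hjk⟩
    exact dens3_eq_ite (hA _) (hA _) (hA _) (h2 i k hjk)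
  · rintro ⟨hij, hjk⟩
    exact dens3_eq_ite (hA _) (hA _) (hA _) (h3 i j k hij hjk)
  · rintro ⟨rfl, rfl⟩
    exact dens3_eq_ite (hA _) (hA _) (hA _) (h4 i)

theorem PairedBlowup.structB {n m : ℕ} {E : Finset (Finset (Fin n))} (hm : 3 ≤ m)
    (h : PairedBlowup (edgeRel E) m) : StructB n m E := by
  obtain ⟨A, B, hA, hB, hAB, hcA, hcB, b₁, b₂, c₁, c₂, c₃, c₄, c₅, c₆, h1, h2, h3, h4⟩ := h
  have a3 : ∀ i, 3 ≤ (A i).card := fun i => hm.trans (hcA i)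
  have b3 : ∀ i, 3 ≤ (B i).card := fun i => hm.trans (hcB i)
  have hE := symmRel_edgeRel E
  refine ⟨A, B, hA, hB, hAB, hcA, hcB, _, _, _, _, _, _, _, _, ite_mem_zero_one b₁,
    ite_mem_zero_one b₂, ite_mem_zero_one c₁, ite_mem_zero_one c₂, ite_mem_zero_one c₃,
    ite_mem_zero_one c₄, ite_mem_zero_one c₅, ite_mem_zero_one c₆, fun i j hij => ?_,
    fun i j k hij hjk => ?_, ?_, fun i j k => ⟨dens3_eq_zero (h4 i j k).1,
      dens3_eq_zero (h4 i j k).2⟩⟩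
  · obtain ⟨g1, g2, g3, g4⟩ := h1 i j hij
    exact ⟨(dens3_eq_ite (a3 _) (a3 _) (b3 _) g1).trans (if_pos trivial),
      (dens3_eq_ite (b3 _) (a3 _) (b3 _) g2).trans (if_pos trivial),
      dens3_eq_ite (a3 _) (b3 _) (a3 _) g3, dens3_eq_ite (a3 _) (b3 _) (b3 _) g4⟩
  · obtain ⟨g1, g2, g3, g4, g5, g6⟩ := h2 i j k hij hjk
    exact ⟨dens3_eq_ite (a3 _) (a3 _) (b3 _) g1, dens3_eq_ite (a3 _) (b3 _) (a3 _) g2,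
      dens3_eq_ite (a3 _) (b3 _) (b3 _) g3, dens3_eq_ite (b3 _) (a3 _) (a3 _) g4,
      dens3_eq_ite (b3 _) (a3 _) (b3 _) g5, dens3_eq_ite (b3 _) (b3 _) (a3 _) g6⟩
  · rintro X Y Z hX hY hZ (rfl | rfl | rfl)
    · exact dens3_eq_zero (h3 X hX Z hZ)
    · exact dens3_eq_zero (((h3 Y hY X hX).swap₂₃ hE).swap₁₂ hE)
    · exact dens3_eq_zero ((h3 X hX Y hY).swap₂₃ hE)

theorem tripleCount_pos {α : Type} {r : α → α → α → Prop} {T : Finset α} {x y z : α} (hx : x ∈ T)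
    (hy : y ∈ T) (hz : z ∈ T) (hxy : x ≠ y) (hxz : x ≠ z) (hyz : y ≠ z) (h : r x y z) :
    0 < tripleCount r T :=
  Finset.card_pos.2 ⟨(x, y, z), Finset.mem_filter.2 ⟨by simp [hx, hy, hz], hxy, hxz, hyz, h⟩⟩

theorem tripleCount_pos_of_not_isClique3 {n : ℕ} {E : Finset (Finset (Fin n))}
    {T : Finset (Fin n)} (h : ¬ IsClique3 E T) :
    0 < tripleCount (fun x y z => ¬ edgeRel E x y z) T := by
  simp only [IsClique3, not_forall] at h
  obtain ⟨e, heT, hc, he⟩ := h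
  obtain ⟨x, y, z, hxy, hxz, hyz, rfl⟩ := Finset.card_eq_three.1 hc
  exact tripleCount_pos (heT (by simp)) (heT (by simp)) (heT (by simp)) hxy hxz hyz he

theorem tripleCount_pos_of_not_isIndep3 {n : ℕ} {E : Finset (Finset (Fin n))}
    {T : Finset (Fin n)} (h : ¬ IsIndep3 E T) : 0 < tripleCount (edgeRel E) T := by
  simp only [IsIndep3, not_forall, not_not] at h
  obtain ⟨e, heT, hc, he⟩ := h
  obtain ⟨x, y, z, hxy, hxz, hyz, rfl⟩ := Finset.card_eq_three.1 hc
  exact tripleCount_pos (heT (by simp)) (heT (by simp)) (heT (by simp)) hxy hxz hyz he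

theorem ceil_rpow_pow_le {n k s : ℕ} (hn : 8 ^ (k + 1) ≤ n) (hs : 2 * s ≤ k + 1) :
    3 ≤ ⌈(n : ℝ) ^ (1 / ((k : ℝ) + 1))⌉₊ ∧ ⌈(n : ℝ) ^ (1 / ((k : ℝ) + 1))⌉₊ ^ s ≤ n := by
  set x := (n : ℝ) ^ (1 / ((k : ℝ) + 1)) with hx
  have hx0 : 0 ≤ x := by positivity
  have hpow : x ^ (k + 1) = n := by
    rw [hx, one_div, ← Nat.cast_succ]
    exact Real.rpow_inv_natCast_pow (by positivity) (by omega)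
  have h8 : 8 ≤ x := by
    refine le_of_pow_le_pow_left₀ (n := k + 1) (by omega) hx0 ?_
    rw [hpow]
    exact_mod_cast hn
  have hle := Nat.le_ceil x
  have hlt := Nat.ceil_lt_add_one hx0
  constructor
  · have : (3 : ℝ) ≤ (⌈x⌉₊ : ℝ) := by linarith
    exact_mod_cast this
  · have : ((⌈x⌉₊ : ℝ)) ^ s ≤ n := by
      calc (⌈x⌉₊ : ℝ) ^ s ≤ (x ^ 2) ^ s := by gcongr; nlinarith
        _ = x ^ (2 * s) := by rw [pow_mul]
        _ ≤ x ^ (k + 1) := pow_le_pow_right₀ (by linarith) hs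
        _ = n := hpow
    exact_mod_cast this

theorem stmt19 (m : ℕ) (hm : 3 ≤ m) :
    ∃ ε : ℝ, 0 < ε ∧
      ∃ n₀ : ℕ, ∀ n : ℕ, n₀ ≤ n →
        ∀ E : Finset (Finset (Fin n)), (∀ e ∈ E, e.card = 3) →
          (¬ ∃ S : Finset (Fin n), (n : ℝ) ^ ε ≤ (S.card : ℝ) ∧
            (IsClique3 E S ∨ IsIndep3 E S)) →
          (StructA n m E ∨ StructB n m E) ∨
          (StructA n m ((Finset.powersetCard 3 (Finset.univ : Finset (Fin n))) \ E) ∨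
           StructB n m ((Finset.powersetCard 3 (Finset.univ : Finset (Fin n))) \ E)) := by
  by_contra! hcon
  have hcon' := fun k : ℕ => hcon (1 / ((k : ℝ) + 1)) (by positivity) (8 ^ (k + 1))
  choose n hn E _ hhom hAB hAB' using hcon'
  let 𝒰 : Ultrafilter ℕ := hyperfilter ℕ
  let h : ℕ → ℕ := fun k => ⌈(n k : ℝ) ^ (1 / ((k : ℝ) + 1))⌉₊
  have : ∀ k, Nonempty (Fin (n k)) := fun k =>
    Fin.pos_iff_nonempty.1 (lt_of_lt_of_le (by positivity) (hn k))
  have h3 : ∀ᶠ k in 𝒰, 3 ≤ h k :=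
    Eventually.of_forall fun k => (ceil_rpow_pow_le (s := 0) (hn k) (by omega)).1
  have hge : ∀ N : ℕ, ∀ᶠ k : ℕ in (𝒰 : Filter ℕ), N ≤ k := fun N =>
    Filter.Eventually.filter_mono Nat.hyperfilter_le_atTop (eventually_ge_atTop N)
  have hh : ∀ s, ∀ᶠ k in 𝒰, h k ^ s ≤ Fintype.card (Fin (n k)) := fun s =>
    (hge (2 * s)).mono fun k hk => by
      rw [Fintype.card_fin]
      exact (ceil_rpow_pow_le (hn k) (by omega)).2
  have hT : ∀ k, ∀ T : Finset (Fin (n k)), h k ≤ T.card →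
      ¬ IsClique3 (E k) T ∧ ¬ IsIndep3 (E k) T := fun k T hT =>
    hhom k T ((Nat.le_ceil _).trans (Nat.cast_le.2 hT))
  let r : ∀ k, Fin (n k) → Fin (n k) → Fin (n k) → Prop := fun k => edgeRel (E k)
  have hL : LargeFamily (ultraRel 𝒰 r) (polyLargeSets 𝒰) := largeFamily_polyLargeSets h3 hh
    (Eventually.of_forall fun k T h' => tripleCount_pos_of_not_isIndep3 (hT k T h').2)
  have hL' : LargeFamily (fun x y z => ¬ ultraRel 𝒰 r x y z) (polyLargeSets 𝒰) := by
    rw [← ultraRel_not]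
    exact largeFamily_polyLargeSets h3 hh
      (Eventually.of_forall fun k T h' => tripleCount_pos_of_not_isClique3 (hT k T h').1)
  have hne : ∀ S ∈ polyLargeSets 𝒰 (α := fun k => Fin (n k)), S.Nonempty := by
    rintro _ ⟨S, hS, rfl⟩
    exact internalSet_nonempty ((hS.eventually_pow_le (h3.mono fun k hk => by omega) hh 0).mono
      fun k hk => Finset.card_pos.1 (by simpa using hk))
  have embeds : ∀ F, ∃ k, EmbedsOn (ultraRel 𝒰 r) (edgeRel (E k)) F (fun x => ultraRep 𝒰 x k) ∧
      EmbedsOn (fun x y z => ¬ ultraRel 𝒰 r x y z)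
        (edgeRel (Finset.powersetCard 3 Finset.univ \ E k)) F (fun x => ultraRep 𝒰 x k) := by
    intro F
    obtain ⟨k, hinj, hk⟩ := (eventually_transfer r F).exists
    refine ⟨k, ⟨hinj, fun x hx y hy z hz _ _ _ => hk x hx y hy z hz⟩,
      ⟨hinj, fun x hx y hy z hz hxy hxz hyz => ?_⟩⟩
    rw [edgeRel_compl _ (hinj.ne hx hy hxy) (hinj.ne hx hz hxz) (hinj.ne hy hz hyz),
      hk x hx y hy z hz]
  rcases LargeFamily.blowup_or_compl hm (symmRel_ultraRel fun k => symmRel_edgeRel (E k)) hne hL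
    hL' with (h | h) | h | h
  · obtain ⟨F, hF⟩ := h.transfer
    obtain ⟨k, hk, -⟩ := embeds F
    exact (hAB k).1 ((hF hk).structA hm)
  · obtain ⟨F, hF⟩ := h.transfer
    obtain ⟨k, hk, -⟩ := embeds F
    exact (hAB k).2 ((hF hk).structB hm)
  · obtain ⟨F, hF⟩ := h.transfer
    obtain ⟨k, -, hk⟩ := embeds F
    exact (hAB' k).1 ((hF hk).structA hm)
  · obtain ⟨F, hF⟩ := h.transfer
    obtain ⟨k, -, hk⟩ := embeds F
    exact (hAB' k).2 ((hF hk).structB hm)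
end
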